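/- Let (x_*,u_*) be a local minimum of radius R(·) for problem (P). Suppose there exists δ>0 with R(t)≥δ for a.e. t, that the set C̃^{ε,R}_* is compact, and that for all (t,x,u)∈C̃^{ε,R}_* the WBCQ holds at (x,u) and the perturbed constraint map M is calm at (0,x,u). Then there exist an absolutely continuous arc p:[t₀,t₁]→ℝ^{n_x} and a number λ₀∈{0,1} satisfying: (nontriviality) (λ₀,p(t))≠0 for all t∈[t₀,t₁]; (transversality) (p(t₀),−p(t₁))∈λ₀∂f(x_*(t₀),x_*(t₁))+N_S(x_*(t₀),x_*(t₁)); (Euler adjoint inclusion) for a.e. t, (ṗ(t),0)∈∂^C(⟨−p(t),φ⟩+λ₀F)(x_*(t),u_*(t))+{0}×N^C_U(u_*(t))+co{∂⟨λ,Φ⟩(x_*(t),u_*(t)) : λ∈N_Ω(Φ(x_*(t),u_*(t)))}; (Weierstrass condition of radius R) for a.e. t, whenever Φ(x_*(t),u)∈Ω, u∈U and |u−u_*(t)|<R(t), one has ⟨p(t),φ(x_*(t),u)⟩−λ₀F(x_*(t),u)≤⟨p(t),φ(x_*(t),u_*(t))⟩−λ₀F(x_*(t),u_*(t)). Moreover,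 in the case of free end point, λ₀ can be taken as 1. -/

import Mathlib

open Filter Topology Set MeasureTheory
open scoped RealInnerProductSpace ENNReal NNReal

noncomputable section

abbrev Euc (n : ℕ) : Type := EuclideanSpace ℝ (Fin n)

abbrev PL2 (α β : Type) : Type := WithLp 2 (α × β)

abbrev PL3 (α β γ : Type) : Type := PL2 α (PL2 β γ)

def pl2 {α β : Type} (a : α) (b : β) : PL2 α β := (WithLp.equiv 2 (α × β)).symm (a, b)

def pl2fst {α β : Type} (z : PL2 α β) : α := (WithLp.equiv 2 (α × β) z).1

def pl2snd {α β : Type} (z : PL2 α β) : β := (WithLp.equiv 2 (α × β) z).2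

def pl3 {α β γ : Type} (a : α) (b : β) (c : γ) : PL3 α β γ := pl2 a (pl2 b c)

section Variational

variable {E : Type} [NormedAddCommGroup E] [InnerProductSpace ℝ E]

/-- Fréchet normal cone. -/
def frechetNC (C : Set E) (x : E) : Set E :=
  {v | ∀ ε > 0, ∃ δ > 0, ∀ y ∈ C, ‖y - x‖ < δ → ⟪v, y - x⟫ ≤ ε * ‖y - x‖}

/-- Limiting (Mordukhovich) normal cone. -/
def limitingNC (C : Set E) (x : E) : Set E :=
  {v | ∃ xs vs : ℕ → E, (∀ n, xs n ∈ C ∧ vs n ∈ frechetNC C (xs n)) ∧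
      Tendsto xs atTop (𝓝 x) ∧ Tendsto vs atTop (𝓝 v)}

/-- Clarke normal cone: closed convex hull of the limiting normal cone. -/
def clarkeNC (C : Set E) (x : E) : Set E := closure (convexHull ℝ (limitingNC C x))

def NormallyRegular (C : Set E) : Prop := ∀ x ∈ C, frechetNC C x = limitingNC C x

/-- Proximal subdifferential of a real-valued function. -/
def proxSubdiff (g : E → ℝ) (x : E) : Set E :=
  {ζ | ∃ σ > 0, ∃ δ > 0, ∀ y, ‖y - x‖ < δ →
    g x + ⟪ζ, y - x⟫ - σ * ‖y - x‖ ^ 2 ≤ g y}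

/-- Limiting (Mordukhovich) subdifferential. -/
def limSubdiff (g : E → ℝ) (x : E) : Set E :=
  {ζ | ∃ xs ζs : ℕ → E, (∀ n, ζs n ∈ proxSubdiff g (xs n)) ∧
      Tendsto xs atTop (𝓝 x) ∧ Tendsto (fun n => g (xs n)) atTop (𝓝 (g x)) ∧
      Tendsto ζs atTop (𝓝 ζ)}

/-- Clarke generalized gradient: convex hull of the limiting subdifferential. -/
def clarkeSubdiff (g : E → ℝ) (x : E) : Set E := convexHull ℝ (limSubdiff g x)

/-- Tangent (contingent) cone. -/
def tangentC (C : Set E) (x : E) : Set E :=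
  {w | ∃ (t : ℕ → ℝ) (ws : ℕ → E), (∀ n, 0 < t n ∧ x + t n • ws n ∈ C) ∧
      Tendsto t atTop (𝓝 0) ∧ Tendsto ws atTop (𝓝 w)}

/-- Directional limiting normal cone in direction `w`. -/
def dirLimitingNC (C : Set E) (x : E) (w : E) : Set E :=
  {v | ∃ (t : ℕ → ℝ) (ws vs : ℕ → E),
      (∀ n, 0 < t n ∧ vs n ∈ frechetNC C (x + t n • ws n)) ∧
      Tendsto t atTop (𝓝 0) ∧ Tendsto ws atTop (𝓝 w) ∧ Tendsto vs atTop (𝓝 v)}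

end Variational

section Maps

variable {F G : Type} [NormedAddCommGroup F] [NormedAddCommGroup G]

/-- Calmness of a set-valued map at a point of its graph (neighborhood-ball form). -/
def Calm (Ψ : F → Set G) (x₀ : F) (y₀ : G) : Prop :=
  ∃ μ : ℝ, 0 ≤ μ ∧ ∃ Ux ∈ 𝓝 x₀, ∃ Vy ∈ 𝓝 y₀,
    ∀ x ∈ Ux, ∀ y ∈ Ψ x ∩ Vy, ∃ z ∈ Ψ x₀, ‖y - z‖ ≤ μ * ‖x - x₀‖

/-- Upper Lipschitz continuity at a point. -/
def UpperLipschitzAt (Ψ : F → Set G) (x₀ : F) : Prop :=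
  ∃ μ : ℝ, 0 ≤ μ ∧ ∃ Ux ∈ 𝓝 x₀,
    ∀ x ∈ Ux, ∀ y ∈ Ψ x, ∃ z ∈ Ψ x₀, ‖y - z‖ ≤ μ * ‖x - x₀‖

end Maps

/-- An absolutely continuous arc on `[t0,t1]` with values in `ℝ^n`,
recorded together with its a.e. derivative. -/
structure Arc (n : ℕ) (t0 t1 : ℝ) where
  f : ℝ → Euc n
  d : ℝ → Euc n
  intble : IntervalIntegrable d volume t0 t1
  rel : ∀ t ∈ Set.Icc t0 t1, f t = f t0 + ∫ s in t0..t, d s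


namespace ProblemP

variable {nx nu dd : ℕ} {t0 t1 : ℝ}

/-- The cost functional `J(x,u) = ∫ F(x(t),u(t)) dt + f(x(t₀),x(t₁))`. -/
def Jcost (F : PL2 (Euc nx) (Euc nu) → ℝ) (f : PL2 (Euc nx) (Euc nx) → ℝ)
    (x : Arc nx t0 t1) (u : ℝ → Euc nu) : ℝ :=
  (∫ t in t0..t1, F (pl2 (x.f t) (u t))) + f (pl2 (x.f t0) (x.f t1))

/-- Admissible pairs of problem (P). -/
def Admissible (φ : PL2 (Euc nx) (Euc nu) → Euc nx) (Φ : PL2 (Euc nx) (Euc nu) → Euc dd)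
    (Uset : Set (Euc nu)) (Om : Set (Euc dd)) (S : Set (PL2 (Euc nx) (Euc nx)))
    (x : Arc nx t0 t1) (u : ℝ → Euc nu) : Prop :=
  Measurable u ∧
  (∀ᵐ t ∂(volume.restrict (Set.Icc t0 t1)),
    x.d t = φ (pl2 (x.f t) (u t)) ∧ Φ (pl2 (x.f t) (u t)) ∈ Om ∧ u t ∈ Uset) ∧
  pl2 (x.f t0) (x.f t1) ∈ S

/-- `(x_*,u_*)` is a local minimum of radius `R(·)` for problem (P). -/
def IsLocalMinOfRadius (F : PL2 (Euc nx) (Euc nu) → ℝ) (f : PL2 (Euc nx) (Euc nx) → ℝ)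
    (φ : PL2 (Euc nx) (Euc nu) → Euc nx) (Φ : PL2 (Euc nx) (Euc nu) → Euc dd)
    (Uset : Set (Euc nu)) (Om : Set (Euc dd)) (S : Set (PL2 (Euc nx) (Euc nx)))
    (ε : ℝ) (R : ℝ → ℝ≥0∞) (xs : Arc nx t0 t1) (us : ℝ → Euc nu) : Prop :=
  Admissible φ Φ Uset Om S xs us ∧
  ∀ (x : Arc nx t0 t1) (u : ℝ → Euc nu), Admissible φ Φ Uset Om S x u →
    (∀ᵐ t ∂(volume.restrict (Set.Icc t0 t1)),
      ‖x.f t - xs.f t‖ ≤ ε ∧ (‖u t - us t‖₊ : ℝ≥0∞) ≤ R t) →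
    (∫ t in t0..t1, ‖x.d t - xs.d t‖) ≤ ε →
    Jcost F f xs us ≤ Jcost F f x u

/-- The weak basic constraint qualification (WBCQ) at `(x,u)`. -/
def WBCQ (Φ : PL2 (Euc nx) (Euc nu) → Euc dd)
    (Uset : Set (Euc nu)) (Om : Set (Euc dd)) (x : Euc nx) (u : Euc nu) : Prop :=
  ∀ (lam : Euc dd) (α : Euc nx),
    lam ∈ limitingNC Om (Φ (pl2 x u)) →
    (∃ a ∈ limSubdiff (fun z => ⟪lam, Φ z⟫) (pl2 x u),
      ∃ η ∈ limitingNC Uset u, pl2 α 0 = a + pl2 0 η) →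
    α = 0

/-- The perturbed constraint map `M(Θ) = {(x,u) ∈ ℝ^{n_x} × U : Φ(x,u)+Θ ∈ Ω}`. -/
def Mmap (Φ : PL2 (Euc nx) (Euc nu) → Euc dd)
    (Uset : Set (Euc nu)) (Om : Set (Euc dd)) : Euc dd → Set (PL2 (Euc nx) (Euc nu)) :=
  fun Θ => {z | pl2snd z ∈ Uset ∧ Φ z + Θ ∈ Om}

/-- The set `C̃^{ε,R}_*`. -/
def Ctil (Φ : PL2 (Euc nx) (Euc nu) → Euc dd)
    (Uset : Set (Euc nu)) (Om : Set (Euc dd)) (ε : ℝ) (R : ℝ → ℝ≥0∞)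
    (xs : Arc nx t0 t1) (us : ℝ → Euc nu) : Set (ℝ × Euc nx × Euc nu) :=
  closure {q : ℝ × Euc nx × Euc nu | q.1 ∈ Set.Icc t0 t1 ∧ ‖q.2.1 - xs.f q.1‖ ≤ ε ∧
    q.2.2 ∈ Uset ∧ Φ (pl2 q.2.1 q.2.2) ∈ Om ∧ (‖q.2.2 - us q.1‖₊ : ℝ≥0∞) ≤ R q.1}

end ProblemP

section NonsmoothCalculus

variable {E : Type} [NormedAddCommGroup E]

/-- `g` is `K`-Lipschitz on the closed ball of radius `r` about `z`. -/
def LipOnBall (g : E → ℝ) (K : ℝ) (z : E) (r : ℝ) : Prop :=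
  ∀ x y, ‖x - z‖ ≤ r → ‖y - z‖ ≤ r → |g x - g y| ≤ K * ‖x - y‖

theorem LipOnBall.mono {g : E → ℝ} {K : ℝ} {z z' : E} {r r' : ℝ} (h : LipOnBall g K z r)
    (hr : ‖z' - z‖ + r' ≤ r) : LipOnBall g K z' r' := by
  intro x y hx hy
  refine h x y ?_ ?_
  · have := norm_sub_le_norm_sub_add_norm_sub x z' z
    linarith
  · have := norm_sub_le_norm_sub_add_norm_sub y z' z
    linarith

theorem LipOnBall.continuousOn {g : E → ℝ} {K : ℝ} {z : E} {r : ℝ} (h : LipOnBall g K z r) :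
    ContinuousOn g (Metric.closedBall z r) := by
  have : LipschitzOnWith (Real.toNNReal K) g (Metric.closedBall z r) := by
    refine LipschitzOnWith.of_dist_le_mul fun x hx y hy => ?_
    rw [Real.dist_eq, dist_eq_norm]
    refine (h x y (by simpa [dist_eq_norm] using hx) (by simpa [dist_eq_norm] using hy)).trans ?_
    exact mul_le_mul_of_nonneg_right (Real.le_coe_toNNReal K) (norm_nonneg _)
  exact this.continuousOn

theorem LocallyLipschitz.exists_ball {G : Type} [NormedAddCommGroup G] {g : E → G}
    (h : LocallyLipschitz g) (z : E) : ∃ K > 0, ∃ r > 0, ∀ x y, ‖x - z‖ ≤ r → ‖y - z‖ ≤ r →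
      ‖g x - g y‖ ≤ K * ‖x - y‖ := by
  obtain ⟨K, t, ht, hK⟩ := h z
  obtain ⟨r, hr, hrt⟩ := Metric.mem_nhds_iff.1 ht
  refine ⟨K + 1, by positivity, r / 2, by positivity, fun x y hx hy => ?_⟩
  have hx' : x ∈ t := hrt (by rw [Metric.mem_ball, dist_eq_norm]; linarith)
  have hy' : y ∈ t := hrt (by rw [Metric.mem_ball, dist_eq_norm]; linarith)
  have := hK.dist_le_mul x hx' y hy'
  rw [dist_eq_norm, dist_eq_norm] at this
  nlinarith [norm_nonneg (x - y)]

variable [InnerProductSpace ℝ E]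

theorem norm_le_of_mem_proxSubdiff {g : E → ℝ} {K r : ℝ} {z x ζ : E} (h : LipOnBall g K z r)
    (hx : ‖x - z‖ < r) (hK : 0 ≤ K) (hζ : ζ ∈ proxSubdiff g x) : ‖ζ‖ ≤ K := by
  obtain ⟨σ, hσ, δ, hδ, hp⟩ := hζ
  by_contra! hlt
  have hζ0 : 0 < ‖ζ‖ := hK.trans_lt hlt
  set τ := min (min (δ / 2) ((r - ‖x - z‖) / 2)) ((‖ζ‖ - K) / (2 * σ)) with hτ
  have hτ0 : 0 < τ := by
    refine lt_min (lt_min (by positivity) ?_) (div_pos (by linarith) (by positivity))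
    linarith
  have h1 : τ ≤ δ / 2 := (min_le_left _ _).trans (min_le_left _ _)
  have h2 : τ ≤ (r - ‖x - z‖) / 2 := (min_le_left _ _).trans (min_le_right _ _)
  have h3 : τ * σ ≤ (‖ζ‖ - K) / 2 := by
    have : τ ≤ (‖ζ‖ - K) / (2 * σ) := min_le_right _ _
    rw [le_div_iff₀ (by positivity)] at this
    linarith
  set y := x + (τ / ‖ζ‖) • ζ with hy
  have hyx : y - x = (τ / ‖ζ‖) • ζ := by simp [hy]
  have hn : ‖y - x‖ = τ := by
    rw [hyx, norm_smul, Real.norm_of_nonneg (by positivity)]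
    field_simp
  have hin : ⟪ζ, y - x⟫ = τ * ‖ζ‖ := by
    rw [hyx, inner_smul_right, real_inner_self_eq_norm_sq]
    field_simp
  have e1 := hp y (by rw [hn]; linarith)
  have hyz : ‖y - z‖ ≤ r := by
    have := norm_sub_le_norm_sub_add_norm_sub y x z
    linarith
  have e2 := h y x hyz hx.le
  rw [hin, hn] at e1
  rw [hn] at e2
  have e3 := (abs_le.1 e2).2
  nlinarith

theorem smul_mem_frechetNC {C : Set E} {x w : E} (h : w ∈ frechetNC C x) {c : ℝ} (hc : 0 ≤ c) :
    c • w ∈ frechetNC C x := by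
  intro ε hε
  obtain ⟨δ, hδ, hd⟩ := h (ε / (c + 1)) (by positivity)
  refine ⟨δ, hδ, fun y hy hyx => ?_⟩
  have := hd y hy hyx
  rw [real_inner_smul_left]
  calc c * ⟪w, y - x⟫ ≤ c * (ε / (c + 1) * ‖y - x‖) := by gcongr
    _ = (c / (c + 1)) * (ε * ‖y - x‖) := by ring
    _ ≤ 1 * (ε * ‖y - x‖) := by
        gcongr
        rw [div_le_one (by positivity)]; linarith
    _ = _ := one_mul _

theorem smul_mem_limitingNC {C : Set E} {x w : E} (h : w ∈ limitingNC C x) {c : ℝ} (hc : 0 ≤ c) :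
    c • w ∈ limitingNC C x := by
  obtain ⟨xs, vs, h1, h2, h3⟩ := h
  exact ⟨xs, fun n => c • vs n, fun n => ⟨(h1 n).1, smul_mem_frechetNC (h1 n).2 hc⟩, h2,
    h3.const_smul c⟩

theorem mem_frechetNC_of_quadratic {C : Set E} {x w : E} {r κ : ℝ} (hr : 0 < r) (hκ : 0 < κ)
    (h : ∀ y ∈ C, ‖y - x‖ ≤ r → ⟪w, y - x⟫ ≤ κ * ‖y - x‖ ^ 2) : w ∈ frechetNC C x := by
  intro ε hε
  refine ⟨min r (ε / κ), lt_min hr (by positivity), fun y hy hyx => ?_⟩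
  have h1 := h y hy (hyx.le.trans (min_le_left _ _))
  have h2 : κ * ‖y - x‖ ≤ ε := by
    have := hyx.le.trans (min_le_right _ _)
    rw [le_div_iff₀ hκ] at this
    linarith
  nlinarith [norm_nonneg (y - x)]

variable [FiniteDimensional ℝ E]

/-- Fuzzy sum rule: at an approximate local minimum of a Lipschitz function over a closed set,
a proximal subgradient and a Fréchet normal at nearby points nearly add up. -/
theorem exists_fuzzy_sum {g : E → ℝ} {C : Set E} {z₀ v : E} {K r s σ η : ℝ} (hC : IsClosed C)
    (hz₀ : z₀ ∈ C) (hr : 0 < r) (hs : 0 ≤ s) (hσ : 0 ≤ σ) (hη : 0 < η)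
    (hg : LipOnBall g K z₀ r)
    (hmin : ∀ z ∈ C, ‖z - z₀‖ ≤ r →
      g z₀ + ⟪v, z - z₀⟫ - s * ‖z - z₀‖ - σ * ‖z - z₀‖ ^ 2 ≤ g z) :
    ∃ z' c ζ w, ‖z' - z₀‖ < η ∧ ‖c - z₀‖ < η ∧ c ∈ C ∧ ζ ∈ proxSubdiff g z' ∧
      w ∈ frechetNC C c ∧ ‖ζ + w - v‖ ≤ 4 * s + η := by
  have : ProperSpace E := FiniteDimensional.proper ℝ E
  set η₀ := min η r / 2 with hη₀
  have hη₀0 : 0 < η₀ := by have := lt_min hη hr; positivity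
  have hη₀η : η₀ ≤ η / 2 := by rw [hη₀]; linarith [min_le_left η r]
  have hη₀r : η₀ ≤ r / 2 := by rw [hη₀]; linarith [min_le_right η r]
  set Q' := max (σ + 1) (4 * s / η₀) with hQ'
  have hQ'σ : σ + 1 ≤ Q' := le_max_left _ _
  have hQ'0 : 0 < Q' := by linarith
  have hQ's : s / Q' ≤ η₀ / 4 := by
    have : 4 * s / η₀ ≤ Q' := le_max_right _ _
    rw [div_le_iff₀ hη₀0] at this
    rw [div_le_iff₀ hQ'0]
    linarith
  set Q := σ + Q' with hQ
  have hQ2 : Q ≤ 2 * Q' := by linarith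
  have hQ0 : 0 < Q := by linarith
  set t := min (η₀ / 8) (η / (4 * Q')) with ht
  have ht0 : 0 < t := lt_min (by positivity) (by positivity)
  have ht1 : t ≤ η₀ / 8 := min_le_left _ _
  have ht2 : 4 * Q' * t ≤ η := by
    have : t ≤ η / (4 * Q') := min_le_right _ _
    rw [le_div_iff₀ (by positivity)] at this
    linarith
  obtain ⟨j, hj⟩ : ∃ j : ℝ, j > 0 ∧ K ^ 2 / 4 < j * (Q' * t ^ 2) ∧
      (K + s * η₀ / (η₀ / 4)) / (η₀ / 4) < j := by
    refine ⟨max (K ^ 2 / 4 / (Q' * t ^ 2)) ((K + s * η₀ / (η₀ / 4)) / (η₀ / 4)) + 1, ?_, ?_, ?_⟩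
    · have : 0 ≤ K ^ 2 / 4 / (Q' * t ^ 2) := by positivity
      linarith [le_max_left (K ^ 2 / 4 / (Q' * t ^ 2)) ((K + s * η₀ / (η₀ / 4)) / (η₀ / 4))]
    · have := le_max_left (K ^ 2 / 4 / (Q' * t ^ 2)) ((K + s * η₀ / (η₀ / 4)) / (η₀ / 4))
      rw [← div_lt_iff₀ (by positivity)]
      linarith
    · linarith [le_max_right (K ^ 2 / 4 / (Q' * t ^ 2)) ((K + s * η₀ / (η₀ / 4)) / (η₀ / 4))]
  obtain ⟨hj0, hj1, hj2⟩ := hj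
  set B := Metric.closedBall z₀ r with hB
  have hmemB : ∀ y, y ∈ B ↔ ‖y - z₀‖ ≤ r := fun y => by rw [hB, Metric.mem_closedBall, dist_eq_norm]
  let ψ : E × E → ℝ := fun q => g q.1 - ⟪v, q.2⟫ + Q * ‖q.2 - z₀‖ ^ 2 + j * ‖q.1 - q.2‖ ^ 2
  have hcpt : IsCompact (B ×ˢ (C ∩ B)) :=
    (isCompact_closedBall z₀ r).prod ((isCompact_closedBall z₀ r).inter_left hC)
  have hz₀B : z₀ ∈ B := by rw [hmemB]; simpa using hr.le
  have hψ : ContinuousOn ψ (B ×ˢ (C ∩ B)) := by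
    have h1 : ContinuousOn (fun q : E × E => g q.1) (B ×ˢ (C ∩ B)) :=
      hg.continuousOn.comp continuousOn_fst fun q hq => hq.1
    have h2 : Continuous fun q : E × E => ⟪v, q.2⟫ := by fun_prop
    have h3 : Continuous fun q : E × E => Q * ‖q.2 - z₀‖ ^ 2 + j * ‖q.1 - q.2‖ ^ 2 := by fun_prop
    refine ((h1.sub h2.continuousOn).add h3.continuousOn).congr fun q _ => ?_
    simp only [ψ, Pi.add_apply, Pi.sub_apply]; ring
  obtain ⟨⟨z', c⟩, hzc, hmin'⟩ := hcpt.exists_isMinOn ⟨(z₀, z₀), hz₀B, hz₀, hz₀B⟩ hψ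
  obtain ⟨hz'B, hcC, hcB⟩ := hzc
  simp only at hz'B hcC hcB
  have hval : ∀ y ∈ B, ∀ d ∈ C, d ∈ B → g z' - ⟪v, c⟫ + Q * ‖c - z₀‖ ^ 2 + j * ‖z' - c‖ ^ 2 ≤
      g y - ⟪v, d⟫ + Q * ‖d - z₀‖ ^ 2 + j * ‖y - d‖ ^ 2 := fun y hy d hd hdB =>
    hmin' (show (y, d) ∈ B ×ˢ (C ∩ B) from ⟨hy, hd, hdB⟩)
  set d := ‖c - z₀‖ with hd
  set e := ‖z' - c‖ with he
  have hd0 : 0 ≤ d := norm_nonneg _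
  have he0 : 0 ≤ e := norm_nonneg _
  have hkey : Q' * d ^ 2 + j * e ^ 2 ≤ K * e + s * d := by
    have h1 := hval z₀ hz₀B z₀ hz₀ hz₀B
    have h2 := (abs_le.1 (hg z' c ((hmemB _).1 hz'B) ((hmemB _).1 hcB))).1
    have h3 := hmin c hcC ((hmemB _).1 hcB)
    rw [inner_sub_right] at h3
    simp only [sub_self, norm_zero] at h1
    rw [← hd] at h3
    rw [← he] at h2
    have : Q * d ^ 2 = σ * d ^ 2 + Q' * d ^ 2 := by rw [hQ]; ring
    linarith
  have hde : d ≤ s / Q' + t := by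
    by_contra! hlt
    have h1 : s + Q' * t < Q' * d := by
      have : Q' * (s / Q' + t) < Q' * d := by gcongr
      rwa [mul_add, mul_div_cancel₀ _ hQ'0.ne'] at this
    have h2 : t < d := by
      have : 0 ≤ s / Q' := by positivity
      linarith
    have h3 : Q' * t ^ 2 < d * (Q' * d - s) := by nlinarith
    have h4 : j * (d * (Q' * d - s)) ≤ K ^ 2 / 4 := by nlinarith [sq_nonneg (j * e - K / 2)]
    nlinarith
  have hdη : d ≤ 3 / 8 * η₀ := by linarith
  have heη : e < η₀ / 4 := by
    by_contra! hle
    have h1 : (K + s * η₀ / (η₀ / 4)) < j * (η₀ / 4) := by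
      rwa [div_lt_iff₀ (by positivity)] at hj2
    have h1' : s * η₀ / (η₀ / 4) = 4 * s := by field_simp
    rw [h1'] at h1
    have h2 : s * d ≤ s * (4 * e) := by gcongr; linarith
    have h3 : j * e ^ 2 ≤ (K + 4 * s) * e := by linarith [mul_nonneg hQ'0.le (sq_nonneg d)]
    have h4 : e > 0 := by linarith
    have h5 : j * (η₀ / 4) * e ≤ j * e ^ 2 := by
      rw [pow_two, ← mul_assoc]; gcongr
    have h6 : (K + 4 * s) * e < j * (η₀ / 4) * e := by gcongr
    linarith
  have hz'd : ‖z' - z₀‖ < η₀ := by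
    have := norm_sub_le_norm_sub_add_norm_sub z' c z₀
    rw [← hd, ← he] at this
    linarith
  refine ⟨z', c, (2 * j) • (c - z'), v - (2 * Q) • (c - z₀) - (2 * j) • (c - z'), by linarith,
    by rw [← hd]; linarith, hcC, ?_, ?_, ?_⟩
  · refine ⟨j, hj0, r / 2, by positivity, fun y hy => ?_⟩
    have hyB : y ∈ B := by
      rw [hmemB]
      have := norm_sub_le_norm_sub_add_norm_sub y z' z₀
      linarith
    have h1 := hval y hyB c hcC hcB
    have h2 : ‖y - c‖ ^ 2 = ‖y - z'‖ ^ 2 + 2 * ⟪y - z', z' - c⟫ + ‖z' - c‖ ^ 2 := by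
      rw [← norm_add_sq_real]; congr 2; abel
    have h3 : ⟪(2 * j) • (c - z'), y - z'⟫ = - (2 * j * ⟪y - z', z' - c⟫) := by
      rw [real_inner_smul_left, real_inner_comm, ← neg_sub z' c, inner_neg_right]; ring
    rw [h3]
    rw [h2, ← he] at h1
    linarith
  · refine mem_frechetNC_of_quadratic (r := r / 2) (κ := Q + j) (by positivity) (by positivity)
      fun y hy hyc => ?_
    have hyB : y ∈ B := by
      rw [hmemB]
      have := norm_sub_le_norm_sub_add_norm_sub y c z₀
      rw [← hd] at this
      linarith
    have h1 := hval z' hz'B y hy hyB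
    have h2 : ‖y - z₀‖ ^ 2 = ‖y - c‖ ^ 2 + 2 * ⟪y - c, c - z₀⟫ + ‖c - z₀‖ ^ 2 := by
      rw [← norm_add_sq_real]; congr 2; abel
    have h3 : ‖z' - y‖ ^ 2 = ‖y - c‖ ^ 2 + 2 * ⟪y - c, c - z'⟫ + ‖z' - c‖ ^ 2 := by
      rw [norm_sub_rev z' y, norm_sub_rev z' c, ← norm_add_sq_real]; congr 2; abel
    rw [h2, h3, ← hd, ← he] at h1
    have h4 : ⟪v, y⟫ = ⟪v, y - c⟫ + ⟪v, c⟫ := by rw [inner_sub_right]; ring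
    rw [inner_sub_left, inner_sub_left, real_inner_smul_left, real_inner_smul_left,
      real_inner_comm (y - c) (c - z₀), real_inner_comm (y - c) (c - z')]
    linarith
  · have h1 : (2 * j) • (c - z') + (v - (2 * Q) • (c - z₀) - (2 * j) • (c - z')) - v =
      - ((2 * Q) • (c - z₀)) := by abel
    rw [h1, norm_neg, norm_smul, Real.norm_of_nonneg (by positivity), ← hd]
    have h2 : Q' * d ≤ s + Q' * t := by
      have : Q' * d ≤ Q' * (s / Q' + t) := by gcongr
      rwa [mul_add, mul_div_cancel₀ _ hQ'0.ne'] at this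
    nlinarith

/-- Limiting form of the sum rule along approximate minimizers. -/
theorem exists_limiting_sum {g : E → ℝ} {C : Set E} {z v : E} {K r : ℝ} (hC : IsClosed C)
    (hr : 0 < r) (hK : 0 ≤ K) (hg : LipOnBall g K z r) {zs vs : ℕ → E} {s : ℕ → ℝ}
    (hzC : ∀ n, zs n ∈ C) (hz : Tendsto zs atTop (𝓝 z)) (hv : Tendsto vs atTop (𝓝 v))
    (hs : Tendsto s atTop (𝓝 0)) (hs0 : ∀ n, 0 ≤ s n)
    (hmin : ∀ᶠ n in atTop, ∃ ρ > 0, ∃ σ ≥ 0, ∀ y ∈ C, ‖y - zs n‖ ≤ ρ →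
      g (zs n) + ⟪vs n, y - zs n⟫ - s n * ‖y - zs n‖ - σ * ‖y - zs n‖ ^ 2 ≤ g y) :
    ∃ ζ ∈ limSubdiff g z, ∃ w ∈ limitingNC C z, v = ζ + w := by
  have : ProperSpace E := FiniteDimensional.proper ℝ E
  have hpos : ∀ n : ℕ, 0 < min (1 / ((n : ℝ) + 1)) (r / 2) := fun n =>
    lt_min (by positivity) (by positivity)
  have hev : ∀ᶠ n in atTop, ∃ q : E × E × E × E, ‖q.1 - zs n‖ < min (1 / ((n : ℝ) + 1)) (r / 2) ∧
      ‖q.2.1 - zs n‖ < min (1 / ((n : ℝ) + 1)) (r / 2) ∧ q.2.1 ∈ C ∧ q.2.2.1 ∈ proxSubdiff g q.1 ∧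
      q.2.2.2 ∈ frechetNC C q.2.1 ∧
      ‖q.2.2.1 + q.2.2.2 - vs n‖ ≤ 4 * s n + min (1 / ((n : ℝ) + 1)) (r / 2) ∧ ‖q.2.2.1‖ ≤ K := by
    have hb : ∀ᶠ n in atTop, ‖zs n - z‖ < r / 2 := by
      have :=
        (tendsto_iff_norm_sub_tendsto_zero.1 hz).eventually_lt_const (show 0 < r / 2 by positivity)
      exact this
    filter_upwards [hmin, hb] with n hn hbn
    obtain ⟨ρ, hρ, σ, hσ, hm⟩ := hn
    have hl : LipOnBall g K (zs n) (min ρ (r / 2)) :=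
      hg.mono (by linarith [min_le_right ρ (r / 2)])
    obtain ⟨z', c, ζ, w, h1, h2, h3, h4, h5, h6⟩ := exists_fuzzy_sum hC (hzC n)
      (lt_min hρ (by positivity : 0 < r / 2)) (hs0 n) hσ (hpos n) hl
      (fun y hy hyn => hm y hy (hyn.trans (min_le_left _ _)))
    refine ⟨(z', c, ζ, w), h1, h2, h3, h4, h5, h6, ?_⟩
    refine norm_le_of_mem_proxSubdiff hg ?_ hK h4
    have := norm_sub_le_norm_sub_add_norm_sub z' (zs n) z
    have := h1.trans_le (min_le_right (1 / ((n : ℝ) + 1)) (r / 2))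
    linarith
  obtain ⟨N, hN⟩ := eventually_atTop.1 hev
  have hN' : ∀ n : ℕ, ∃ q : E × E × E × E, _ := fun n => hN (n + N) (by omega)
  choose q hq1 hq2 hq3 hq4 hq5 hq6 hq7 using hN'
  have hcb : ∀ n, (q n).2.2.1 ∈ Metric.closedBall (0 : E) K := fun n => by
    simpa using hq7 n
  obtain ⟨ζ, -, τ, hτ, hζ⟩ := (isCompact_closedBall (0 : E) K).tendsto_subseq hcb
  have hτN : Tendsto (fun n => τ n + N) atTop atTop :=
    tendsto_atTop_mono (fun n => Nat.le_add_right _ _) hτ.tendsto_atTop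
  have hsm : Tendsto (fun n : ℕ => min (1 / ((n : ℝ) + 1)) (r / 2)) atTop (𝓝 0) := by
    refine squeeze_zero (fun n => (hpos n).le) (fun n => min_le_left _ _) ?_
    exact tendsto_one_div_add_atTop_nhds_zero_nat
  have hz1 : Tendsto (fun n => (q (τ n)).1) atTop (𝓝 z) := by
    have h1 : Tendsto (fun n => (q (τ n)).1 - zs (τ n + N)) atTop (𝓝 0) :=
      squeeze_zero_norm (fun n => (hq1 (τ n)).le) (hsm.comp hτN)
    have := h1.add (hz.comp hτN)
    simpa using this
  have hc1 : Tendsto (fun n => (q (τ n)).2.1) atTop (𝓝 z) := by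
    have h1 : Tendsto (fun n => (q (τ n)).2.1 - zs (τ n + N)) atTop (𝓝 0) :=
      squeeze_zero_norm (fun n => (hq2 (τ n)).le) (hsm.comp hτN)
    have := h1.add (hz.comp hτN)
    simpa using this
  have hw : Tendsto (fun n => (q (τ n)).2.2.2) atTop (𝓝 (v - ζ)) := by
    have h1 : Tendsto (fun n => (q (τ n)).2.2.1 + (q (τ n)).2.2.2 - vs (τ n + N)) atTop (𝓝 0) := by
      refine squeeze_zero_norm (fun n => hq6 (τ n)) ?_
      have := ((hs.comp hτN).const_mul 4).add (hsm.comp hτN)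
      simpa using this
    have := (h1.add (hv.comp hτN)).sub hζ
    simp only [zero_add] at this
    refine this.congr fun n => ?_
    simp only [Function.comp]
    abel
  refine ⟨ζ, ⟨fun n => (q (τ n)).1, fun n => (q (τ n)).2.2.1, fun n => hq4 _, hz1, ?_, hζ⟩,
    v - ζ, ⟨fun n => (q (τ n)).2.1, fun n => (q (τ n)).2.2.2, fun n => ⟨hq3 _, hq5 _⟩, hc1, hw⟩,
    by abel⟩
  have : ContinuousAt g z := hg.continuousOn.continuousAt (Metric.closedBall_mem_nhds z hr)
  exact this.tendsto.comp hz1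

end NonsmoothCalculus

section ProductSpace

variable {X Y : Type}

@[simp] theorem pl2fst_pl2 (a : X) (b : Y) : pl2fst (pl2 a b) = a := rfl

@[simp] theorem pl2snd_pl2 (a : X) (b : Y) : pl2snd (pl2 a b) = b := rfl

@[simp] theorem pl2_eta (z : PL2 X Y) : pl2 (pl2fst z) (pl2snd z) = z := rfl

theorem pl2_ext {z w : PL2 X Y} (h₁ : pl2fst z = pl2fst w) (h₂ : pl2snd z = pl2snd w) : z = w := by
  rw [← pl2_eta z, ← pl2_eta w, h₁, h₂]

variable [NormedAddCommGroup X] [NormedAddCommGroup Y]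

@[simp] theorem pl2fst_add (z w : PL2 X Y) : pl2fst (z + w) = pl2fst z + pl2fst w := rfl

@[simp] theorem pl2snd_add (z w : PL2 X Y) : pl2snd (z + w) = pl2snd z + pl2snd w := rfl

@[simp] theorem pl2fst_sub (z w : PL2 X Y) : pl2fst (z - w) = pl2fst z - pl2fst w := rfl

@[simp] theorem pl2snd_sub (z w : PL2 X Y) : pl2snd (z - w) = pl2snd z - pl2snd w := rfl

@[simp] theorem pl2fst_neg (z : PL2 X Y) : pl2fst (-z) = -pl2fst z := rfl

@[simp] theorem pl2snd_neg (z : PL2 X Y) : pl2snd (-z) = -pl2snd z := rfl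

@[simp] theorem pl2fst_zero : pl2fst (0 : PL2 X Y) = 0 := rfl

@[simp] theorem pl2snd_zero : pl2snd (0 : PL2 X Y) = 0 := rfl

@[fun_prop]
theorem continuous_pl2fst : Continuous (pl2fst : PL2 X Y → X) :=
  WithLp.prod_continuous_ofLp 2 X Y |>.fst

@[fun_prop]
theorem continuous_pl2snd : Continuous (pl2snd : PL2 X Y → Y) :=
  WithLp.prod_continuous_ofLp 2 X Y |>.snd

theorem continuous_pl2 : Continuous fun q : X × Y => pl2 q.1 q.2 :=
  WithLp.prod_continuous_toLp 2 X Y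

theorem Filter.Tendsto.pl2 {T : Type*} {l : Filter T} {f : T → X} {g : T → Y} {a : X} {b : Y}
    (hf : Tendsto f l (𝓝 a)) (hg : Tendsto g l (𝓝 b)) :
    Tendsto (fun t => pl2 (f t) (g t)) l (𝓝 (pl2 a b)) :=
  (continuous_pl2.tendsto (a, b)).comp (hf.prodMk_nhds hg)

theorem Filter.Tendsto.pl2fst {T : Type*} {l : Filter T} {f : T → PL2 X Y} {a : PL2 X Y}
    (hf : Tendsto f l (𝓝 a)) : Tendsto (fun t => pl2fst (f t)) l (𝓝 (pl2fst a)) :=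
  (continuous_pl2fst.tendsto a).comp hf

theorem Filter.Tendsto.pl2snd {T : Type*} {l : Filter T} {f : T → PL2 X Y} {a : PL2 X Y}
    (hf : Tendsto f l (𝓝 a)) : Tendsto (fun t => pl2snd (f t)) l (𝓝 (pl2snd a)) :=
  (continuous_pl2snd.tendsto a).comp hf

variable [InnerProductSpace ℝ X] [InnerProductSpace ℝ Y]

@[simp] theorem pl2fst_smul (c : ℝ) (z : PL2 X Y) : pl2fst (c • z) = c • pl2fst z := rfl

@[simp] theorem pl2snd_smul (c : ℝ) (z : PL2 X Y) : pl2snd (c • z) = c • pl2snd z := rfl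

theorem inner_pl2 (z w : PL2 X Y) :
    ⟪z, w⟫ = ⟪pl2fst z, pl2fst w⟫ + ⟪pl2snd z, pl2snd w⟫ :=
  WithLp.prod_inner_apply z w

theorem norm_sq_pl2 (z : PL2 X Y) : ‖z‖ ^ 2 = ‖pl2fst z‖ ^ 2 + ‖pl2snd z‖ ^ 2 := by
  rw [← real_inner_self_eq_norm_sq, inner_pl2, real_inner_self_eq_norm_sq,
    real_inner_self_eq_norm_sq]

theorem norm_pl2fst_le (z : PL2 X Y) : ‖pl2fst z‖ ≤ ‖z‖ :=
  abs_le_of_sq_le_sq' (by rw [norm_sq_pl2 z]; nlinarith [norm_nonneg (pl2snd z)])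
    (norm_nonneg _) |>.2

theorem norm_pl2snd_le (z : PL2 X Y) : ‖pl2snd z‖ ≤ ‖z‖ :=
  abs_le_of_sq_le_sq' (by rw [norm_sq_pl2 z]; nlinarith [norm_nonneg (pl2fst z)])
    (norm_nonneg _) |>.2

theorem norm_le_pl2 (z : PL2 X Y) : ‖z‖ ≤ ‖pl2fst z‖ + ‖pl2snd z‖ :=
  abs_le_of_sq_le_sq' (by
    rw [norm_sq_pl2 z]
    nlinarith [mul_nonneg (norm_nonneg (pl2fst z)) (norm_nonneg (pl2snd z))]) (by positivity) |>.2

theorem frechetNC_prod {A : Set X} {B : Set Y} {z w : PL2 X Y}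
    (hz₁ : pl2fst z ∈ A) (hz₂ : pl2snd z ∈ B)
    (hw : w ∈ frechetNC {q : PL2 X Y | pl2fst q ∈ A ∧ pl2snd q ∈ B} z) :
    pl2fst w ∈ frechetNC A (pl2fst z) ∧ pl2snd w ∈ frechetNC B (pl2snd z) := by
  constructor
  · intro ε hε
    obtain ⟨δ, hδ, h⟩ := hw ε hε
    refine ⟨δ, hδ, fun y hy hyz => ?_⟩
    have hn : ‖pl2 y (pl2snd z) - z‖ = ‖y - pl2fst z‖ := by
      rw [← abs_of_nonneg (norm_nonneg (pl2 y (pl2snd z) - z)),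
        ← abs_of_nonneg (norm_nonneg (y - pl2fst z)), ← sq_eq_sq_iff_abs_eq_abs, norm_sq_pl2]
      simp
    have := h (pl2 y (pl2snd z)) ⟨by simpa using hy, by simpa using hz₂⟩ (by rw [hn]; exact hyz)
    rw [hn, inner_pl2] at this
    simpa using this
  · intro ε hε
    obtain ⟨δ, hδ, h⟩ := hw ε hε
    refine ⟨δ, hδ, fun y hy hyz => ?_⟩
    have hn : ‖pl2 (pl2fst z) y - z‖ = ‖y - pl2snd z‖ := by
      rw [← abs_of_nonneg (norm_nonneg (pl2 (pl2fst z) y - z)),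
        ← abs_of_nonneg (norm_nonneg (y - pl2snd z)), ← sq_eq_sq_iff_abs_eq_abs, norm_sq_pl2]
      simp
    have := h (pl2 (pl2fst z) y) ⟨by simpa using hz₁, by simpa using hy⟩ (by rw [hn]; exact hyz)
    rw [hn, inner_pl2] at this
    simpa using this

end ProductSpace

section Robustness

variable {E : Type} [NormedAddCommGroup E] [InnerProductSpace ℝ E]

theorem frechetNC_univ (x : E) : frechetNC (univ : Set E) x = {0} := by
  ext w
  refine ⟨fun hw => ?_, ?_⟩
  · by_contra h0
    have hw0 : 0 < ‖w‖ := norm_pos_iff.2 h0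
    obtain ⟨δ, hδ, h⟩ := hw (‖w‖ / 2) (by positivity)
    have e : (x + (δ / 2 / ‖w‖) • w) - x = (δ / 2 / ‖w‖) • w := by abel
    have hn : ‖(x + (δ / 2 / ‖w‖) • w) - x‖ = δ / 2 := by
      rw [e, norm_smul, Real.norm_of_nonneg (by positivity)]; field_simp
    have := h (x + (δ / 2 / ‖w‖) • w) (mem_univ _) (by rw [hn]; linarith)
    rw [hn, e, inner_smul_right, real_inner_self_eq_norm_sq] at this
    have e2 : δ / 2 / ‖w‖ * ‖w‖ ^ 2 = δ / 2 * ‖w‖ := by field_simp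
    rw [e2] at this
    nlinarith
  · rintro rfl ε hε
    exact ⟨1, one_pos, fun y _ _ => by rw [inner_zero_left]; positivity⟩

theorem limitingNC_univ (x : E) : limitingNC (univ : Set E) x = {0} := by
  ext w
  refine ⟨?_, ?_⟩
  · rintro ⟨xs, vs, h1, -, h3⟩
    have : vs = fun _ => 0 := by
      ext n
      have := (h1 n).2
      rw [frechetNC_univ] at this
      exact this
    rw [this] at h3
    exact tendsto_nhds_unique h3 tendsto_const_nhds
  · rintro rfl
    refine ⟨fun _ => x, fun _ => 0, fun n => ⟨mem_univ _, ?_⟩, tendsto_const_nhds,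
      tendsto_const_nhds⟩
    rw [frechetNC_univ]; rfl

/-- The limiting normal cone mapping has closed graph. -/
theorem limitingNC_closed_graph {C : Set E} {x v : E} {xs vs : ℕ → E}
    (h : ∀ n, vs n ∈ limitingNC C (xs n)) (hx : Tendsto xs atTop (𝓝 x))
    (hv : Tendsto vs atTop (𝓝 v)) : v ∈ limitingNC C x := by
  have : ∀ n : ℕ, ∃ q : E × E, q.1 ∈ C ∧ q.2 ∈ frechetNC C q.1 ∧
      ‖q.1 - xs n‖ < 1 / ((n : ℝ) + 1) ∧ ‖q.2 - vs n‖ < 1 / ((n : ℝ) + 1) := by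
    intro n
    obtain ⟨ys, ws, h1, h2, h3⟩ := h n
    have hp : (0 : ℝ) < 1 / ((n : ℝ) + 1) := by positivity
    obtain ⟨m, hm⟩ := ((((tendsto_iff_norm_sub_tendsto_zero.1 h2).eventually_lt_const hp).and
      ((tendsto_iff_norm_sub_tendsto_zero.1 h3).eventually_lt_const hp))).exists
    exact ⟨(ys m, ws m), (h1 m).1, (h1 m).2, hm.1, hm.2⟩
  choose q h1 h2 h3 h4 using this
  refine ⟨fun n => (q n).1, fun n => (q n).2, fun n => ⟨h1 n, h2 n⟩, ?_, ?_⟩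
  · have e := squeeze_zero_norm (fun n => (h3 n).le) tendsto_one_div_add_atTop_nhds_zero_nat
    simpa using e.add hx
  · have e := squeeze_zero_norm (fun n => (h4 n).le) tendsto_one_div_add_atTop_nhds_zero_nat
    simpa using e.add hv

theorem smul_mem_limSubdiff {g : E → ℝ} {x ζ : E} (h : ζ ∈ limSubdiff g x) {c : ℝ} (hc : 0 < c) :
    c • ζ ∈ limSubdiff (fun z => c * g z) x := by
  obtain ⟨xs, ζs, h1, h2, h3, h4⟩ := h
  refine ⟨xs, fun n => c • ζs n, fun n => ?_, h2, h3.const_mul c, h4.const_smul c⟩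
  obtain ⟨σ, hσ, δ, hδ, hp⟩ := h1 n
  refine ⟨c * σ, by positivity, δ, hδ, fun y hy => ?_⟩
  have := mul_le_mul_of_nonneg_left (hp y hy) hc.le
  rw [real_inner_smul_left]
  linarith

theorem limSubdiff_zero (x : E) : limSubdiff (fun _ : E => (0 : ℝ)) x ⊆ {0} := by
  rintro ζ ⟨xs, ζs, h1, -, -, h4⟩
  have : ∀ n, ζs n = 0 := fun n => by
    have hl : LipOnBall (fun _ : E => (0 : ℝ)) 0 (xs n) 1 := fun x y _ _ => by simp
    exact norm_le_zero_iff.1 (norm_le_of_mem_proxSubdiff hl (by simp) le_rfl (h1 n))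
  have e : ζs = fun _ => 0 := funext this
  rw [e] at h4
  exact tendsto_nhds_unique h4 tendsto_const_nhds

variable [FiniteDimensional ℝ E]

theorem limSubdiff_nonempty {g : E → ℝ} (hg : LocallyLipschitz g) (x : E) :
    (limSubdiff g x).Nonempty := by
  obtain ⟨K, hK, r, hr, h⟩ := hg.exists_ball x
  have hl : LipOnBall g K x r := fun a b ha hb => by simpa using h a b ha hb
  obtain ⟨ζ, hζ, -⟩ := exists_limiting_sum (C := {x}) (v := 0) (zs := fun _ => x)
    (vs := fun _ => 0) (s := fun _ => 0) isClosed_singleton hr hK.le hl (fun _ => rfl)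
    tendsto_const_nhds tendsto_const_nhds tendsto_const_nhds (fun _ => le_rfl)
    (Eventually.of_forall fun n => ⟨1, one_pos, 0, le_rfl, by
      rintro y rfl -
      simp⟩)
  exact ⟨ζ, hζ⟩

theorem LocallyLipschitz.lipOnBall_inner {Z D : Type} [NormedAddCommGroup Z]
    [NormedAddCommGroup D] [InnerProductSpace ℝ D] {Φ : Z → D} {K r : ℝ} {z : Z}
    (h : ∀ x y, ‖x - z‖ ≤ r → ‖y - z‖ ≤ r → ‖Φ x - Φ y‖ ≤ K * ‖x - y‖) (lam : D) :
    LipOnBall (fun z => ⟪lam, Φ z⟫) (‖lam‖ * K) z r := by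
  intro x y hx hy
  simp only
  rw [← inner_sub_right]
  refine (abs_real_inner_le_norm _ _).trans ?_
  rw [mul_assoc]
  gcongr
  exact h x y hx hy

theorem mem_limSubdiff_inner_of_tendsto {D : Type} [NormedAddCommGroup D] [InnerProductSpace ℝ D]
    {Φ : E → D} (hΦ : LocallyLipschitz Φ) {z ζ : E} {lam : D} {zs ζs : ℕ → E} {lams : ℕ → D}
    (hz : Tendsto zs atTop (𝓝 z)) (hζ : Tendsto ζs atTop (𝓝 ζ)) (hl : Tendsto lams atTop (𝓝 lam))
    (h : ∀ n, ζs n ∈ proxSubdiff (fun z => ⟪lams n, Φ z⟫) (zs n)) :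
    ζ ∈ limSubdiff (fun z => ⟪lam, Φ z⟫) z := by
  obtain ⟨K, hK, r, hr, hb⟩ := hΦ.exists_ball z
  have hs : Tendsto (fun n => ‖lams n - lam‖ * K) atTop (𝓝 0) := by
    simpa using (tendsto_iff_norm_sub_tendsto_zero.1 hl).mul_const K
  obtain ⟨ζ', hζ', w, hw, e⟩ := exists_limiting_sum (C := univ) (v := ζ) isClosed_univ hr
    (by positivity) (LocallyLipschitz.lipOnBall_inner hb lam) (fun _ => mem_univ _) hz hζ hs
    (fun n => by positivity) (by
      filter_upwards [(tendsto_iff_norm_sub_tendsto_zero.1 hz).eventually_lt_const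
        (show 0 < r / 2 by positivity)] with n hn
      obtain ⟨σ, hσ, δ, hδ, hp⟩ := h n
      refine ⟨min (δ / 2) (r / 2), lt_min (by positivity) (by positivity), σ, hσ.le,
        fun y _ hy => ?_⟩
      have h1 := hp y (by linarith [min_le_left (δ / 2) (r / 2)])
      have h2 : ‖y - z‖ ≤ r := by
        have := norm_sub_le_norm_sub_add_norm_sub y (zs n) z
        linarith [min_le_right (δ / 2) (r / 2)]
      have h3 := hb y (zs n) h2 (by linarith)
      have h4 : ⟪lams n - lam, Φ y - Φ (zs n)⟫ ≤ ‖lams n - lam‖ * (K * ‖y - zs n‖) :=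
        (real_inner_le_norm _ _).trans (by gcongr)
      simp only [inner_sub_left, inner_sub_right] at h4 h1 ⊢
      linarith)
  rw [limitingNC_univ] at hw
  rw [e, show w = 0 from hw, add_zero]
  exact hζ'

end Robustness

section ConstraintSystem

variable {X Y D : Type} [NormedAddCommGroup X] [NormedAddCommGroup Y] [NormedAddCommGroup D]

/-- The set of pairs satisfying the control and the mixed constraint. -/
def feasibleSet (Φ : PL2 X Y → D) (U : Set Y) (Om : Set D) : Set (PL2 X Y) :=
  {z | pl2snd z ∈ U ∧ Φ z ∈ Om}

theorem isClosed_feasibleSet {Φ : PL2 X Y → D} {U : Set Y} {Om : Set D} (hΦ : Continuous Φ)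
    (hU : IsClosed U) (hOm : IsClosed Om) : IsClosed (feasibleSet Φ U Om) :=
  (hU.preimage continuous_pl2snd).inter (hOm.preimage hΦ)

variable [InnerProductSpace ℝ X] [InnerProductSpace ℝ Y]

/-- Exact penalization of the constraint by calmness. -/
theorem Calm.penalty {Φ : PL2 X Y → D} (hΦ : Continuous Φ) {U : Set Y} {Om : Set D}
    {z₀ : PL2 X Y} (hcalm : Calm (fun Θ => {z | pl2snd z ∈ U ∧ Φ z + Θ ∈ Om}) 0 z₀) :
    ∃ μ ≥ 0, ∀ᶠ z₁ in 𝓝 z₀, z₁ ∈ feasibleSet Φ U Om → ∀ v ∈ frechetNC (feasibleSet Φ U Om) z₁,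
      ∀ ε > 0, ∃ ρ > 0, ∀ z, pl2snd z ∈ U → ∀ ω ∈ Om, ‖z - z₁‖ ≤ ρ → ‖ω - Φ z₁‖ ≤ ρ →
        ⟪v, z - z₁⟫ ≤ ε * ‖z - z₁‖ + (‖v‖ + ε) * μ * ‖Φ z - ω‖ := by
  obtain ⟨μ, hμ, Ux, hUx, Vy, hVy, hc⟩ := hcalm
  obtain ⟨a, ha, hUa⟩ := Metric.mem_nhds_iff.1 hUx
  refine ⟨μ, hμ, ?_⟩
  filter_upwards [eventually_mem_nhds_iff.2 hVy] with z₁ hV hz₁ v hv ε hε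
  obtain ⟨δ, hδ, hd⟩ := hv ε hε
  have hcont : Tendsto (fun q : PL2 X Y × D => ‖Φ q.1 - q.2‖) (𝓝 (z₁, Φ z₁)) (𝓝 0) := by
    have : Continuous fun q : PL2 X Y × D => ‖Φ q.1 - q.2‖ := by fun_prop
    simpa using this.tendsto (z₁, Φ z₁)
  have e1 : ∀ᶠ q in 𝓝 (z₁, Φ z₁), ‖Φ q.1 - q.2‖ < min a (δ / 2 / (μ + 1)) :=
    hcont.eventually_lt_const (lt_min ha (by positivity))
  have e2 : ∀ᶠ q in 𝓝 (z₁, Φ z₁), q.1 ∈ Vy := continuousAt_fst.eventually_mem hV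
  obtain ⟨ρ, hρ, hb⟩ := Metric.eventually_nhds_iff.1 (e1.and e2)
  refine ⟨min (ρ / 2) (δ / 3), by positivity, fun z hzU ω hω hz hωn => ?_⟩
  obtain ⟨h1, h2⟩ := @hb (z, ω) (by
    rw [Prod.dist_eq, dist_eq_norm, dist_eq_norm]
    refine max_lt ?_ ?_
    · exact (hz.trans (min_le_left _ _)).trans_lt (by linarith)
    · exact (hωn.trans (min_le_left _ _)).trans_lt (by linarith))
  simp only at h1 h2
  obtain ⟨z', hz', hzz⟩ := hc (ω - Φ z) (hUa (by
    rw [Metric.mem_ball, dist_eq_norm, sub_zero, norm_sub_rev]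
    exact h1.trans_le (min_le_left _ _))) z ⟨⟨hzU, by simpa using hω⟩, h2⟩
  rw [sub_zero, norm_sub_rev ω] at hzz
  have hz'f : z' ∈ feasibleSet Φ U Om := ⟨hz'.1, by simpa using hz'.2⟩
  have h3 : μ * ‖Φ z - ω‖ ≤ δ / 2 := by
    have := (h1.trans_le (min_le_right _ _)).le
    rw [le_div_iff₀ (by positivity)] at this
    nlinarith [norm_nonneg (Φ z - ω)]
  have h4 : ‖z' - z₁‖ ≤ μ * ‖Φ z - ω‖ + ‖z - z₁‖ := by
    have := norm_sub_le_norm_sub_add_norm_sub z' z z₁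
    rw [norm_sub_rev z' z] at this
    linarith
  have h5 := hd z' hz'f (by
    have := hz.trans (min_le_right _ _)
    linarith)
  have h6 : ⟪v, z - z'⟫ ≤ ‖v‖ * (μ * ‖Φ z - ω‖) :=
    (real_inner_le_norm _ _).trans (by gcongr)
  have h7 : ⟪v, z - z₁⟫ = ⟪v, z - z'⟫ + ⟪v, z' - z₁⟫ := by rw [← inner_add_right]; congr 1; abel
  have h8 := mul_le_mul_of_nonneg_left h4 hε.le
  rw [h7]
  linarith

variable [InnerProductSpace ℝ D]

theorem fst_mem_proxSubdiff_of_penalty {Z : Type} [NormedAddCommGroup Z] [InnerProductSpace ℝ Z]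
    {Φ : Z → D} (hΦ : LocallyLipschitz Φ) {κ : ℝ} {q ζ : PL2 Z D}
    (hζ : ζ ∈ proxSubdiff (fun q : PL2 Z D => κ * ‖Φ (pl2fst q) - pl2snd q‖) q) :
    pl2fst ζ ∈ proxSubdiff (fun z => ⟪-pl2snd ζ, Φ z⟫) (pl2fst q) := by
  obtain ⟨σ, hσ, δ, hδ, hp⟩ := hζ
  obtain ⟨K, hK, r, hr, hL⟩ := hΦ.exists_ball (pl2fst q)
  refine ⟨σ * (1 + K ^ 2), by positivity, min r (δ / (1 + K)), lt_min hr (by positivity),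
    fun z hz => ?_⟩
  have h1 : ‖Φ z - Φ (pl2fst q)‖ ≤ K * ‖z - pl2fst q‖ :=
    hL _ _ (hz.le.trans (min_le_left _ _)) (by simpa using hr.le)
  have h2 : (1 + K) * ‖z - pl2fst q‖ < δ := by
    have := hz.trans_le (min_le_right _ _)
    rw [lt_div_iff₀ (by positivity)] at this
    linarith
  have h3 := hp (pl2 z (pl2snd q + Φ z - Φ (pl2fst q))) (by
    refine (norm_le_pl2 _).trans_lt ?_
    simp only [pl2fst_sub, pl2snd_sub, pl2fst_pl2, pl2snd_pl2]
    rw [show pl2snd q + Φ z - Φ (pl2fst q) - pl2snd q = Φ z - Φ (pl2fst q) by abel]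
    linarith)
  rw [inner_pl2, norm_sq_pl2] at h3
  simp only [pl2fst_sub, pl2snd_sub, pl2fst_pl2, pl2snd_pl2] at h3
  rw [show pl2snd q + Φ z - Φ (pl2fst q) - pl2snd q = Φ z - Φ (pl2fst q) by abel,
    show Φ z - (pl2snd q + Φ z - Φ (pl2fst q)) = Φ (pl2fst q) - pl2snd q by abel] at h3
  have h4 : ‖Φ z - Φ (pl2fst q)‖ ^ 2 ≤ K ^ 2 * ‖z - pl2fst q‖ ^ 2 := by
    rw [← mul_pow]
    gcongr
  have h5 := mul_le_mul_of_nonneg_left h4 hσ.le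
  simp only [inner_neg_left]
  rw [inner_sub_right (pl2snd ζ)] at h3
  nlinarith

end ConstraintSystem

section ConstraintNormals

variable {X Y D : Type} [NormedAddCommGroup X] [InnerProductSpace ℝ X] [NormedAddCommGroup Y]
  [InnerProductSpace ℝ Y] [NormedAddCommGroup D] [InnerProductSpace ℝ D]

theorem lipOnBall_penalty {Z : Type} [NormedAddCommGroup Z] [InnerProductSpace ℝ Z]
    {Φ : Z → D} {κ K r : ℝ} {z : Z} (hκ : 0 ≤ κ)
    (h : ∀ x y, ‖x - z‖ ≤ r → ‖y - z‖ ≤ r → ‖Φ x - Φ y‖ ≤ K * ‖x - y‖) (ω : D) :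
    LipOnBall (fun q : PL2 Z D => κ * ‖Φ (pl2fst q) - pl2snd q‖) (κ * (|K| + 1)) (pl2 z ω) r := by
  intro q q' hq hq'
  have h1 := h (pl2fst q) (pl2fst q') ((norm_pl2fst_le (q - pl2 z ω)).trans hq)
    ((norm_pl2fst_le (q' - pl2 z ω)).trans hq')
  have h2 : K * ‖pl2fst q - pl2fst q'‖ ≤ |K| * ‖q - q'‖ :=
    (mul_le_mul_of_nonneg_right (le_abs_self K) (norm_nonneg _)).trans
      (mul_le_mul_of_nonneg_left (norm_pl2fst_le (q - q')) (abs_nonneg K))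
  have h3 := norm_pl2snd_le (q - q')
  rw [pl2snd_sub] at h3
  rw [← mul_sub, abs_mul, abs_of_nonneg hκ, mul_assoc]
  refine mul_le_mul_of_nonneg_left ((abs_norm_sub_norm_le _ _).trans ?_) hκ
  rw [show Φ (pl2fst q) - pl2snd q - (Φ (pl2fst q') - pl2snd q')
    = (Φ (pl2fst q) - Φ (pl2fst q')) - (pl2snd q - pl2snd q') by abel]
  refine (norm_sub_le _ _).trans ?_
  linarith

variable [FiniteDimensional ℝ X] [FiniteDimensional ℝ Y] [FiniteDimensional ℝ D]

theorem exists_multiplier_of_mem_limitingNC {Φ : PL2 X Y → D} (hΦ : LocallyLipschitz Φ) {U : Set Y}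
    {Om : Set D} (hU : IsClosed U) (hOm : IsClosed Om) {z₀ v : PL2 X Y}
    (hcalm : Calm (fun Θ => {z | pl2snd z ∈ U ∧ Φ z + Θ ∈ Om}) 0 z₀)
    (hv : v ∈ limitingNC (feasibleSet Φ U Om) z₀) :
    ∃ lam ∈ limitingNC Om (Φ z₀), ∃ a ∈ limSubdiff (fun z => ⟪lam, Φ z⟫) z₀,
      ∃ η ∈ limitingNC U (pl2snd z₀), v = a + pl2 0 η := by
  obtain ⟨μ, hμ, hpen⟩ := hcalm.penalty hΦ.continuous
  obtain ⟨K, hK, r, hr, hL⟩ := hΦ.exists_ball z₀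
  obtain ⟨zs, vs, hzv, hz, hvs⟩ := hv
  set κ := (‖v‖ + 2) * μ with hκ
  have hκ0 : 0 ≤ κ := by positivity
  set g : PL2 (PL2 X Y) D → ℝ := fun q => κ * ‖Φ (pl2fst q) - pl2snd q‖ with hg
  set C : Set (PL2 (PL2 X Y) D) := {q | pl2fst q ∈ {z : PL2 X Y | pl2fst z ∈ univ ∧ pl2snd z ∈ U} ∧
    pl2snd q ∈ Om} with hC
  have hCc : IsClosed C := by
    have hU' : IsClosed {z : PL2 X Y | pl2fst z ∈ univ ∧ pl2snd z ∈ U} := by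
      simp only [mem_univ, true_and]
      exact hU.preimage continuous_pl2snd
    exact (hU'.preimage continuous_pl2fst).inter (hOm.preimage continuous_pl2snd)
  have hgl : LipOnBall g (κ * (|K| + 1)) (pl2 z₀ (Φ z₀)) r := lipOnBall_penalty hκ0 hL _
  have hz' : Tendsto (fun n => pl2 (zs n) (Φ (zs n))) atTop (𝓝 (pl2 z₀ (Φ z₀))) :=
    hz.pl2 ((hΦ.continuous.tendsto _).comp hz)
  have hev : ∀ᶠ n in atTop, ‖vs n‖ < ‖v‖ + 1 := hvs.norm.eventually_lt_const (by linarith)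
  have hev2 : ∀ᶠ n in atTop, ‖pl2 (zs n) (Φ (zs n)) - pl2 z₀ (Φ z₀)‖ < r / 2 := by
    have := (hz'.sub_const (pl2 z₀ (Φ z₀))).norm
    rw [sub_self, norm_zero] at this
    exact this.eventually_lt_const (by positivity)
  have key : ∀ᶠ n in atTop, ∀ ε : ℝ, 0 < ε → ε ≤ 1 → ∃ z' c ζ w : PL2 (PL2 X Y) D,
      ‖z' - pl2 (zs n) (Φ (zs n))‖ < ε ∧ ‖c - pl2 (zs n) (Φ (zs n))‖ < ε ∧ c ∈ C ∧
      ζ ∈ proxSubdiff g z' ∧ w ∈ frechetNC C c ∧ ‖ζ + w - pl2 (vs n) 0‖ ≤ 4 * ε + ε := by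
    filter_upwards [hz.eventually hpen, hev, hev2] with n hn hvn hrn ε hε hε1
    obtain ⟨ρ, hρ, hd⟩ := hn (hzv n).1 (vs n) (hzv n).2 ε hε
    refine exists_fuzzy_sum (K := κ * (|K| + 1)) (r := min ρ (r / 2)) (σ := 0) hCc
      ⟨by simpa using (hzv n).1.1, by simpa using (hzv n).1.2⟩ (by positivity) hε.le le_rfl hε
      (hgl.mono (by linarith [min_le_right ρ (r / 2)])) fun q hq hqn => ?_
    have hqn' := hqn.trans (min_le_left _ _)
    have h1 := (norm_pl2fst_le _).trans hqn'
    have h2 := (norm_pl2snd_le _).trans hqn'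
    have h0 := norm_pl2fst_le (q - pl2 (zs n) (Φ (zs n)))
    rw [pl2fst_sub, pl2fst_pl2] at h1 h0
    rw [pl2snd_sub, pl2snd_pl2] at h2
    have h3 := hd (pl2fst q) hq.1.2 (pl2snd q) hq.2 h1 h2
    have h4 : (‖vs n‖ + ε) * μ * ‖Φ (pl2fst q) - pl2snd q‖ ≤ κ * ‖Φ (pl2fst q) - pl2snd q‖ := by
      refine mul_le_mul_of_nonneg_right (mul_le_mul_of_nonneg_right ?_ hμ) (norm_nonneg _)
      linarith
    have h5 : ε * ‖pl2fst q - zs n‖ ≤ ε * ‖q - pl2 (zs n) (Φ (zs n))‖ := by gcongr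
    simp only [hg, inner_pl2, pl2fst_sub, pl2snd_sub, pl2fst_pl2, pl2snd_pl2, sub_self, norm_zero,
      mul_zero, inner_zero_left, add_zero, zero_mul, sub_zero, zero_add]
    simp only [inner_pl2, pl2fst_sub, pl2snd_sub] at h3
    linarith
  obtain ⟨n₀, hn₀⟩ := eventually_atTop.1 key
  have hpos : ∀ n : ℕ, (0 : ℝ) < 1 / ((n : ℝ) + 1) := fun n => by positivity
  have hle : ∀ n : ℕ, 1 / ((n : ℝ) + 1) ≤ 1 := fun n => by
    rw [div_le_one (by positivity)]
    linarith [(n.cast_nonneg : (0 : ℝ) ≤ n)]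
  choose z' c ζ w hz'n hcn hcC hζ hw hsum using fun n : ℕ =>
    hn₀ (n + n₀) (Nat.le_add_left _ _) (1 / ((n : ℝ) + 1)) (hpos n) (hle n)
  have hsh : Tendsto (fun n => n + n₀) atTop atTop := tendsto_add_atTop_nat n₀
  have h10 : Tendsto (fun n : ℕ => 1 / ((n : ℝ) + 1)) atTop (𝓝 0) :=
    tendsto_one_div_add_atTop_nhds_zero_nat
  have close : ∀ y : ℕ → PL2 (PL2 X Y) D,
      (∀ n, ‖y n - pl2 (zs (n + n₀)) (Φ (zs (n + n₀)))‖ < 1 / ((n : ℝ) + 1)) →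
      Tendsto y atTop (𝓝 (pl2 z₀ (Φ z₀))) := fun y hy => by
    have := (squeeze_zero_norm (fun n => (hy n).le) h10).add (hz'.comp hsh)
    simpa using this
  have hz't := close z' hz'n
  have hct := close c hcn
  have hζb : ∀ᶠ n in atTop, ζ n ∈ Metric.closedBall (0 : PL2 (PL2 X Y) D) (κ * (|K| + 1)) := by
    filter_upwards [(Metric.tendsto_nhds.1 hz't) r hr] with n hn
    rw [mem_closedBall_zero_iff]
    exact norm_le_of_mem_proxSubdiff hgl (by rwa [dist_eq_norm] at hn) (by positivity) (hζ n)
  have : ProperSpace (PL2 (PL2 X Y) D) := FiniteDimensional.proper ℝ _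
  obtain ⟨ζ₀, -, φ, hφ, hζt⟩ := (isCompact_closedBall _ _).tendsto_subseq' hζb.frequently
  have hvt : Tendsto (fun n => pl2 (vs (n + n₀)) (0 : D)) atTop (𝓝 (pl2 v 0)) :=
    (hvs.comp hsh).pl2 tendsto_const_nhds
  have hwt : Tendsto (fun n => w (φ n)) atTop (𝓝 (pl2 v 0 - ζ₀)) := by
    have h1 : Tendsto (fun n => ζ n + w n - pl2 (vs (n + n₀)) 0) atTop (𝓝 0) :=
      squeeze_zero_norm hsum (by simpa using (h10.const_mul 4).add h10)
    have h2 := ((h1.comp hφ.tendsto_atTop).add (hvt.comp hφ.tendsto_atTop)).sub hζt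
    simpa using h2
  have hwn : ∀ n, pl2fst (w n) ∈ frechetNC {z : PL2 X Y | pl2fst z ∈ univ ∧ pl2snd z ∈ U}
      (pl2fst (c n))
      ∧ pl2snd (w n) ∈ frechetNC Om (pl2snd (c n)) := fun n =>
    frechetNC_prod (hcC n).1 (hcC n).2 (hw n)
  have hwn' := fun n => frechetNC_prod (hcC n).1.1 (hcC n).1.2 (hwn n).1
  have hctφ := hct.comp hφ.tendsto_atTop
  refine ⟨-pl2snd ζ₀, ⟨fun n => pl2snd (c (φ n)), fun n => pl2snd (w (φ n)),
    fun n => ⟨(hcC _).2, (hwn _).2⟩, hctφ.pl2snd, ?_⟩, pl2fst ζ₀, ?_, pl2snd v - pl2snd (pl2fst ζ₀),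
    ⟨fun n => pl2snd (pl2fst (c (φ n))), fun n => pl2snd (pl2fst (w (φ n))),
      fun n => ⟨(hcC _).1.2, (hwn' _).2⟩, hctφ.pl2fst.pl2snd, ?_⟩, ?_⟩
  · simpa using hwt.pl2snd
  · exact mem_limSubdiff_inner_of_tendsto hΦ (hz't.comp hφ.tendsto_atTop).pl2fst hζt.pl2fst
      hζt.pl2snd.neg fun n => fst_mem_proxSubdiff_of_penalty hΦ (hζ (φ n))
  · simpa using hwt.pl2fst.pl2snd
  · have h0 : ∀ n, pl2fst (pl2fst (w n)) = 0 := fun n => by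
      have := (hwn' n).1
      rw [frechetNC_univ] at this
      exact this
    have h1 := hwt.pl2fst.pl2fst
    simp only [h0] at h1
    have h2 := tendsto_nhds_unique h1 tendsto_const_nhds
    simp only [pl2fst_sub, pl2fst_pl2] at h2
    refine pl2_ext ?_ ?_
    · rw [pl2fst_add, pl2fst_pl2, add_zero]
      exact sub_eq_zero.1 h2
    · simp

end ConstraintNormals

section Aubin

theorem one_le_norm_of_mem_proxSubdiff_norm_sub {E : Type} [NormedAddCommGroup E]
    [InnerProductSpace ℝ E] {x y ζ : E} (hxy : y ≠ x)
    (hζ : ζ ∈ proxSubdiff (fun y => ‖y - x‖) y) : 1 ≤ ‖ζ‖ := by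
  obtain ⟨σ, hσ, δ, hδ, hp⟩ := hζ
  have hn : 0 < ‖y - x‖ := norm_pos_iff.2 (sub_ne_zero.2 hxy)
  set d := ‖y - x‖ with hd
  by_contra! hlt
  set τ := min (min (1 / 2) (δ / (2 * d))) ((1 - ‖ζ‖) / (2 * σ * d)) with hτ
  have hτ0 : 0 < τ := by
    have : 0 < 1 - ‖ζ‖ := by linarith
    positivity
  have hτ1 : τ ≤ 1 / 2 := (min_le_left _ _).trans (min_le_left _ _)
  have hτ2 : τ * (2 * d) ≤ δ := by
    rw [← le_div_iff₀ (by positivity)]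
    exact (min_le_left _ _).trans (min_le_right _ _)
  have hτ3 : τ * (2 * σ * d) ≤ 1 - ‖ζ‖ := by
    rw [← le_div_iff₀ (by positivity)]
    exact min_le_right _ _
  have h1 := hp (y - τ • (y - x)) (by
    rw [sub_sub_cancel_left, norm_neg, norm_smul, Real.norm_of_nonneg hτ0.le, ← hd]
    nlinarith)
  simp only at h1
  rw [sub_sub_cancel_left, norm_neg, inner_neg_right, real_inner_smul_right, norm_smul,
    Real.norm_of_nonneg hτ0.le, show y - τ • (y - x) - x = (1 - τ) • (y - x) by
      rw [sub_smul, one_smul]; abel, norm_smul, Real.norm_of_nonneg (by linarith : 0 ≤ 1 - τ),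
    ← hd] at h1
  have h2 : ⟪ζ, y - x⟫ ≤ ‖ζ‖ * d := real_inner_le_norm _ _
  have h3 : τ * ⟪ζ, y - x⟫ ≤ τ * (‖ζ‖ * d) := by gcongr
  have h4 : τ * d ≤ τ * d * (‖ζ‖ + σ * τ * d) := by nlinarith
  have h5 : 1 ≤ ‖ζ‖ + σ * τ * d := by
    by_contra! h
    nlinarith [mul_pos hτ0 hn]
  nlinarith

variable {X Y : Type} [NormedAddCommGroup X] [InnerProductSpace ℝ X] [NormedAddCommGroup Y]
  [InnerProductSpace ℝ Y]

theorem mem_proxSubdiff_of_separable {a : X → ℝ} {b : Y → ℝ} {z ζ : PL2 X Y}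
    (hζ : ζ ∈ proxSubdiff (fun z : PL2 X Y => a (pl2fst z) + b (pl2snd z)) z) :
    pl2fst ζ ∈ proxSubdiff a (pl2fst z) ∧ pl2snd ζ ∈ proxSubdiff b (pl2snd z) := by
  obtain ⟨σ, hσ, δ, hδ, hp⟩ := hζ
  constructor
  · refine ⟨σ, hσ, δ, hδ, fun y hy => ?_⟩
    have h1 : ‖pl2 y (pl2snd z) - z‖ ^ 2 = ‖y - pl2fst z‖ ^ 2 := by simp [norm_sq_pl2]
    have := hp (pl2 y (pl2snd z)) (by
      rwa [← pow_left_inj₀ (norm_nonneg _) (norm_nonneg _) two_ne_zero |>.1 h1] at hy)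
    rw [h1, inner_pl2] at this
    simp only [pl2fst_sub, pl2snd_sub, pl2fst_pl2, pl2snd_pl2, sub_self, inner_zero_right] at this
    linarith
  · refine ⟨σ, hσ, δ, hδ, fun y hy => ?_⟩
    have h1 : ‖pl2 (pl2fst z) y - z‖ ^ 2 = ‖y - pl2snd z‖ ^ 2 := by simp [norm_sq_pl2]
    have := hp (pl2 (pl2fst z) y) (by
      rwa [← pow_left_inj₀ (norm_nonneg _) (norm_nonneg _) two_ne_zero |>.1 h1] at hy)
    rw [h1, inner_pl2] at this
    simp only [pl2fst_sub, pl2snd_sub, pl2fst_pl2, pl2snd_pl2, sub_self, inner_zero_right] at this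
    linarith

theorem mem_limitingNC_of_frechetNC {C : Set X} {x v : X} (hx : x ∈ C) (h : v ∈ frechetNC C x) :
    v ∈ limitingNC C x :=
  ⟨fun _ => x, fun _ => v, fun _ => ⟨hx, h⟩, tendsto_const_nhds, tendsto_const_nhds⟩

variable [FiniteDimensional ℝ X] [FiniteDimensional ℝ Y]

theorem exists_slope_bound {C K : Set (PL2 X Y)} (hK : IsCompact K)
    (hN : ∀ z ∈ K, ∀ v ∈ limitingNC C z, pl2snd v = 0 → pl2fst v = 0) :
    ∃ k > 0, ∀ z ∈ K, ∀ v ∈ limitingNC C z, ‖pl2fst v‖ ≤ k * ‖pl2snd v‖ := by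
  by_contra! hcon
  choose zs hzK vs hvs hlt using fun n : ℕ => hcon ((n : ℝ) + 1) (by positivity)
  have hpos : ∀ n, 0 < ‖pl2fst (vs n)‖ := fun n =>
    (by positivity : (0 : ℝ) ≤ ((n : ℝ) + 1) * ‖pl2snd (vs n)‖).trans_lt (hlt n)
  set ws : ℕ → PL2 X Y := fun n => ‖pl2fst (vs n)‖⁻¹ • vs n with hws
  have hw1 : ∀ n, ‖pl2fst (ws n)‖ = 1 := fun n => by
    simp only [hws, pl2fst_smul, norm_smul, norm_inv, norm_norm]
    exact inv_mul_cancel₀ (hpos n).ne'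
  have hw2 : ∀ n : ℕ, ‖pl2snd (ws n)‖ ≤ 1 / ((n : ℝ) + 1) := fun n => by
    simp only [hws, pl2snd_smul, norm_smul, norm_inv, norm_norm]
    rw [le_div_iff₀ (by positivity), inv_mul_eq_div, div_mul_eq_mul_div, div_le_one (hpos n)]
    linarith [hlt n]
  have hwN : ∀ n, ws n ∈ limitingNC C (zs n) := fun n =>
    smul_mem_limitingNC (hvs n) (inv_nonneg.2 (norm_nonneg _))
  have hwb : ∀ n, ws n ∈ Metric.closedBall (0 : PL2 X Y) 2 := fun n => by
    rw [mem_closedBall_zero_iff]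
    have h1 : 1 / ((n : ℝ) + 1) ≤ 1 := by
      rw [div_le_one (by positivity)]
      linarith [(n.cast_nonneg : (0 : ℝ) ≤ n)]
    linarith [norm_le_pl2 (ws n), hw1 n, hw2 n]
  have : ProperSpace (PL2 X Y) := FiniteDimensional.proper ℝ _
  obtain ⟨z, hz, φ, hφ, hzt⟩ := hK.tendsto_subseq hzK
  obtain ⟨w, -, ψ, hψ, hwt⟩ := (isCompact_closedBall (0 : PL2 X Y) 2).tendsto_subseq
    fun n => hwb (φ n)
  have hw0 : pl2snd w = 0 := by
    refine tendsto_nhds_unique hwt.pl2snd (squeeze_zero_norm (fun n => hw2 _) ?_)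
    exact tendsto_one_div_add_atTop_nhds_zero_nat.comp (hφ.tendsto_atTop.comp hψ.tendsto_atTop)
  have h1 := hN z hz w (limitingNC_closed_graph (fun n => hwN (φ (ψ n)))
    (hzt.comp hψ.tendsto_atTop) hwt) hw0
  have h2 := hwt.pl2fst.norm
  rw [h1, norm_zero] at h2
  simp only [Function.comp_apply, hw1] at h2
  exact one_ne_zero (tendsto_nhds_unique tendsto_const_nhds h2)

theorem exists_mem_fiber_of_slope_bound {C : Set (PL2 X Y)} (hC : IsClosed C) {z₀ : PL2 X Y}
    (hz₀ : z₀ ∈ C) {k ρ₁ ρ₂ : ℝ} (hk : 0 < k)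
    (h : ∀ z ∈ C, ‖pl2fst z - pl2fst z₀‖ ≤ ρ₁ → ‖pl2snd z - pl2snd z₀‖ ≤ ρ₂ →
      ∀ v ∈ limitingNC C z, ‖pl2fst v‖ ≤ k * ‖pl2snd v‖)
    {x : X} (h₁ : 2 * ‖x - pl2fst z₀‖ < ρ₁) (h₂ : 2 * k * ‖x - pl2fst z₀‖ < ρ₂) :
    ∃ v, pl2 x v ∈ C ∧ ‖v - pl2snd z₀‖ ≤ 2 * k * ‖x - pl2fst z₀‖ := by
  have : ProperSpace (PL2 X Y) := FiniteDimensional.proper ℝ _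
  set e := 1 / (2 * k) with he
  have he0 : 0 < e := by positivity
  have hek : 2 * k * e = 1 := by rw [he]; field_simp
  set g : PL2 X Y → ℝ := fun z => ‖pl2fst z - x‖ + e * ‖pl2snd z - pl2snd z₀‖ with hg
  set B : Set (PL2 X Y) :=
    C ∩ {z | ‖pl2fst z - pl2fst z₀‖ ≤ ρ₁ ∧ ‖pl2snd z - pl2snd z₀‖ ≤ ρ₂} with hB
  have hρ₁ : 0 < ρ₁ := lt_of_le_of_lt (by positivity) h₁
  have hρ₂ : 0 < ρ₂ := lt_of_le_of_lt (by positivity) h₂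
  have hc₁ : Continuous fun z : PL2 X Y => ‖pl2fst z - pl2fst z₀‖ := by fun_prop
  have hc₂ : Continuous fun z : PL2 X Y => ‖pl2snd z - pl2snd z₀‖ := by fun_prop
  have hBc : IsCompact B := by
    refine Metric.isCompact_of_isClosed_isBounded (hC.inter (IsClosed.inter
      (isClosed_le hc₁ continuous_const) (isClosed_le hc₂ continuous_const))) ?_
    refine (Metric.isBounded_closedBall (x := z₀) (r := ρ₁ + ρ₂)).subset fun z hz => ?_
    rw [Metric.mem_closedBall, dist_eq_norm]
    have := norm_le_pl2 (z - z₀)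
    rw [pl2fst_sub, pl2snd_sub] at this
    linarith [hz.2.1, hz.2.2]
  have hz₀B : z₀ ∈ B := ⟨hz₀, by simpa using hρ₁.le, by simpa using hρ₂.le⟩
  obtain ⟨z, hzB, hzm⟩ := hBc.exists_isMinOn ⟨z₀, hz₀B⟩
    (Continuous.continuousOn (by fun_prop : Continuous g))
  have hz0 : g z ≤ ‖x - pl2fst z₀‖ := by
    have := hzm hz₀B
    simpa [hg, norm_sub_rev] using this
  simp only [hg] at hz0
  have hb1 : ‖pl2fst z - pl2fst z₀‖ < ρ₁ := by
    have := norm_sub_le_norm_sub_add_norm_sub (pl2fst z) x (pl2fst z₀)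
    nlinarith [mul_nonneg he0.le (norm_nonneg (pl2snd z - pl2snd z₀))]
  have hb2' : ‖pl2snd z - pl2snd z₀‖ ≤ 2 * k * ‖x - pl2fst z₀‖ := by
    have h3 : e * ‖pl2snd z - pl2snd z₀‖ ≤ ‖x - pl2fst z₀‖ := by
      linarith [norm_nonneg (pl2fst z - x)]
    have h4 := mul_le_mul_of_nonneg_left h3 (by positivity : 0 ≤ 2 * k)
    rwa [← mul_assoc, hek, one_mul] at h4
  have hb2 := hb2'.trans_lt h₂
  suffices hx : pl2fst z = x by
    exact ⟨pl2snd z, by rw [← hx, pl2_eta]; exact hzB.1, hb2'⟩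
  by_contra hne
  have hd0 : 0 < ‖pl2fst z - x‖ := norm_pos_iff.2 (sub_ne_zero.2 hne)
  set ρ := min (ρ₁ - ‖pl2fst z - pl2fst z₀‖) (ρ₂ - ‖pl2snd z - pl2snd z₀‖) with hρ
  have hρ0 : 0 < ρ := lt_min (by linarith) (by linarith)
  have hin : ∀ y : PL2 X Y, ‖y - z‖ ≤ ρ →
      ‖pl2fst y - pl2fst z₀‖ ≤ ρ₁ ∧ ‖pl2snd y - pl2snd z₀‖ ≤ ρ₂ := fun y hy => by
    have h1 := (norm_pl2fst_le (y - z)).trans (hy.trans (min_le_left _ _))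
    have h2 := (norm_pl2snd_le (y - z)).trans (hy.trans (min_le_right _ _))
    rw [pl2fst_sub] at h1
    rw [pl2snd_sub] at h2
    constructor
    · linarith [norm_sub_le_norm_sub_add_norm_sub (pl2fst y) (pl2fst z) (pl2fst z₀)]
    · linarith [norm_sub_le_norm_sub_add_norm_sub (pl2snd y) (pl2snd z) (pl2snd z₀)]
  have hgl : LipOnBall g (1 + e) z ρ := by
    intro y y' _ _
    have h1 := abs_norm_sub_norm_le (pl2fst y - x) (pl2fst y' - x)
    have h2 := abs_norm_sub_norm_le (pl2snd y - pl2snd z₀) (pl2snd y' - pl2snd z₀)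
    rw [sub_sub_sub_cancel_right] at h1 h2
    have h3 := h1.trans (norm_pl2fst_le (y - y'))
    have h4 := mul_le_mul_of_nonneg_left (h2.trans (norm_pl2snd_le (y - y'))) he0.le
    have h5 : g y - g y' = (‖pl2fst y - x‖ - ‖pl2fst y' - x‖) +
        e * (‖pl2snd y - pl2snd z₀‖ - ‖pl2snd y' - pl2snd z₀‖) := by simp only [hg]; ring
    rw [h5]
    refine (abs_add_le _ _).trans ?_
    rw [abs_mul, abs_of_pos he0]
    linarith
  set η := min (min ρ ‖pl2fst z - x‖) (1 / (4 * (1 + k))) with hη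
  have hη0 : 0 < η := by positivity
  have hηk : (1 + k) * η ≤ 1 / 4 := by
    have : η ≤ 1 / (4 * (1 + k)) := min_le_right _ _
    rw [le_div_iff₀ (by positivity)] at this
    linarith
  obtain ⟨z', c, ζ, w, h1, h2, hcC, hζ, hw, hsum⟩ := exists_fuzzy_sum (v := 0) (s := 0) (σ := 0) hC
    hzB.1 hρ0 le_rfl le_rfl hη0 hgl fun y hy hyz => by
      simpa using hzm (show y ∈ B from ⟨hy, hin y hyz⟩)
  have hηρ : η ≤ ρ := (min_le_left _ _).trans (min_le_left _ _)
  have hcb := hin c (h2.le.trans hηρ)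
  have hsl := h c hcC hcb.1 hcb.2 w (mem_limitingNC_of_frechetNC hcC hw)
  obtain ⟨hp1, hp2⟩ := mem_proxSubdiff_of_separable (a := fun y => ‖y - x‖)
    (b := fun v => e * ‖v - pl2snd z₀‖) hζ
  have hne' : pl2fst z' ≠ x := by
    intro hx
    have h3 := (norm_pl2fst_le (z' - z)).trans_lt
      (h1.trans_le ((min_le_left _ _).trans (min_le_right _ _)))
    rw [pl2fst_sub, hx, norm_sub_rev] at h3
    exact lt_irrefl _ h3
  have hζ1 := one_le_norm_of_mem_proxSubdiff_norm_sub hne' hp1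
  have hbl : LipOnBall (fun v => e * ‖v - pl2snd z₀‖) e (pl2snd z') 1 := by
    intro y y' _ _
    have h2 := abs_norm_sub_norm_le (y - pl2snd z₀) (y' - pl2snd z₀)
    rw [sub_sub_sub_cancel_right] at h2
    simp only
    rw [← mul_sub, abs_mul, abs_of_pos he0]
    gcongr
  have hζ2 := norm_le_of_mem_proxSubdiff hbl (by simp) he0.le hp2
  rw [sub_zero, mul_zero, zero_add] at hsum
  have hs1 := (norm_pl2fst_le _).trans hsum
  have hs2 := (norm_pl2snd_le _).trans hsum
  rw [pl2fst_add] at hs1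
  rw [pl2snd_add] at hs2
  have hw1 : 1 - η ≤ ‖pl2fst w‖ := by
    have := norm_sub_le (pl2fst ζ + pl2fst w) (pl2fst w)
    rw [add_sub_cancel_right] at this
    linarith
  have hw2 : ‖pl2snd w‖ ≤ e + η := by
    have := norm_sub_le (pl2snd ζ + pl2snd w) (pl2snd ζ)
    rw [add_sub_cancel_left] at this
    linarith
  have := mul_le_mul_of_nonneg_left hw2 hk.le
  nlinarith

end Aubin

section Ekeland

theorem exists_ekeland_point {E : Type*} [PseudoMetricSpace E] [CompleteSpace E] {A : Set E}
    (hA : IsClosed A) {Ψ : E → ℝ} (hΨ : ContinuousOn Ψ A) (h0 : ∀ w ∈ A, 0 ≤ Ψ w) {σ : ℝ}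
    (hσ : 0 < σ) {w₀ : E} (hw₀ : w₀ ∈ A) :
    ∃ w ∈ A, Ψ w + σ * dist w w₀ ≤ Ψ w₀ ∧ ∀ w' ∈ A, Ψ w ≤ Ψ w' + σ * dist w' w := by
  set P : E → Set E := fun w => {w' | w' ∈ A ∧ Ψ w' + σ * dist w' w ≤ Ψ w} with hP
  have hself : ∀ w ∈ A, w ∈ P w := fun w hw => ⟨hw, by simp⟩
  have htrans : ∀ w w' w'', w' ∈ P w → w'' ∈ P w' → w'' ∈ P w := by
    rintro w w' w'' ⟨_, h1⟩ ⟨h2, h3⟩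
    exact ⟨h2, by nlinarith [dist_triangle w'' w' w]⟩
  have hbdd : ∀ w, BddBelow (Ψ '' P w) := fun w => ⟨0, by
    rintro _ ⟨w', hw', rfl⟩
    exact h0 w' hw'.1⟩
  have hstep : ∀ (n : ℕ) (w : A), ∃ w' : A, w'.1 ∈ P w.1 ∧
      ∀ w'' ∈ P w.1, Ψ w'.1 ≤ Ψ w'' + (1 / 2) ^ n := by
    intro n w
    obtain ⟨_, ⟨w', hw', rfl⟩, hlt⟩ := exists_lt_of_csInf_lt
      (Set.Nonempty.image Ψ ⟨w.1, hself _ w.2⟩)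
      (show sInf (Ψ '' P w.1) < sInf (Ψ '' P w.1) + (1 / 2) ^ n by
        have : (0 : ℝ) < (1 / 2) ^ n := by positivity
        linarith)
    exact ⟨⟨w', hw'.1⟩, hw', fun w'' hw'' => by
      linarith [csInf_le (hbdd w.1) (mem_image_of_mem Ψ hw'')]⟩
  choose next hnext1 hnext2 using hstep
  let ws : ℕ → A := fun n => Nat.rec ⟨w₀, hw₀⟩ (fun n w => next n w) n
  have hws : ∀ n, ws (n + 1) = next n (ws n) := fun n => rfl
  have hmem : ∀ n m, n ≤ m → (ws m).1 ∈ P (ws n).1 := by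
    intro n m hnm
    induction m, hnm using Nat.le_induction with
    | base => exact hself _ (ws n).2
    | succ m _ ih => exact htrans _ _ _ ih (by rw [hws]; exact hnext1 m (ws m))
  have hanti : Antitone fun n => Ψ (ws n).1 := antitone_nat_of_succ_le fun n => by
    nlinarith [(hmem n (n + 1) (Nat.le_succ n)).2,
      dist_nonneg (x := (ws (n + 1)).1) (y := (ws n).1)]
  have hlim := tendsto_atTop_ciInf hanti ⟨0, by
    rintro _ ⟨n, rfl⟩
    exact h0 _ (ws n).2⟩
  have hcau : CauchySeq fun n => (ws n).1 := by
    have h1 := hlim.cauchySeq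
    rw [Metric.cauchySeq_iff'] at h1 ⊢
    intro e he
    obtain ⟨n₀, hn₀⟩ := h1 (σ * e) (by positivity)
    refine ⟨n₀, fun n hn => ?_⟩
    have h2 := hn₀ n hn
    have h3 := (hmem n₀ n hn).2
    rw [Real.dist_eq, abs_lt] at h2
    have h4 : σ * dist (ws n).1 (ws n₀).1 < σ * e := by linarith [h2.1]
    exact lt_of_mul_lt_mul_left h4 hσ.le
  obtain ⟨w, hw⟩ := cauchySeq_tendsto_of_complete hcau
  have hwA : w ∈ A := hA.mem_of_tendsto hw (Eventually.of_forall fun n => (ws n).2)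
  have hΨw : Tendsto (fun n => Ψ (ws n).1) atTop (𝓝 (Ψ w)) :=
    (hΨ w hwA).tendsto.comp (tendsto_nhdsWithin_iff.2 ⟨hw, Eventually.of_forall fun n => (ws n).2⟩)
  have hwP : ∀ n, w ∈ P (ws n).1 := fun n => by
    refine ⟨hwA, le_of_tendsto (hΨw.add ((hw.dist tendsto_const_nhds).const_mul σ)) ?_⟩
    filter_upwards [eventually_ge_atTop n] with m hm using (hmem n m hm).2
  refine ⟨w, hwA, (hwP 0).2, fun w' hw' => ?_⟩
  by_contra! hlt
  have h1 : ∀ n : ℕ, Ψ w ≤ Ψ w' + (1 / 2) ^ n := fun n => by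
    have h2 := hnext2 n (ws n) w' (htrans _ _ _ (hwP n) ⟨hw', hlt.le⟩)
    have h3 := hanti.le_of_tendsto hΨw (n + 1)
    simp only [hws] at h3
    linarith
  have h2 : Ψ w ≤ Ψ w' + 0 := ge_of_tendsto
    ((tendsto_pow_atTop_nhds_zero_of_lt_one (by norm_num : (0 : ℝ) ≤ 1 / 2)
      (by norm_num)).const_add _) (Eventually.of_forall h1)
  nlinarith [dist_nonneg (x := w') (y := w)]

end Ekeland

section Gronwall

theorem le_of_integral_le_backward {u : ℝ → ℝ} {a b A C M : ℝ} (hab : a ≤ b) (hA : 0 ≤ A)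
    (hC : 0 ≤ C) (hM : ∀ t ∈ Icc a b, u t ≤ M) (hu : IntervalIntegrable u volume a b)
    (h : ∀ t ∈ Icc a b, u t ≤ A + C * ∫ s in t..b, u s) {t : ℝ} (ht : t ∈ Icc a b) :
    u t ≤ 2 * A * Real.exp (2 * (C + 1) * (b - a)) := by
  set c := 2 * (C + 1) with hc
  have hc0 : 0 < c := by positivity
  have hexp : ∀ t, (∫ s in t..b, Real.exp (c * (b - s))) = (Real.exp (c * (b - t)) - 1) / c := by
    intro t
    have : ∀ s ∈ uIcc t b, HasDerivAt (fun s => -(Real.exp (c * (b - s)) / c))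
        (Real.exp (c * (b - s))) s := fun s _ => by
      have h1 : HasDerivAt (fun s => c * (b - s)) (c * (0 - 1)) s :=
        ((hasDerivAt_const s b).sub (hasDerivAt_id s)).const_mul c
      have h2 := (h1.exp.div_const c).neg
      refine h2.congr_deriv ?_
      field_simp
      ring
    rw [intervalIntegral.integral_eq_sub_of_hasDerivAt this
      (Continuous.intervalIntegrable (by fun_prop) _ _)]
    simp
    ring
  have key : ∀ m : ℝ, 0 ≤ m → (∀ t ∈ Icc a b, u t ≤ m * Real.exp (c * (b - t))) →
      ∀ t ∈ Icc a b, u t ≤ (A + m / 2) * Real.exp (c * (b - t)) := by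
    intro m hm hum t ht
    have h1 : ∫ s in t..b, u s ≤ ∫ s in t..b, m * Real.exp (c * (b - s)) := by
      refine intervalIntegral.integral_mono_on ht.2
        (hu.mono_set (by rw [uIcc_of_le hab, uIcc_of_le ht.2]; exact Icc_subset_Icc_left ht.1))
        (Continuous.intervalIntegrable (by fun_prop) _ _) fun s hs => hum s ⟨ht.1.trans hs.1, hs.2⟩
    rw [intervalIntegral.integral_const_mul, hexp] at h1
    have h2 : 1 ≤ Real.exp (c * (b - t)) := Real.one_le_exp (by nlinarith [ht.2])
    have h3 := h t ht
    have h4 : C * (m * ((Real.exp (c * (b - t)) - 1) / c)) ≤ m / 2 * Real.exp (c * (b - t)) := by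
      have e1 : C * (m * ((Real.exp (c * (b - t)) - 1) / c))
          = C / (C + 1) * (m / 2 * (Real.exp (c * (b - t)) - 1)) := by
        rw [hc]; field_simp
      have e2 : C / (C + 1) ≤ 1 := by rw [div_le_one (by positivity)]; linarith
      rw [e1]
      have e3 : 0 ≤ m / 2 * (Real.exp (c * (b - t)) - 1) := by
        have : 0 ≤ Real.exp (c * (b - t)) - 1 := by linarith
        positivity
      nlinarith
    nlinarith [mul_le_mul_of_nonneg_left h1 hC]
  have hiter : ∀ n : ℕ, ∀ t ∈ Icc a b,
      u t ≤ (2 * A + (1 / 2) ^ n * |M|) * Real.exp (c * (b - t)) := by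
    intro n
    induction n with
    | zero =>
      intro t ht
      have h2 : 1 ≤ Real.exp (c * (b - t)) := Real.one_le_exp (by nlinarith [ht.2])
      have := (hM t ht).trans (le_abs_self M)
      nlinarith [abs_nonneg M]
    | succ n ih =>
      intro t ht
      refine (key _ (by positivity) ih t ht).trans (le_of_eq ?_)
      rw [pow_succ]
      ring
  have hlim : u t ≤ (2 * A + 0 * |M|) * Real.exp (c * (b - t)) := by
    refine ge_of_tendsto ((((tendsto_pow_atTop_nhds_zero_of_lt_one (by norm_num : (0 : ℝ) ≤ 1 / 2)
      (by norm_num)).mul_const _).const_add _).mul_const _)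
      (Eventually.of_forall fun n => hiter n t ht)
  rw [zero_mul, add_zero] at hlim
  refine hlim.trans ?_
  gcongr
  exact ht.1

theorem eq_zero_of_integral_le_forward {u : ℝ → ℝ} {a b C M : ℝ} (hab : a ≤ b)
    (hC : 0 ≤ C) (hM : ∀ t ∈ Icc a b, u t ≤ M) (hu : IntervalIntegrable u volume a b)
    (h : ∀ t ∈ Icc a b, u t ≤ C * ∫ s in a..t, u s) : u b ≤ 0 := by
  have hmem : ∀ t ∈ Icc a b, a + b - t ∈ Icc a b := fun t ht =>
    ⟨by linarith [ht.2], by linarith [ht.1]⟩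
  have := le_of_integral_le_backward (u := fun t => u (a + b - t)) (A := 0) (C := C) (M := M) hab
    le_rfl hC (fun t ht => hM _ (hmem t ht)) (by
      have := hu.comp_sub_left (a + b)
      simpa using this.symm) (fun t ht => by
      have h1 := h _ (hmem t ht)
      rw [intervalIntegral.integral_comp_sub_left (fun s => u s) (a + b)]
      simpa using h1) (t := a) ⟨le_rfl, hab⟩
  simpa using this

end Gronwall

section ConvexHull

theorem IsCompact.convexHull_of_finiteDimensional {E : Type} [NormedAddCommGroup E]
    [InnerProductSpace ℝ E] [FiniteDimensional ℝ E] {s : Set E} (hs : IsCompact s) :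
    IsCompact (convexHull ℝ s) := by
  have h : convexHull ℝ s = ⋃ m ∈ Finset.range (Module.finrank ℝ E + 2),
      (fun q : (Fin m → ℝ) × (Fin m → E) => ∑ i, q.1 i • q.2 i) ''
        (stdSimplex ℝ (Fin m) ×ˢ Set.pi univ fun _ => s) := by
    refine Subset.antisymm (fun x hx => ?_) ?_
    · obtain ⟨ι, hι, z, w, hz, hai, hw0, hw1, hwz⟩ := eq_pos_convex_span_of_mem_convexHull hx
      have hcard : Fintype.card ι ≤ Module.finrank ℝ E + 1 :=
        hai.card_le_finrank_succ.trans (Nat.succ_le_succ (Submodule.finrank_le _))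
      let e := (Fintype.equivFin ι).symm
      simp only [mem_iUnion, Finset.mem_range]
      refine ⟨Fintype.card ι, by omega, (fun i => w (e i), fun i => z (e i)),
        ⟨⟨fun i => (hw0 _).le, ?_⟩, fun i _ => hz (mem_range_self _)⟩, ?_⟩
      · rw [← hw1]
        exact e.sum_comp w
      · rw [← hwz]
        exact e.sum_comp fun i => w i • z i
    · refine iUnion₂_subset fun m _ => ?_
      rintro _ ⟨⟨w, z⟩, ⟨hw, hz⟩, rfl⟩
      exact (convex_convexHull ℝ s).sum_mem (fun i _ => hw.1 i) hw.2
        fun i _ => subset_convexHull ℝ s (hz i (mem_univ i))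
  rw [h]
  refine (Finset.range _).isCompact_biUnion fun m _ => ?_
  exact ((isCompact_stdSimplex ℝ (Fin m)).prod (isCompact_univ_pi fun _ => hs)).image (by fun_prop)

theorem mem_convexHull_of_inner_le {E : Type} [NormedAddCommGroup E] [InnerProductSpace ℝ E]
    [FiniteDimensional ℝ E] {s : Set E} (hs : IsCompact s) {v : E}
    (h : ∀ ξ : E, ∃ w ∈ s, ⟪ξ, v⟫ ≤ ⟪ξ, w⟫) : v ∈ convexHull ℝ s := by
  by_contra hv
  have : CompleteSpace E := FiniteDimensional.complete ℝ E
  obtain ⟨l, u, hl, hlv⟩ := geometric_hahn_banach_closed_point (convex_convexHull ℝ s)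
    hs.convexHull_of_finiteDimensional.isClosed hv
  obtain ⟨w, hw, hvw⟩ := h ((InnerProductSpace.toDual ℝ E).symm l)
  rw [InnerProductSpace.toDual_symm_apply, InnerProductSpace.toDual_symm_apply] at hvw
  linarith [hl w (subset_convexHull ℝ s hw)]

end ConvexHull

section MeasureTools

theorem ae_nonneg_of_forall_small_setIntegral {a b : ℝ} {D : ℝ → ℝ} {T : Set ℝ} {C α : ℝ}
    (hD : Measurable D) (hDi : Integrable D (volume.restrict (Icc a b))) (hT : MeasurableSet T)
    (hα : 0 < α)
    (h : ∀ A, MeasurableSet A → A ⊆ T → (volume.restrict (Icc a b)).real A ≤ α →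
      0 ≤ (∫ t in A, D t ∂(volume.restrict (Icc a b))) +
        C * (volume.restrict (Icc a b)).real A ^ 2) :
    ∀ᵐ t ∂(volume.restrict (Icc a b)), t ∈ T → 0 ≤ D t := by
  set μ := volume.restrict (Icc a b) with hμ
  have key : ∀ m : ℕ, ∀ᵐ t ∂μ, t ∈ T → -(1 / ((m : ℝ) + 1)) ≤ D t := by
    intro m
    set c := 1 / ((m : ℝ) + 1) with hc
    have hc0 : 0 < c := by positivity
    set β := min α (c / (|C| + 1)) with hβ
    have hβ0 : 0 < β := by positivity
    have hβC : |C| * β < c := by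
      have h1 : β * (|C| + 1) ≤ c := by
        rw [← le_div_iff₀ (by positivity)]
        exact min_le_right _ _
      nlinarith
    set B := T ∩ {t | D t < -c} with hB
    have hBm : MeasurableSet B := hT.inter (measurableSet_lt hD measurable_const)
    have hpiece : ∀ j : ℤ, μ (B ∩ Ico (j • β) ((j + 1) • β)) = 0 := by
      intro j
      set A := B ∩ Ico (j • β) ((j + 1) • β) with hA
      have hAm : MeasurableSet A := hBm.inter measurableSet_Ico
      have hAβ : μ.real A ≤ β := by
        refine ENNReal.toReal_le_of_le_ofReal hβ0.le ?_
        calc μ A ≤ volume A := Measure.restrict_apply_le _ _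
          _ ≤ volume (Ico (j • β) ((j + 1) • β)) := measure_mono inter_subset_right
          _ = ENNReal.ofReal β := by rw [Real.volume_Ico]; congr 1; simp [add_mul]
      have h1 := h A hAm (inter_subset_left.trans inter_subset_left) (hAβ.trans (min_le_left _ _))
      have h2 : ∫ t in A, D t ∂μ ≤ ∫ t in A, -c ∂μ :=
        setIntegral_mono_on hDi.integrableOn (integrable_const _).integrableOn hAm
          fun t ht => le_of_lt ht.1.2
      rw [setIntegral_const, smul_eq_mul] at h2
      have h3 : 0 ≤ μ.real A := measureReal_nonneg
      have h4 : C * μ.real A ^ 2 ≤ |C| * β * μ.real A := by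
        have e1 : C * μ.real A ^ 2 ≤ |C| * μ.real A ^ 2 :=
          mul_le_mul_of_nonneg_right (le_abs_self C) (sq_nonneg _)
        have e2 : |C| * μ.real A * μ.real A ≤ |C| * β * μ.real A := by gcongr
        nlinarith
      have h5 : μ.real A = 0 := by
        by_contra hne
        have : 0 < μ.real A := lt_of_le_of_ne h3 (Ne.symm hne)
        nlinarith
      exact (measureReal_eq_zero_iff (measure_ne_top μ A)).1 h5
    have hBnull : μ B = 0 := by
      have : B = ⋃ j : ℤ, B ∩ Ico (j • β) ((j + 1) • β) := by
        rw [← inter_iUnion, iUnion_Ico_zsmul hβ0, inter_univ]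
      rw [this]
      exact measure_iUnion_null hpiece
    rw [ae_iff]
    refine measure_mono_null (fun t ht => ?_) hBnull
    simp only [mem_ofPred_eq, Classical.not_imp, not_le] at ht
    exact ⟨ht.1, ht.2⟩
  filter_upwards [ae_all_iff.2 key] with t ht hT
  have h10 : Tendsto (fun n : ℕ => -(1 / ((n : ℝ) + 1))) atTop (𝓝 (-0)) :=
    tendsto_one_div_add_atTop_nhds_zero_nat.neg
  rw [neg_zero] at h10
  exact le_of_tendsto h10 (Eventually.of_forall fun n => ht n hT)

theorem Measurable.integrable_of_norm_le {G : Type} [NormedAddCommGroup G] [MeasurableSpace G]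
    [BorelSpace G] [SecondCountableTopology G] {α : Type} [MeasurableSpace α] {ν : Measure α}
    [IsFiniteMeasure ν] {g : α → G} (hg : Measurable g) {K : ℝ} (hK : ∀ᵐ t ∂ν, ‖g t‖ ≤ K) :
    Integrable g ν :=
  Integrable.of_bound hg.aestronglyMeasurable K hK

variable {E : Type} [NormedAddCommGroup E] [InnerProductSpace ℝ E] {μ : Measure ℝ}

theorem setIntegral_Iic_eq_integral_ite {h : ℝ → E} (t : ℝ) :
    ∫ s in Iic t, h s ∂μ = ∫ s, (if s ≤ t then h s else 0) ∂μ := by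
  rw [← integral_indicator measurableSet_Iic]
  exact integral_congr_ae (Eventually.of_forall fun s => by simp [indicator])

theorem setIntegral_Ici_eq_integral_ite {h : ℝ → E} (t : ℝ) :
    ∫ s in Ici t, h s ∂μ = ∫ s, (if t ≤ s then h s else 0) ∂μ := by
  rw [← integral_indicator measurableSet_Ici]
  exact integral_congr_ae (Eventually.of_forall fun s => by simp [indicator])

variable [SecondCountableTopology E] [MeasurableSpace E] [BorelSpace E] [IsFiniteMeasure μ]

theorem measurable_setIntegral_Iic {h : ℝ → E} (hh : Measurable h) :
    Measurable fun t => ∫ s in Iic t, h s ∂μ := by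
  simp only [setIntegral_Iic_eq_integral_ite]
  refine StronglyMeasurable.measurable (StronglyMeasurable.integral_prod_right
    (f := fun t s => if s ≤ t then h s else 0) ?_)
  exact (Measurable.ite (measurableSet_le measurable_snd measurable_fst) (hh.comp measurable_snd)
    measurable_const).stronglyMeasurable

theorem measurable_setIntegral_Ici {h : ℝ → E} (hh : Measurable h) :
    Measurable fun t => ∫ s in Ici t, h s ∂μ := by
  simp only [setIntegral_Ici_eq_integral_ite]
  refine StronglyMeasurable.measurable (StronglyMeasurable.integral_prod_right
    (f := fun t s => if t ≤ s then h s else 0) ?_)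
  exact (Measurable.ite (measurableSet_le measurable_fst measurable_snd) (hh.comp measurable_snd)
    measurable_const).stronglyMeasurable

variable [CompleteSpace E]

theorem integral_inner_setIntegral_Iic {g h : ℝ → E} (hg : Measurable g) (hh : Measurable h)
    {Kg Kh : ℝ} (hKg : ∀ᵐ t ∂μ, ‖g t‖ ≤ Kg) (hKh : ∀ᵐ t ∂μ, ‖h t‖ ≤ Kh) :
    ∫ t, ⟪g t, ∫ s in Iic t, h s ∂μ⟫ ∂μ = ∫ s, ⟪∫ t in Ici s, g t ∂μ, h s⟫ ∂μ := by
  have hgi : Integrable g μ := hg.integrable_of_norm_le hKg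
  have hhi : Integrable h μ := hh.integrable_of_norm_le hKh
  have h1 : ∀ t, ⟪g t, ∫ s in Iic t, h s ∂μ⟫ = ∫ s, (if s ≤ t then ⟪g t, h s⟫ else 0) ∂μ := by
    intro t
    rw [← integral_inner hhi.integrableOn, ← integral_indicator measurableSet_Iic]
    exact integral_congr_ae (Eventually.of_forall fun s => by simp [indicator])
  have h2 : ∀ s, ⟪∫ t in Ici s, g t ∂μ, h s⟫ = ∫ t, (if s ≤ t then ⟪g t, h s⟫ else 0) ∂μ := by
    intro s
    rw [real_inner_comm, ← integral_inner hgi.integrableOn, ← integral_indicator measurableSet_Ici]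
    exact integral_congr_ae (Eventually.of_forall fun t => by simp [indicator, real_inner_comm])
  simp only [h1, h2]
  refine integral_integral_swap ?_
  have hm : Measurable (Function.uncurry fun t s => if s ≤ t then ⟪g t, h s⟫ else (0 : ℝ)) :=
    Measurable.ite (measurableSet_le measurable_snd measurable_fst)
      ((hg.comp measurable_fst).inner (hh.comp measurable_snd)) measurable_const
  refine hm.integrable_of_norm_le (K := |Kg| * |Kh|) ?_
  have e1 : ∀ᵐ q ∂(μ.prod μ), ‖g q.1‖ ≤ Kg := Measure.quasiMeasurePreserving_fst.ae hKg
  have e2 : ∀ᵐ q ∂(μ.prod μ), ‖h q.2‖ ≤ Kh := Measure.quasiMeasurePreserving_snd.ae hKh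
  filter_upwards [e1, e2] with q hq1 hq2
  simp only [Function.uncurry]
  split_ifs
  · refine (abs_real_inner_le_norm _ _).trans ?_
    gcongr
    · exact hq1.trans (le_abs_self _)
    · exact hq2.trans (le_abs_self _)
  · rw [norm_zero]
    positivity

end MeasureTools

/-- Data of a control problem localized around a reference process `(xs, us)`, with the pure
constraint set `C`, whose relevant part lies in the bounded set `W`. -/
structure LocalProblem (X Y : Type) [NormedAddCommGroup X] [InnerProductSpace ℝ X]
    [NormedAddCommGroup Y] [InnerProductSpace ℝ Y] where
  t0 : ℝ
  t1 : ℝ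
  F : PL2 X Y → ℝ
  f : PL2 X X → ℝ
  φ : PL2 X Y → X
  C : Set (PL2 X Y)
  W : Set (PL2 X Y)
  S : Set (PL2 X X)
  xs : ℝ → X
  us : ℝ → Y
  r : ℝ → ℝ
  ε : ℝ
  δ : ℝ
  k : ℝ
  K : ℝ
  B : ℝ
  ρ : ℝ
  t0_lt : t0 < t1
  ε_pos : 0 < ε
  δ_pos : 0 < δ
  k_pos : 0 < k
  K_pos : 0 < K
  B_pos : 0 < B
  ρ_pos : 0 < ρ
  continuous_F : Continuous F
  continuous_φ : Continuous φ
  lipschitz_f : LocallyLipschitz f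
  isClosed_C : IsClosed C
  isClosed_S : IsClosed S
  norm_le_B : ∀ z ∈ W, ‖z‖ ≤ B
  φ_bound : ∀ z ∈ W, ‖φ z‖ ≤ K
  F_bound : ∀ z ∈ W, ‖F z‖ ≤ K
  φ_lip : ∀ z ∈ W, ∀ w ∈ W, ‖φ z - φ w‖ ≤ K * ‖z - w‖
  F_lip : ∀ z ∈ W, ∀ w ∈ W, ‖F z - F w‖ ≤ K * ‖z - w‖
  slope : ∀ z ∈ W, ∀ v ∈ limitingNC C z, ‖pl2fst v‖ ≤ k * ‖pl2snd v‖
  measurable_xs : StronglyMeasurable xs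
  measurable_us : StronglyMeasurable us
  measurable_r : Measurable r
  δ_le : ∀ᵐ t ∂(volume.restrict (Icc t0 t1)), δ ≤ r t
  mem_W : ∀ᵐ t ∂(volume.restrict (Icc t0 t1)), ∀ z ∈ C, ‖pl2fst z - xs t‖ ≤ ε →
    ‖pl2snd z - us t‖ ≤ r t → z ∈ W
  ref_mem : ∀ᵐ t ∂(volume.restrict (Icc t0 t1)), pl2 (xs t) (us t) ∈ C
  ref_endpoints : pl2 (xs t0) (xs t1) ∈ S
  ref_traj : ∀ t ∈ Icc t0 t1,
    xs t = xs t0 + ∫ s in Iic t, φ (pl2 (xs s) (us s)) ∂(volume.restrict (Icc t0 t1))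
  minimal : ∀ (c : PL2 X X) (ω : ℝ → PL2 X Y), c ∈ S → StronglyMeasurable ω →
    (∀ᵐ t ∂(volume.restrict (Icc t0 t1)), ω t ∈ C ∧ ‖pl2fst (ω t) - xs t‖ ≤ ε ∧
      ‖pl2snd (ω t) - us t‖ ≤ r t) →
    (∀ᵐ t ∂(volume.restrict (Icc t0 t1)), pl2fst (ω t) =
      pl2fst c + ∫ s in Iic t, φ (ω s) ∂(volume.restrict (Icc t0 t1))) →
    pl2fst c + (∫ s, φ (ω s) ∂(volume.restrict (Icc t0 t1))) = pl2snd c →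
    (∫ t, ‖ω t - pl2 (xs t) (us t)‖ ∂(volume.restrict (Icc t0 t1))) ≤ ρ →
    (∫ t, F (pl2 (xs t) (us t)) ∂(volume.restrict (Icc t0 t1))) + f (pl2 (xs t0) (xs t1)) ≤
      (∫ t, F (ω t) ∂(volume.restrict (Icc t0 t1))) + f c

namespace LocalProblem

variable {X Y : Type} [NormedAddCommGroup X] [InnerProductSpace ℝ X] [NormedAddCommGroup Y]
  [InnerProductSpace ℝ Y] (P : LocalProblem X Y)

abbrev μ : Measure ℝ := volume.restrict (Icc P.t0 P.t1)

def ws (t : ℝ) : PL2 X Y := pl2 (P.xs t) (P.us t)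

def c₀ : PL2 X X := pl2 (P.xs P.t0) (P.xs P.t1)

/-- Pointwise admissibility of `z` at time `t`. -/
def Near (t : ℝ) (z : PL2 X Y) : Prop :=
  z ∈ P.C ∧ ‖pl2fst z - P.xs t‖ ≤ P.ε ∧ ‖pl2snd z - P.us t‖ ≤ P.r t

def traj (c : PL2 X X) (ω : ℝ → PL2 X Y) (t : ℝ) : X :=
  pl2fst c + ∫ s in Iic t, P.φ (ω s) ∂P.μ

/-- Discrepancy between the integrated trajectory and the state component of `ω`. -/
def gap (c : PL2 X X) (ω : ℝ → PL2 X Y) (t : ℝ) : X := P.traj c ω t - pl2fst (ω t)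

def endGap (c : PL2 X X) (ω : ℝ → PL2 X Y) : X :=
  pl2fst c - pl2snd c + ∫ s, P.φ (ω s) ∂P.μ

def cost (c : PL2 X X) (ω : ℝ → PL2 X Y) : ℝ := (∫ t, P.F (ω t) ∂P.μ) + P.f c

def costGap (γ : ℝ) (c : PL2 X X) (ω : ℝ → PL2 X Y) : ℝ :=
  max (P.cost c ω - P.cost P.c₀ P.ws + γ) 0

/-- Squared penalty functional. -/
def sqPen (N γ : ℝ) (c : PL2 X X) (ω : ℝ → PL2 X Y) : ℝ :=
  ‖P.endGap c ω‖ ^ 2 + P.costGap γ c ω ^ 2 + N * ∫ t, ‖P.gap c ω t‖ ^ 2 ∂P.μ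

/-- Penalty for controls close to the boundary of the tube. -/
def ctrlPen (θ t : ℝ) (z : PL2 X Y) : ℝ := max (‖pl2snd z - P.us t‖ - θ * P.r t) 0

variable {P} {c c' : PL2 X X} {ω ω' : ℝ → PL2 X Y}

theorem near_mem_W : ∀ᵐ t ∂P.μ, ∀ z, P.Near t z → z ∈ P.W := by
  filter_upwards [P.mem_W] with t ht z hz using ht z hz.1 hz.2.1 hz.2.2

theorem ae_mem_W (hω : ∀ᵐ t ∂P.μ, P.Near t (ω t)) : ∀ᵐ t ∂P.μ, ω t ∈ P.W := by
  filter_upwards [hω, near_mem_W (P := P)] with t h1 h2 using h2 _ h1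

theorem near_ws : ∀ᵐ t ∂P.μ, P.Near t (P.ws t) := by
  filter_upwards [P.ref_mem, P.δ_le] with t h1 h2
  refine ⟨h1, ?_, ?_⟩
  · simpa [ws] using P.ε_pos.le
  · simpa [ws] using P.δ_pos.le.trans h2

theorem stronglyMeasurable_ws : StronglyMeasurable P.ws :=
  continuous_pl2.comp_stronglyMeasurable (P.measurable_xs.prodMk P.measurable_us)

theorem measurable_F (hω : StronglyMeasurable ω) : Measurable fun t => P.F (ω t) :=
  (P.continuous_F.comp_stronglyMeasurable hω).measurable

theorem integrable_F (hω : StronglyMeasurable ω) (hW : ∀ᵐ t ∂P.μ, ω t ∈ P.W) :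
    Integrable (fun t => P.F (ω t)) P.μ :=
  (measurable_F hω).integrable_of_norm_le (K := P.K) (hW.mono fun _ ht => P.F_bound _ ht)

def gapBound (P : LocalProblem X Y) (c : PL2 X X) : ℝ :=
  ‖pl2fst c‖ + P.K * P.μ.real univ + P.B

theorem norm_traj_le (hW : ∀ᵐ t ∂P.μ, ω t ∈ P.W) (t : ℝ) :
    ‖P.traj c ω t‖ ≤ ‖pl2fst c‖ + P.K * P.μ.real univ := by
  refine (norm_add_le _ _).trans ?_
  gcongr
  refine (norm_setIntegral_le_of_norm_le_const_ae' (measure_lt_top _ _)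
    (hW.mono fun s hs _ => P.φ_bound _ hs)).trans ?_
  exact mul_le_mul_of_nonneg_left (measureReal_mono (subset_univ _)) P.K_pos.le

theorem norm_gap_le (hW : ∀ᵐ t ∂P.μ, ω t ∈ P.W) :
    ∀ᵐ t ∂P.μ, ‖P.gap c ω t‖ ≤ gapBound P c := by
  filter_upwards [hW] with t ht
  refine (norm_sub_le _ _).trans ?_
  have := (norm_pl2fst_le _).trans (P.norm_le_B _ ht)
  unfold gapBound
  linarith [norm_traj_le (c := c) hW t]

variable [MeasurableSpace X] [BorelSpace X]

theorem measurable_φ (hω : StronglyMeasurable ω) : Measurable fun t => P.φ (ω t) :=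
  (P.continuous_φ.comp_stronglyMeasurable hω).measurable

variable [FiniteDimensional ℝ X]

theorem integrable_φ (hω : StronglyMeasurable ω) (hW : ∀ᵐ t ∂P.μ, ω t ∈ P.W) :
    Integrable (fun t => P.φ (ω t)) P.μ :=
  (measurable_φ hω).integrable_of_norm_le (K := P.K) (hW.mono fun _ ht => P.φ_bound _ ht)

theorem measurable_traj (hω : StronglyMeasurable ω) : Measurable (P.traj c ω) :=
  (measurable_setIntegral_Iic (measurable_φ hω)).const_add _

theorem measurable_gap (hω : StronglyMeasurable ω) : Measurable (P.gap c ω) :=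
  (measurable_traj hω).sub (continuous_pl2fst.comp_stronglyMeasurable hω).measurable

theorem integrable_gap (hω : StronglyMeasurable ω) (hW : ∀ᵐ t ∂P.μ, ω t ∈ P.W) :
    Integrable (P.gap c ω) P.μ :=
  (measurable_gap hω).integrable_of_norm_le (norm_gap_le hW)

theorem integrable_gap_sq (hω : StronglyMeasurable ω) (hW : ∀ᵐ t ∂P.μ, ω t ∈ P.W) :
    Integrable (fun t => ‖P.gap c ω t‖ ^ 2) P.μ :=
  ((measurable_gap hω).norm.pow_const 2).integrable_of_norm_le (K := gapBound P c ^ 2)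
    ((norm_gap_le hW).mono fun t ht => by
      rw [norm_pow, norm_norm]
      gcongr)

end LocalProblem

namespace LocalProblem

variable {X Y : Type} [NormedAddCommGroup X] [InnerProductSpace ℝ X] [NormedAddCommGroup Y]
  [InnerProductSpace ℝ Y] {P : LocalProblem X Y} {c c' : PL2 X X} {ω ω' : ℝ → PL2 X Y}

theorem integrable_of_mem_W (hω : StronglyMeasurable ω) (hW : ∀ᵐ t ∂P.μ, ω t ∈ P.W) :
    Integrable ω P.μ :=
  (integrable_const P.B).mono' hω.aestronglyMeasurable (hW.mono fun _ ht => P.norm_le_B _ ht)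

theorem integrable_norm_sub (hω : StronglyMeasurable ω) (hω' : StronglyMeasurable ω')
    (hW : ∀ᵐ t ∂P.μ, ω t ∈ P.W) (hW' : ∀ᵐ t ∂P.μ, ω' t ∈ P.W) :
    Integrable (fun t => ‖ω t - ω' t‖) P.μ :=
  ((integrable_of_mem_W hω hW).sub (integrable_of_mem_W hω' hW')).norm

theorem abs_integral_F_sub_le (hω : StronglyMeasurable ω) (hω' : StronglyMeasurable ω')
    (hW : ∀ᵐ t ∂P.μ, ω t ∈ P.W) (hW' : ∀ᵐ t ∂P.μ, ω' t ∈ P.W) :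
    |∫ t, P.F (ω t) ∂P.μ - ∫ t, P.F (ω' t) ∂P.μ| ≤ P.K * ∫ t, ‖ω t - ω' t‖ ∂P.μ := by
  rw [← integral_sub (integrable_F hω hW) (integrable_F hω' hW'), ← integral_const_mul]
  refine norm_integral_le_of_norm_le (G := ℝ) ((integrable_norm_sub hω hω' hW hW').const_mul _) ?_
  filter_upwards [hW, hW'] with t h1 h2 using P.F_lip _ h1 _ h2

theorem ctrlPen_nonneg (θ t : ℝ) (z : PL2 X Y) : 0 ≤ P.ctrlPen θ t z := le_max_right _ _

theorem ctrlPen_ws {θ : ℝ} (hθ : 0 ≤ θ) : ∀ᵐ t ∂P.μ, P.ctrlPen θ t (P.ws t) = 0 := by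
  filter_upwards [P.δ_le] with t ht
  have : 0 ≤ θ * P.r t := mul_nonneg hθ (P.δ_pos.le.trans ht)
  simp [ctrlPen, ws, this]

theorem abs_ctrlPen_sub_le (θ t : ℝ) (z w : PL2 X Y) :
    |P.ctrlPen θ t z - P.ctrlPen θ t w| ≤ ‖z - w‖ := by
  refine (abs_max_sub_max_le_abs _ _ _).trans ?_
  rw [sub_sub_sub_cancel_right]
  refine (abs_norm_sub_norm_le _ _).trans ?_
  rw [sub_sub_sub_cancel_right, ← pl2snd_sub]
  exact norm_pl2snd_le _

theorem integrable_ctrlPen {θ : ℝ} (hθ : 0 ≤ θ) (hω : StronglyMeasurable ω)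
    (hW : ∀ᵐ t ∂P.μ, ω t ∈ P.W) :
    Integrable (fun t => P.ctrlPen θ t (ω t)) P.μ := by
  have hm : Measurable fun t => P.ctrlPen θ t (ω t) :=
    ((((continuous_pl2snd.comp_stronglyMeasurable hω).sub P.measurable_us).norm.measurable).sub
      (P.measurable_r.const_mul θ)).max measurable_const
  refine (integrable_norm_sub hω stronglyMeasurable_ws hW (ae_mem_W near_ws)).mono'
    hm.aestronglyMeasurable ?_
  filter_upwards [ctrlPen_ws (P := P) hθ] with t ht
  simpa [ht] using abs_ctrlPen_sub_le (P := P) θ t (ω t) (P.ws t)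

theorem abs_integral_ctrlPen_sub_le {θ : ℝ} (hθ : 0 ≤ θ) (hω : StronglyMeasurable ω)
    (hω' : StronglyMeasurable ω') (hW : ∀ᵐ t ∂P.μ, ω t ∈ P.W) (hW' : ∀ᵐ t ∂P.μ, ω' t ∈ P.W) :
    |∫ t, P.ctrlPen θ t (ω t) ∂P.μ - ∫ t, P.ctrlPen θ t (ω' t) ∂P.μ| ≤
      ∫ t, ‖ω t - ω' t‖ ∂P.μ := by
  rw [← integral_sub (integrable_ctrlPen hθ hω hW) (integrable_ctrlPen hθ hω' hW')]
  exact norm_integral_le_of_norm_le (G := ℝ) (integrable_norm_sub hω hω' hW hW')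
    (ae_of_all _ fun t => abs_ctrlPen_sub_le _ _ _ _)

variable [MeasurableSpace X] [BorelSpace X] [FiniteDimensional ℝ X]

theorem norm_setIntegral_φ_sub_le (hω : StronglyMeasurable ω) (hω' : StronglyMeasurable ω')
    (hW : ∀ᵐ t ∂P.μ, ω t ∈ P.W) (hW' : ∀ᵐ t ∂P.μ, ω' t ∈ P.W) (s : Set ℝ) :
    ‖∫ t in s, P.φ (ω t) ∂P.μ - ∫ t in s, P.φ (ω' t) ∂P.μ‖ ≤ P.K * ∫ t, ‖ω t - ω' t‖ ∂P.μ := by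
  have hi := integrable_norm_sub hω hω' hW hW'
  rw [← integral_sub (integrable_φ hω hW).integrableOn (integrable_φ hω' hW').integrableOn,
    ← integral_const_mul]
  refine (norm_integral_le_of_norm_le (hi.const_mul P.K).integrableOn
    (ae_restrict_of_ae ?_)).trans (setIntegral_le_integral (hi.const_mul P.K)
      (ae_of_all _ fun t => mul_nonneg P.K_pos.le (norm_nonneg _)))
  filter_upwards [hW, hW'] with t h1 h2 using P.φ_lip _ h1 _ h2

theorem norm_traj_sub_le (hω : StronglyMeasurable ω) (hω' : StronglyMeasurable ω')
    (hW : ∀ᵐ t ∂P.μ, ω t ∈ P.W) (hW' : ∀ᵐ t ∂P.μ, ω' t ∈ P.W) (t : ℝ) :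
    ‖P.traj c ω t - P.traj c' ω' t‖ ≤ ‖c - c'‖ + P.K * ∫ t, ‖ω t - ω' t‖ ∂P.μ := by
  rw [traj, traj, add_sub_add_comm, ← pl2fst_sub]
  exact (norm_add_le _ _).trans
    (add_le_add (norm_pl2fst_le _) (norm_setIntegral_φ_sub_le hω hω' hW hW' _))

theorem norm_endGap_sub_le (hω : StronglyMeasurable ω) (hω' : StronglyMeasurable ω')
    (hW : ∀ᵐ t ∂P.μ, ω t ∈ P.W) (hW' : ∀ᵐ t ∂P.μ, ω' t ∈ P.W) :
    ‖P.endGap c ω - P.endGap c' ω'‖ ≤ 2 * ‖c - c'‖ + P.K * ∫ t, ‖ω t - ω' t‖ ∂P.μ := by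
  have h := norm_setIntegral_φ_sub_le hω hω' hW hW' univ
  simp only [setIntegral_univ] at h
  have e : P.endGap c ω - P.endGap c' ω' = (pl2fst (c - c') - pl2snd (c - c')) +
      (∫ t, P.φ (ω t) ∂P.μ - ∫ t, P.φ (ω' t) ∂P.μ) := by
    simp only [endGap, pl2fst_sub, pl2snd_sub]; abel
  rw [e]
  have h1 := norm_pl2fst_le (c - c')
  have h2 := norm_pl2snd_le (c - c')
  linarith [norm_add_le (pl2fst (c - c') - pl2snd (c - c'))
    (∫ t, P.φ (ω t) ∂P.μ - ∫ t, P.φ (ω' t) ∂P.μ), norm_sub_le (pl2fst (c - c')) (pl2snd (c - c'))]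

theorem abs_integral_gap_sq_sub_le (hω : StronglyMeasurable ω) (hω' : StronglyMeasurable ω')
    (hW : ∀ᵐ t ∂P.μ, ω t ∈ P.W) (hW' : ∀ᵐ t ∂P.μ, ω' t ∈ P.W) :
    |∫ t, ‖P.gap c ω t‖ ^ 2 ∂P.μ - ∫ t, ‖P.gap c' ω' t‖ ^ 2 ∂P.μ| ≤
      (gapBound P c + gapBound P c') * ((‖c - c'‖ + P.K * ∫ t, ‖ω t - ω' t‖ ∂P.μ) *
        P.μ.real univ + ∫ t, ‖ω t - ω' t‖ ∂P.μ) := by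
  have hi := integrable_norm_sub hω hω' hW hW'
  rw [← integral_sub (integrable_gap_sq hω hW) (integrable_gap_sq hω' hW')]
  set D := ‖c - c'‖ + P.K * ∫ t, ‖ω t - ω' t‖ ∂P.μ with hD
  have e : D * P.μ.real univ + ∫ t, ‖ω t - ω' t‖ ∂P.μ = ∫ t, (D + ‖ω t - ω' t‖) ∂P.μ := by
    rw [integral_add (integrable_const _) hi, integral_const, smul_eq_mul, mul_comm]
  rw [e, ← integral_const_mul]
  refine norm_integral_le_of_norm_le (G := ℝ) (((integrable_const _).add hi).const_mul _) ?_
  filter_upwards [norm_gap_le (c := c) hW, norm_gap_le (c := c') hW'] with t h1 h2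
  have h3 : ‖P.gap c ω t - P.gap c' ω' t‖ ≤ D + ‖ω t - ω' t‖ := by
    rw [gap, gap, sub_sub_sub_comm, ← pl2fst_sub]
    exact (norm_sub_le _ _).trans
      (add_le_add (norm_traj_sub_le hω hω' hW hW' t) (norm_pl2fst_le _))
  have h4 := abs_norm_sub_norm_le (P.gap c ω t) (P.gap c' ω' t)
  rw [Real.norm_eq_abs, sq_sub_sq, abs_mul, abs_of_nonneg (by positivity)]
  exact mul_le_mul (add_le_add h1 h2) (h4.trans h3) (abs_nonneg _)
    ((add_nonneg (norm_nonneg _) (norm_nonneg _)).trans (add_le_add h1 h2))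

end LocalProblem

namespace LocalProblem

variable {X Y : Type} [NormedAddCommGroup X] [InnerProductSpace ℝ X] [NormedAddCommGroup Y]
  [InnerProductSpace ℝ Y] {P : LocalProblem X Y} {c c' : PL2 X X} {ω ω' : ℝ → PL2 X Y}
  {N γ L θ : ℝ}

/-- Full penalty functional. -/
def pen (P : LocalProblem X Y) (N γ L θ : ℝ) (c : PL2 X X) (ω : ℝ → PL2 X Y) : ℝ :=
  √(P.sqPen N γ c ω) + L * ∫ t, P.ctrlPen θ t (ω t) ∂P.μ

theorem traj_congr (h : ω =ᵐ[P.μ] ω') (t : ℝ) : P.traj c ω t = P.traj c ω' t := by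
  have : ∫ s in Iic t, P.φ (ω s) ∂P.μ = ∫ s in Iic t, P.φ (ω' s) ∂P.μ :=
    integral_congr_ae (ae_restrict_of_ae (h.mono fun s hs => by simp only [hs]))
  simp only [traj, this]

theorem cost_congr (h : ω =ᵐ[P.μ] ω') : P.cost c ω = P.cost c ω' := by
  have : ∫ s, P.F (ω s) ∂P.μ = ∫ s, P.F (ω' s) ∂P.μ :=
    integral_congr_ae (h.mono fun s hs => by simp only [hs])
  simp only [cost, this]

theorem endGap_congr (h : ω =ᵐ[P.μ] ω') : P.endGap c ω = P.endGap c ω' := by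
  have : ∫ s, P.φ (ω s) ∂P.μ = ∫ s, P.φ (ω' s) ∂P.μ :=
    integral_congr_ae (h.mono fun s hs => by simp only [hs])
  simp only [endGap, this]

theorem sqPen_congr (h : ω =ᵐ[P.μ] ω') : P.sqPen N γ c ω = P.sqPen N γ c ω' := by
  have : ∫ t, ‖P.gap c ω t‖ ^ 2 ∂P.μ = ∫ t, ‖P.gap c ω' t‖ ^ 2 ∂P.μ :=
    integral_congr_ae (h.mono fun s hs => by simp only [gap, hs, traj_congr h])
  simp only [sqPen, costGap, endGap_congr h, cost_congr h, this]

theorem pen_congr (h : ω =ᵐ[P.μ] ω') : P.pen N γ L θ c ω = P.pen N γ L θ c ω' := by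
  have : ∫ s, P.ctrlPen θ s (ω s) ∂P.μ = ∫ s, P.ctrlPen θ s (ω' s) ∂P.μ :=
    integral_congr_ae (h.mono fun s hs => by simp only [hs])
  simp only [pen, sqPen_congr h, this]

theorem sqPen_nonneg (hN : 0 ≤ N) : 0 ≤ P.sqPen N γ c ω := by
  have : 0 ≤ ∫ t, ‖P.gap c ω t‖ ^ 2 ∂P.μ := integral_nonneg fun t => sq_nonneg _
  unfold sqPen
  positivity

theorem ctrlPen_integral_nonneg : 0 ≤ ∫ t, P.ctrlPen θ t (ω t) ∂P.μ :=
  integral_nonneg fun _ => ctrlPen_nonneg _ _ _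

theorem pen_nonneg (hL : 0 ≤ L) : 0 ≤ P.pen N γ L θ c ω :=
  add_nonneg (Real.sqrt_nonneg _) (mul_nonneg hL ctrlPen_integral_nonneg)

theorem traj_ws {t : ℝ} (ht : t ∈ Icc P.t0 P.t1) : P.traj P.c₀ P.ws t = P.xs t := by
  simpa [traj, c₀, ws] using (P.ref_traj t ht).symm

theorem gap_ws {t : ℝ} (ht : t ∈ Icc P.t0 P.t1) : P.gap P.c₀ P.ws t = 0 := by
  simp [gap, traj_ws ht, ws]

theorem setIntegral_Iic_t1 {G : Type} [NormedAddCommGroup G] [NormedSpace ℝ G] (g : ℝ → G) :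
    ∫ s in Iic P.t1, g s ∂P.μ = ∫ s, g s ∂P.μ := by
  rw [Measure.restrict_restrict measurableSet_Iic,
    inter_eq_right.2 fun t ht => ht.2]

theorem traj_t1 : P.traj c ω P.t1 = pl2snd c + P.endGap c ω := by
  rw [traj, setIntegral_Iic_t1, endGap]; abel

theorem endGap_ws : P.endGap P.c₀ P.ws = 0 := by
  have h := traj_t1 (P := P) (c := P.c₀) (ω := P.ws)
  rw [traj_ws (right_mem_Icc.2 P.t0_lt.le)] at h
  simpa [c₀] using h.symm

theorem pen_ws (hγ : 0 ≤ γ) (hθ : 0 ≤ θ) : P.pen N γ L θ P.c₀ P.ws = γ := by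
  have h1 : ∫ t, ‖P.gap P.c₀ P.ws t‖ ^ 2 ∂P.μ = 0 := by
    refine integral_eq_zero_of_ae ((ae_restrict_iff' measurableSet_Icc).2 (ae_of_all _ ?_))
    intro t ht
    simp [gap_ws ht]
  have h2 : ∫ t, P.ctrlPen θ t (P.ws t) ∂P.μ = 0 := integral_eq_zero_of_ae (ctrlPen_ws hθ)
  simp [pen, sqPen, h1, h2, endGap_ws, costGap, hγ]

theorem isClosed_near (t : ℝ) : IsClosed {z | P.Near t z} := by
  refine P.isClosed_C.inter (IsClosed.inter ?_ ?_)
  · exact isClosed_le (f := fun z => ‖pl2fst z - P.xs t‖)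
      (continuous_pl2fst.sub continuous_const).norm continuous_const
  · exact isClosed_le (f := fun z => ‖pl2snd z - P.us t‖)
      (continuous_pl2snd.sub continuous_const).norm continuous_const

theorem costGap_nonneg : 0 ≤ P.costGap γ c ω := le_max_right _ _

variable [MeasurableSpace X] [BorelSpace X] [FiniteDimensional ℝ X]

theorem sqPen_pos (hN : 0 < N) (hγ : 0 < γ) (hc : c ∈ P.S) (hω : StronglyMeasurable ω)
    (hn : ∀ᵐ t ∂P.μ, P.Near t (ω t)) (hρ : ∫ t, ‖ω t - P.ws t‖ ∂P.μ ≤ P.ρ) :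
    0 < P.sqPen N γ c ω := by
  refine (sqPen_nonneg hN.le).lt_of_ne fun h => ?_
  have h0 : 0 ≤ ∫ t, ‖P.gap c ω t‖ ^ 2 ∂P.μ := integral_nonneg fun t => sq_nonneg _
  unfold sqPen at h
  have h1 : ‖P.endGap c ω‖ ^ 2 = 0 := by
    linarith [sq_nonneg ‖P.endGap c ω‖, sq_nonneg (P.costGap γ c ω), mul_nonneg hN.le h0]
  have h2 : P.costGap γ c ω ^ 2 = 0 := by
    linarith [sq_nonneg ‖P.endGap c ω‖, sq_nonneg (P.costGap γ c ω), mul_nonneg hN.le h0]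
  have h3 : ∫ t, ‖P.gap c ω t‖ ^ 2 ∂P.μ = 0 := by
    have : N * ∫ t, ‖P.gap c ω t‖ ^ 2 ∂P.μ = 0 := by linarith
    exact (mul_eq_zero.1 this).resolve_left hN.ne'
  rw [integral_eq_zero_iff_of_nonneg (fun t => sq_nonneg _)
    (integrable_gap_sq hω (ae_mem_W hn))] at h3
  have h4 := P.minimal c ω hc hω hn (h3.mono fun t ht => ?_) ?_ hρ
  · have h5 : P.cost c ω - P.cost P.c₀ P.ws + γ ≤ 0 := by
      have := le_max_left (P.cost c ω - P.cost P.c₀ P.ws + γ) 0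
      have h6 : P.costGap γ c ω = 0 := by simpa using h2
      rw [costGap] at h6
      exact this.trans h6.le
    have h6 : P.cost P.c₀ P.ws ≤ P.cost c ω := h4
    linarith
  · have : P.gap c ω t = 0 := by simpa using ht
    exact (sub_eq_zero.1 this).symm
  · have : P.endGap c ω = 0 := by simpa using h1
    rw [endGap] at this
    rw [← sub_eq_zero, ← this]
    abel

theorem tendsto_pen {ι : Type} {l : Filter ι} {cs : ι → PL2 X X} {ωs : ι → ℝ → PL2 X Y}
    (hθ : 0 ≤ θ) (hω : StronglyMeasurable ω)
    (hW : ∀ᵐ t ∂P.μ, ω t ∈ P.W) (hωs : ∀ i, StronglyMeasurable (ωs i))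
    (hWs : ∀ᶠ i in l, ∀ᵐ t ∂P.μ, ωs i t ∈ P.W) (hc : Tendsto cs l (𝓝 c))
    (hd : Tendsto (fun i => ∫ t, ‖ωs i t - ω t‖ ∂P.μ) l (𝓝 0)) :
    Tendsto (fun i => P.pen N γ L θ (cs i) (ωs i)) l (𝓝 (P.pen N γ L θ c ω)) := by
  have hc0 : Tendsto (fun i => ‖cs i - c‖) l (𝓝 0) := by
    simpa using (tendsto_iff_norm_sub_tendsto_zero.1 hc)
  have key : ∀ {a : ι → ℝ} {b : ℝ} {e : ι → ℝ}, (∀ᶠ i in l, |a i - b| ≤ e i) →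
      Tendsto e l (𝓝 0) → Tendsto a l (𝓝 b) := by
    intro a b e h he
    rw [tendsto_iff_norm_sub_tendsto_zero]
    exact squeeze_zero' (Eventually.of_forall fun _ => norm_nonneg _) h he
  have h1 : Tendsto (fun i => P.endGap (cs i) (ωs i)) l (𝓝 (P.endGap c ω)) := by
    rw [tendsto_iff_norm_sub_tendsto_zero]
    refine squeeze_zero' (Eventually.of_forall fun _ => norm_nonneg _)
      (hWs.mono fun i hi => norm_endGap_sub_le (hωs i) hω hi hW) ?_
    simpa using (hc0.const_mul 2).add (hd.const_mul P.K)
  have h2 : Tendsto (fun i => P.cost (cs i) (ωs i)) l (𝓝 (P.cost c ω)) := by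
    refine Tendsto.add (key (hWs.mono fun i hi => abs_integral_F_sub_le (hωs i) hω hi hW)
      (by simpa using hd.const_mul P.K)) ((P.lipschitz_f.continuous.tendsto c).comp hc)
  have h3 : Tendsto (fun i => ∫ t, ‖P.gap (cs i) (ωs i) t‖ ^ 2 ∂P.μ) l
      (𝓝 (∫ t, ‖P.gap c ω t‖ ^ 2 ∂P.μ)) := by
    refine key (hWs.mono fun i hi => abs_integral_gap_sq_sub_le (hωs i) hω hi hW) ?_
    have h4 : Tendsto (fun i => gapBound P (cs i)) l (𝓝 (gapBound P c)) := by
      unfold gapBound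
      exact ((((continuous_pl2fst.tendsto c).comp hc).norm).add_const _).add_const _
    have := (h4.add_const (gapBound P c)).mul
      (((hc0.add (hd.const_mul P.K)).mul_const (P.μ.real univ)).add hd)
    simpa using this
  have h5 : Tendsto (fun i => ∫ t, P.ctrlPen θ t (ωs i t) ∂P.μ) l
      (𝓝 (∫ t, P.ctrlPen θ t (ω t) ∂P.μ)) :=
    key (hWs.mono fun i hi => abs_integral_ctrlPen_sub_le hθ (hωs i) hω hi hW) hd
  have h6 : Tendsto (fun i => P.costGap γ (cs i) (ωs i)) l (𝓝 (P.costGap γ c ω)) :=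
    ((h2.sub_const _).add_const γ).max tendsto_const_nhds
  exact (Real.continuous_sqrt.tendsto _ |>.comp
    (((h1.norm.pow 2).add (h6.pow 2)).add (h3.const_mul N))).add (h5.const_mul L)

theorem exists_ekeland_process [FiniteDimensional ℝ Y] (hγ : 0 < γ) (hL : 0 ≤ L)
    (hθ : 0 ≤ θ) {σ ρ : ℝ} (hσ : 0 < σ) (hρ : 0 < ρ) :
    ∃ (c : PL2 X X) (ω : ℝ → PL2 X Y), c ∈ P.S ∧ StronglyMeasurable ω ∧
      (∀ᵐ t ∂P.μ, P.Near t (ω t)) ∧ P.pen N γ L θ c ω ≤ γ ∧ σ * ‖c - P.c₀‖ ≤ γ ∧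
      σ * ∫ t, ‖ω t - P.ws t‖ ∂P.μ ≤ γ ∧
      ∀ (c' : PL2 X X) (ω' : ℝ → PL2 X Y), c' ∈ P.S → StronglyMeasurable ω' →
        (∀ᵐ t ∂P.μ, P.Near t (ω' t)) → ‖c' - P.c₀‖ ≤ ρ → ∫ t, ‖ω' t - P.ws t‖ ∂P.μ ≤ ρ →
        P.pen N γ L θ c ω ≤ P.pen N γ L θ c' ω' +
          σ * (‖c' - c‖ + ∫ t, ‖ω' t - ω t‖ ∂P.μ) := by
  have : CompleteSpace (PL2 X Y) := FiniteDimensional.complete ℝ _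
  have : CompleteSpace (PL2 X X) := FiniteDimensional.complete ℝ _
  have hwi := integrable_of_mem_W (P := P) stronglyMeasurable_ws (ae_mem_W near_ws)
  set w₀ : PL2 X X × Lp (PL2 X Y) 1 P.μ := (P.c₀, hwi.toL1 P.ws) with hw₀
  set A : Set (PL2 X X × Lp (PL2 X Y) 1 P.μ) :=
    {w | w.1 ∈ P.S ∧ (∀ᵐ t ∂P.μ, P.Near t (w.2 t)) ∧ dist w w₀ ≤ ρ} with hA
  have hsm : ∀ w : Lp (PL2 X Y) 1 P.μ, StronglyMeasurable w := fun w => Lp.stronglyMeasurable w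
  have hdist : ∀ (v w : Lp (PL2 X Y) 1 P.μ) (v' w' : ℝ → PL2 X Y), v =ᵐ[P.μ] v' → w =ᵐ[P.μ] w' →
      dist v w = ∫ t, ‖v' t - w' t‖ ∂P.μ := by
    intro v w v' w' hv hw
    rw [L1.dist_eq_integral_dist]
    refine integral_congr_ae ?_
    filter_upwards [hv, hw] with t h1 h2
    simp only [h1, h2, dist_eq_norm]
  have hclosed : IsClosed A := by
    refine IsSeqClosed.isClosed fun ws w hws hlim => ⟨?_, ?_, ?_⟩
    · exact P.isClosed_S.mem_of_tendsto ((continuous_fst.tendsto w).comp hlim)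
        (Eventually.of_forall fun n => (hws n).1)
    · obtain ⟨ns, -, hns⟩ := (tendstoInMeasure_of_tendsto_Lp
        ((continuous_snd.tendsto w).comp hlim)).exists_seq_tendsto_ae
      filter_upwards [hns, ae_all_iff.2 fun n => (hws n).2.1] with t h1 h2
      exact (isClosed_near t).mem_of_tendsto h1 (Eventually.of_forall fun n => h2 _)
    · exact le_of_tendsto (hlim.dist tendsto_const_nhds) (Eventually.of_forall fun n => (hws n).2.2)
  have hcont : ContinuousOn (fun w : PL2 X X × Lp (PL2 X Y) 1 P.μ => P.pen N γ L θ w.1 w.2) A := by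
    intro w hw
    refine tendsto_pen hθ (hsm _) (ae_mem_W hw.2.1) (fun v => hsm v.2) ?_ ?_ ?_
    · exact eventually_mem_nhdsWithin.mono fun v hv => ae_mem_W hv.2.1
    · exact (continuous_fst.tendsto w).mono_left nhdsWithin_le_nhds
    · have : Tendsto (fun v : PL2 X X × Lp (PL2 X Y) 1 P.μ => dist v.2 w.2) (𝓝[A] w) (𝓝 0) := by
        have h := ((continuous_snd.tendsto w).mono_left
          (nhdsWithin_le_nhds (s := A))).dist (tendsto_const_nhds (x := w.2))
        simpa using h
      exact this.congr fun v => hdist _ _ _ _ (EventuallyEq.refl _ _) (EventuallyEq.refl _ _)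
  have hw₀A : w₀ ∈ A := by
    refine ⟨P.ref_endpoints, ?_, by simpa using hρ.le⟩
    filter_upwards [Integrable.coeFn_toL1 hwi, near_ws (P := P)] with t h1 h2
    rw [hw₀]
    simpa only [h1] using h2
  obtain ⟨w, hwA, h1, h2⟩ := exists_ekeland_point hclosed hcont (fun w _ => pen_nonneg hL) hσ hw₀A
  have h3 : P.pen N γ L θ w₀.1 w₀.2 = γ := by
    rw [pen_congr (Integrable.coeFn_toL1 hwi)]; exact pen_ws hγ.le hθ
  simp only [h3] at h1
  have hp : 0 ≤ P.pen N γ L θ w.1 w.2 := pen_nonneg hL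
  have hd1 : ‖w.1 - P.c₀‖ ≤ dist w w₀ := by rw [← dist_eq_norm]; exact le_max_left _ _
  have hd2 : ∫ t, ‖w.2 t - P.ws t‖ ∂P.μ ≤ dist w w₀ := by
    rw [← hdist w.2 w₀.2 _ _ (EventuallyEq.refl _ _) (Integrable.coeFn_toL1 hwi)]
    exact le_max_right _ _
  refine ⟨w.1, w.2, hwA.1, hsm _, hwA.2.1, ?_, ?_, ?_, ?_⟩
  · nlinarith [mul_nonneg hσ.le (dist_nonneg (x := w) (y := w₀))]
  · nlinarith [mul_le_mul_of_nonneg_left hd1 hσ.le]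
  · nlinarith [mul_le_mul_of_nonneg_left hd2 hσ.le]
  · intro c' ω' hc' hω' hn hcρ hωρ
    have hi := integrable_of_mem_W (P := P) hω' (ae_mem_W hn)
    have hco := Integrable.coeFn_toL1 hi
    have h4 := h2 (c', hi.toL1 ω') ⟨hc', ?_, ?_⟩
    · refine h4.trans ?_
      simp only [pen_congr hco]
      gcongr
      rw [Prod.dist_eq, hdist (hi.toL1 ω') w.2 _ _ hco (EventuallyEq.refl _ _), dist_eq_norm]
      exact max_le_add_of_nonneg (norm_nonneg _) (integral_nonneg fun t => norm_nonneg _)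
    · filter_upwards [hco, hn] with t h1 h2
      simpa only [h1] using h2
    · rw [Prod.dist_eq, hdist (hi.toL1 ω') w₀.2 _ _ hco (Integrable.coeFn_toL1 hwi), dist_eq_norm]
      exact max_le hcρ hωρ

end LocalProblem

theorem integrable_inner_of_norm_le {E : Type} [NormedAddCommGroup E] [InnerProductSpace ℝ E]
    [SecondCountableTopology E] [MeasurableSpace E] [BorelSpace E] {ν : Measure ℝ}
    [IsFiniteMeasure ν] {g h : ℝ → E} (hg : Measurable g) (hh : Measurable h)
    {a b : ℝ} (ha : ∀ᵐ t ∂ν, ‖g t‖ ≤ a) (hb : ∀ᵐ t ∂ν, ‖h t‖ ≤ b) :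
    Integrable (fun t => ⟪g t, h t⟫) ν := by
  refine (hg.inner hh).integrable_of_norm_le (K := |a| * |b|) ?_
  filter_upwards [ha, hb] with t h1 h2
  refine (abs_real_inner_le_norm _ _).trans ?_
  gcongr
  · exact h1.trans (le_abs_self _)
  · exact h2.trans (le_abs_self _)

namespace LocalProblem

variable {X Y : Type} [NormedAddCommGroup X] [InnerProductSpace ℝ X] [NormedAddCommGroup Y]
  [InnerProductSpace ℝ Y] {P : LocalProblem X Y} {c c' : PL2 X X} {ω ω' : ℝ → PL2 X Y}
  {N γ L θ : ℝ} {z : PL2 X Y} {A : Set ℝ}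

/-- Unnormalized adjoint arc. -/
def rawAdj (P : LocalProblem X Y) (N : ℝ) (c : PL2 X X) (ω : ℝ → PL2 X Y) (t : ℝ) : X :=
  P.endGap c ω + N • ∫ s in Ici t, P.gap c ω s ∂P.μ

/-- First-order rate of the squared penalty under a needle variation with value `z` at `t`. -/
def needleRate (P : LocalProblem X Y) (N γ : ℝ) (c : PL2 X X) (ω : ℝ → PL2 X Y) (z : PL2 X Y)
    (t : ℝ) : ℝ :=
  ⟪P.rawAdj N c ω t, P.φ z - P.φ (ω t)⟫ + P.costGap γ c ω * (P.F z - P.F (ω t)) +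
    N / 2 * (‖P.traj c ω t - pl2fst z‖ ^ 2 - ‖P.gap c ω t‖ ^ 2)

/-- Remainder constant in the needle variation estimate. -/
def needleConst (P : LocalProblem X Y) (N : ℝ) : ℝ :=
  8 * P.K ^ 2 + N * (4 * P.K ^ 2 * P.μ.real univ + 8 * P.B * P.K)

theorem max_add_sq_le (a h : ℝ) : max (a + h) 0 ^ 2 ≤ max a 0 ^ 2 + 2 * (max a 0 * h) + h ^ 2 := by
  rcases le_total a 0 with ha | ha <;> rcases le_total (a + h) 0 with hh | hh
  · rw [max_eq_right ha, max_eq_right hh]; nlinarith [sq_nonneg h]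
  · rw [max_eq_right ha, max_eq_left hh]; nlinarith
  · rw [max_eq_left ha, max_eq_right hh]; nlinarith [sq_nonneg (a + h)]
  · rw [max_eq_left ha, max_eq_left hh]; nlinarith

theorem norm_indicator_sub_le {G : Type} [NormedAddCommGroup G] {M : ℝ} {a : G}
    {b : ℝ → G} {t : ℝ} (ha : ‖a‖ ≤ M) (hb : ‖b t‖ ≤ M) :
    ‖A.indicator (fun t => a - b t) t‖ ≤ A.indicator (fun _ => 2 * M) t := by
  by_cases ht : t ∈ A
  · simp only [indicator_of_mem ht]
    exact (norm_sub_le _ _).trans (by linarith)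
  · simp [indicator_of_notMem ht]

theorem norm_rawAdj_le (hN : 0 ≤ N) (hW : ∀ᵐ t ∂P.μ, ω t ∈ P.W) (t : ℝ) :
    ‖P.rawAdj N c ω t‖ ≤ ‖P.endGap c ω‖ + N * (gapBound P c * P.μ.real univ) := by
  refine (norm_add_le _ _).trans ?_
  rw [norm_smul, Real.norm_of_nonneg hN]
  gcongr
  have h0 : 0 ≤ gapBound P c := by
    have := P.K_pos; have := P.B_pos
    unfold gapBound; positivity
  refine (norm_setIntegral_le_of_norm_le_const_ae' (measure_lt_top _ _)
    ((norm_gap_le hW).mono fun s hs _ => hs)).trans ?_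
  exact mul_le_mul_of_nonneg_left (measureReal_mono (subset_univ _)) h0

variable [MeasurableSpace X] [BorelSpace X] [FiniteDimensional ℝ X]

theorem measurable_rawAdj (hω : StronglyMeasurable ω) : Measurable (P.rawAdj N c ω) :=
  ((measurable_setIntegral_Ici (measurable_gap hω)).const_smul N).const_add _

theorem measurable_needleRate (hω : StronglyMeasurable ω) :
    Measurable (P.needleRate N γ c ω z) :=
  (((measurable_rawAdj hω).inner ((measurable_φ hω).const_sub _)).add
    (((measurable_F hω).const_sub _).const_mul _)).add
    (((((measurable_traj hω).sub_const _).norm.pow_const 2).sub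
      ((measurable_gap hω).norm.pow_const 2)).const_mul _)

theorem integrable_needleRate (hN : 0 ≤ N) (hω : StronglyMeasurable ω)
    (hW : ∀ᵐ t ∂P.μ, ω t ∈ P.W) (hz : z ∈ P.W) :
    Integrable (P.needleRate N γ c ω z) P.μ := by
  refine Integrable.add (Integrable.add ?_ ?_) ?_
  · exact integrable_inner_of_norm_le (measurable_rawAdj hω) ((measurable_φ hω).const_sub _)
      (ae_of_all _ (norm_rawAdj_le hN hW)) (b := 2 * P.K)
      (hW.mono fun t ht => (norm_sub_le _ _).trans (by
        linarith [P.φ_bound _ ht, P.φ_bound _ hz]))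
  · exact ((integrable_const _).sub (integrable_F hω hW)).const_mul _
  · refine (Integrable.sub ?_ (integrable_gap_sq hω hW)).const_mul _
    refine (((measurable_traj hω).sub_const _).norm.pow_const 2).integrable_of_norm_le
      (K := (‖pl2fst c‖ + P.K * P.μ.real univ + ‖pl2fst z‖) ^ 2) (ae_of_all _ fun t => ?_)
    rw [norm_pow, norm_norm]
    gcongr
    exact (norm_sub_le _ _).trans (add_le_add_left (norm_traj_le hW t) _)

open scoped Classical in
theorem sqPen_needle_le (hN : 0 ≤ N) (hω : StronglyMeasurable ω) (hW : ∀ᵐ t ∂P.μ, ω t ∈ P.W)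
    (hz : z ∈ P.W) (hA : MeasurableSet A) :
    P.sqPen N γ c (A.piecewise (fun _ => z) ω) ≤ P.sqPen N γ c ω +
      2 * (∫ t in A, P.needleRate N γ c ω z t ∂P.μ) + needleConst P N * P.μ.real A ^ 2 := by
  have hK := P.K_pos
  have hB := P.B_pos
  set ω' := A.piecewise (fun _ => z) ω with hω'
  have hω'm : StronglyMeasurable ω' := StronglyMeasurable.piecewise hA stronglyMeasurable_const hω
  have hW' : ∀ᵐ t ∂P.μ, ω' t ∈ P.W := by
    filter_upwards [hW] with t ht
    by_cases h : t ∈ A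
    · rwa [hω', piecewise_eq_of_mem _ _ _ h]
    · rwa [hω', piecewise_eq_of_notMem _ _ _ h]
  set m := P.μ.real A with hm
  have hm0 : 0 ≤ m := measureReal_nonneg
  set d : ℝ → X := A.indicator fun t => P.φ z - P.φ (ω t) with hd
  set e : ℝ → ℝ := A.indicator fun t => P.F z - P.F (ω t) with he
  set Δ : ℝ → X := fun t => ∫ s in Iic t, d s ∂P.μ with hΔ
  have hdm : Measurable d := ((measurable_φ hω).const_sub _).indicator hA
  have hem : Measurable e := ((measurable_F hω).const_sub _).indicator hA
  have hdb : ∀ᵐ t ∂P.μ, ‖d t‖ ≤ A.indicator (fun _ => 2 * P.K) t :=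
    hW.mono fun t ht => norm_indicator_sub_le (b := fun t => P.φ (ω t))
      (P.φ_bound _ hz) (P.φ_bound _ ht)
  have heb : ∀ᵐ t ∂P.μ, ‖e t‖ ≤ A.indicator (fun _ => 2 * P.K) t :=
    hW.mono fun t ht => norm_indicator_sub_le (b := fun t => P.F (ω t))
      (P.F_bound _ hz) (P.F_bound _ ht)
  have hind : ∀ t, A.indicator (fun _ => 2 * P.K) t ≤ 2 * P.K := fun t =>
    indicator_le_self' (fun _ _ => by positivity) t
  have hdb2 : ∀ᵐ t ∂P.μ, ‖d t‖ ≤ 2 * P.K := hdb.mono fun t ht => ht.trans (hind t)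
  have hdi : Integrable d P.μ := hdm.integrable_of_norm_le hdb2
  have hei : Integrable e P.μ := hem.integrable_of_norm_le (heb.mono fun t ht => ht.trans (hind t))
  have hci : Integrable (A.indicator fun _ => 2 * P.K) P.μ := (integrable_const _).indicator hA
  have hcint : ∫ t, A.indicator (fun _ => 2 * P.K) t ∂P.μ = 2 * P.K * m := by
    rw [integral_indicator hA, setIntegral_const, smul_eq_mul, mul_comm]
  have hΔb : ∀ t, ‖Δ t‖ ≤ 2 * P.K * m := fun t => by
    rw [← hcint]
    exact (norm_integral_le_of_norm_le hci.integrableOn (ae_restrict_of_ae hdb)).trans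
      (setIntegral_le_integral hci (ae_of_all _ fun t => indicator_nonneg
        (fun _ _ => by positivity) t))
  have hdint : ‖∫ t, d t ∂P.μ‖ ≤ 2 * P.K * m := by
    rw [← hcint]; exact norm_integral_le_of_norm_le hci hdb
  have heint : |∫ t, e t ∂P.μ| ≤ 2 * P.K * m := by
    rw [← hcint]; exact norm_integral_le_of_norm_le hci heb
  have hφ' : ∀ t, P.φ (ω' t) = P.φ (ω t) + d t := fun t => by
    by_cases h : t ∈ A
    · rw [hω', hd, piecewise_eq_of_mem _ _ _ h, indicator_of_mem h]; abel
    · rw [hω', hd, piecewise_eq_of_notMem _ _ _ h, indicator_of_notMem h, add_zero]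
  have hF' : ∀ t, P.F (ω' t) = P.F (ω t) + e t := fun t => by
    by_cases h : t ∈ A
    · rw [hω', he, piecewise_eq_of_mem _ _ _ h, indicator_of_mem h]; ring
    · rw [hω', he, piecewise_eq_of_notMem _ _ _ h, indicator_of_notMem h, add_zero]
  have htraj : ∀ t, P.traj c ω' t = P.traj c ω t + Δ t := fun t => by
    simp only [traj, hφ', hΔ]
    rw [integral_add (integrable_φ hω hW).integrableOn hdi.integrableOn, add_assoc]
  have hend : P.endGap c ω' = P.endGap c ω + ∫ t, d t ∂P.μ := by
    simp only [endGap, hφ']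
    rw [integral_add (integrable_φ hω hW) hdi, add_assoc]
  have hcost : P.cost c ω' = P.cost c ω + ∫ t, e t ∂P.μ := by
    simp only [cost, hF']
    rw [integral_add (integrable_F hω hW) hei]; ring
  set b : ℝ → ℝ := A.indicator fun t => ‖P.traj c ω t - pl2fst z‖ ^ 2 - ‖P.gap c ω t‖ ^ 2 with hb
  have hΔm : Measurable Δ := measurable_setIntegral_Iic hdm
  have hgΔ : Integrable (fun t => ⟪P.gap c ω t, Δ t⟫) P.μ :=
    integrable_inner_of_norm_le (measurable_gap hω) hΔm (norm_gap_le hW) (ae_of_all _ hΔb)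
  have hbi : Integrable b P.μ := by
    refine (Integrable.sub ?_ (integrable_gap_sq hω hW)).indicator hA
    refine (((measurable_traj hω).sub_const _).norm.pow_const 2).integrable_of_norm_le
      (K := (‖pl2fst c‖ + P.K * P.μ.real univ + ‖pl2fst z‖) ^ 2) (ae_of_all _ fun t => ?_)
    rw [norm_pow, norm_norm]
    gcongr
    exact (norm_sub_le _ _).trans (add_le_add_left (norm_traj_le hW t) _)
  have hgap : ∀ᵐ t ∂P.μ, ‖P.gap c ω' t‖ ^ 2 ≤ ‖P.gap c ω t‖ ^ 2 + 2 * ⟪P.gap c ω t, Δ t⟫ +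
      4 * P.K ^ 2 * m ^ 2 + b t + 4 * P.B * m * A.indicator (fun _ => 2 * P.K) t := by
    filter_upwards [hW] with t ht
    have hsq : ‖Δ t‖ ^ 2 ≤ 4 * P.K ^ 2 * m ^ 2 := by
      have := pow_le_pow_left₀ (norm_nonneg _) (hΔb t) 2
      nlinarith
    by_cases h : t ∈ A
    · rw [hb, indicator_of_mem h, indicator_of_mem h, gap, htraj, hω', piecewise_eq_of_mem _ _ _ h]
      have e1 : P.traj c ω t + Δ t - pl2fst z = (P.traj c ω t - pl2fst z) + Δ t := by abel
      have e2 : P.traj c ω t - pl2fst z = P.gap c ω t + pl2fst (ω t - z) := by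
        rw [gap, pl2fst_sub]; abel
      have e3 : ‖pl2fst (ω t - z)‖ ≤ 2 * P.B :=
        (norm_pl2fst_le _).trans ((norm_sub_le _ _).trans (by
          linarith [P.norm_le_B _ ht, P.norm_le_B _ hz]))
      have e4 : ⟪pl2fst (ω t - z), Δ t⟫ ≤ 2 * P.B * (2 * P.K * m) :=
        (real_inner_le_norm _ _).trans
          (mul_le_mul e3 (hΔb t) (norm_nonneg _) (by positivity))
      have e5 : ⟪P.traj c ω t - pl2fst z, Δ t⟫ = ⟪P.gap c ω t, Δ t⟫ + ⟪pl2fst (ω t - z), Δ t⟫ := by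
        rw [e2, inner_add_left]
      rw [e1, norm_add_sq_real, e5]
      linarith
    · rw [hb, indicator_of_notMem h, indicator_of_notMem h, gap, htraj, hω',
        piecewise_eq_of_notMem _ _ _ h]
      have e1 : P.traj c ω t + Δ t - pl2fst (ω t) = P.gap c ω t + Δ t := by rw [gap]; abel
      rw [e1, norm_add_sq_real]
      linarith
  have hgapint : ∫ t, ‖P.gap c ω' t‖ ^ 2 ∂P.μ ≤ (∫ t, ‖P.gap c ω t‖ ^ 2 ∂P.μ) +
      2 * (∫ t, ⟪P.gap c ω t, Δ t⟫ ∂P.μ) + 4 * P.K ^ 2 * m ^ 2 * P.μ.real univ +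
      (∫ t, b t ∂P.μ) + 4 * P.B * m * (2 * P.K * m) := by
    have i1 := integrable_gap_sq (c := c) hω hW
    have i2 := i1.add (hgΔ.const_mul 2)
    have i3 := i2.add (integrable_const (μ := P.μ) (4 * P.K ^ 2 * m ^ 2))
    have i4 := i3.add hbi
    have i5 := hci.const_mul (4 * P.B * m)
    refine (integral_mono_ae (integrable_gap_sq hω'm hW') (i4.add i5) hgap).trans_eq ?_
    rw [integral_add' i4 i5, integral_add' i3 hbi, integral_add' i2 (integrable_const _),
      integral_add' i1 (hgΔ.const_mul 2), integral_const_mul, integral_const_mul (4 * P.B * m),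
      hcint, integral_const, smul_eq_mul]
    ring
  have hfub : ∫ t, ⟪P.gap c ω t, Δ t⟫ ∂P.μ = ∫ s, ⟪∫ t in Ici s, P.gap c ω t ∂P.μ, d s⟫ ∂P.μ :=
    integral_inner_setIntegral_Iic (measurable_gap hω) hdm (norm_gap_le hW) hdb2
  have hGd : Integrable (fun s => ⟪∫ t in Ici s, P.gap c ω t ∂P.μ, d s⟫) P.μ := by
    have h0 : 0 ≤ gapBound P c := by unfold gapBound; positivity
    refine integrable_inner_of_norm_le (measurable_setIntegral_Ici (measurable_gap hω)) hdm
      (a := gapBound P c * P.μ.real univ) (ae_of_all _ fun t => ?_) hdb2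
    refine (norm_setIntegral_le_of_norm_le_const_ae' (measure_lt_top _ _)
      ((norm_gap_le hW).mono fun s hs _ => hs)).trans ?_
    exact mul_le_mul_of_nonneg_left (measureReal_mono (subset_univ _)) h0
  have hrate : ∫ t in A, P.needleRate N γ c ω z t ∂P.μ = ⟪P.endGap c ω, ∫ t, d t ∂P.μ⟫ +
      N * (∫ t, ⟪P.gap c ω t, Δ t⟫ ∂P.μ) + P.costGap γ c ω * (∫ t, e t ∂P.μ) +
      N / 2 * ∫ t, b t ∂P.μ := by
    have j1 : Integrable (fun t => ⟪P.endGap c ω, d t⟫) P.μ := hdi.const_inner _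
    have j2 := hGd.const_mul N
    have j3 : Integrable (fun t => ⟪P.endGap c ω, d t⟫ +
      N * ⟪∫ s in Ici t, P.gap c ω s ∂P.μ, d t⟫) P.μ := j1.add j2
    have j4 := hei.const_mul (P.costGap γ c ω)
    have j5 : Integrable (fun t => ⟪P.endGap c ω, d t⟫ +
      N * ⟪∫ s in Ici t, P.gap c ω s ∂P.μ, d t⟫ + P.costGap γ c ω * e t) P.μ := j3.add j4
    rw [hfub, ← integral_inner hdi, ← integral_const_mul, ← integral_const_mul,
      ← integral_const_mul, ← integral_add j1 j2, ← integral_add j3 j4,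
      ← integral_add j5 (hbi.const_mul _), ← integral_indicator hA]
    refine integral_congr_ae (ae_of_all _ fun t => ?_)
    by_cases h : t ∈ A
    · simp only [hd, he, hb, indicator_of_mem h, needleRate, rawAdj, inner_add_left,
        real_inner_smul_left]
    · simp [hd, he, hb, indicator_of_notMem h]
  have hsq1 : ‖∫ t, d t ∂P.μ‖ ^ 2 ≤ 4 * P.K ^ 2 * m ^ 2 := by
    have := pow_le_pow_left₀ (norm_nonneg _) hdint 2
    nlinarith
  have hsq2 : (∫ t, e t ∂P.μ) ^ 2 ≤ 4 * P.K ^ 2 * m ^ 2 := by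
    have := pow_le_pow_left₀ (abs_nonneg _) heint 2
    rw [sq_abs] at this
    nlinarith
  have hcg : P.costGap γ c ω' ^ 2 ≤ P.costGap γ c ω ^ 2 +
      2 * (P.costGap γ c ω * ∫ t, e t ∂P.μ) + (∫ t, e t ∂P.μ) ^ 2 := by
    have := max_add_sq_le (P.cost c ω - P.cost P.c₀ P.ws + γ) (∫ t, e t ∂P.μ)
    rwa [show P.cost c ω - P.cost P.c₀ P.ws + γ + ∫ t, e t ∂P.μ =
      P.cost c ω' - P.cost P.c₀ P.ws + γ by rw [hcost]; ring] at this
  have hN1 := mul_le_mul_of_nonneg_left hgapint hN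
  rw [hrate]
  unfold sqPen needleConst
  rw [hend, norm_add_sq_real]
  linarith

end LocalProblem

open scoped Classical in
theorem integral_piecewise_eq_add {G : Type} {ν : Measure ℝ} {A : Set ℝ} (hA : MeasurableSet A)
    {z : G} {ω : ℝ → G} {g : ℝ → G → ℝ} (h1 : Integrable (fun t => g t (ω t)) ν)
    (h2 : Integrable (fun t => g t z) ν) :
    ∫ t, g t (A.piecewise (fun _ => z) ω t) ∂ν =
      (∫ t, g t (ω t) ∂ν) + ∫ t in A, (g t z - g t (ω t)) ∂ν := by
  have h3 : Integrable (A.indicator fun t => g t z - g t (ω t)) ν := (h2.sub h1).indicator hA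
  rw [← integral_indicator hA, ← integral_add h1 h3]
  refine integral_congr_ae (ae_of_all _ fun t => ?_)
  by_cases h : t ∈ A <;> simp [h]

namespace LocalProblem

variable {X Y : Type} [NormedAddCommGroup X] [InnerProductSpace ℝ X] [NormedAddCommGroup Y]
  [InnerProductSpace ℝ Y] {P : LocalProblem X Y} {c c' : PL2 X X} {ω ω' : ℝ → PL2 X Y}
  {N γ L θ σ ρ : ℝ} {z : PL2 X Y} {A : Set ℝ}

/-- Normalized first-order rate of the full perturbed penalty. -/
def slopeRate (P : LocalProblem X Y) (N γ L θ σ : ℝ) (c : PL2 X X) (ω : ℝ → PL2 X Y)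
    (z : PL2 X Y) (t : ℝ) : ℝ :=
  P.needleRate N γ c ω z t / √(P.sqPen N γ c ω) +
    L * (P.ctrlPen θ t z - P.ctrlPen θ t (ω t)) + σ * ‖z - ω t‖

theorem sqrt_le_sqrt_add {a b : ℝ} (ha : 0 < a) (hb : 0 ≤ b) :
    √b ≤ √a + (b - a) / (2 * √a) := by
  have h : 0 < √a := Real.sqrt_pos.2 ha
  rw [← sub_le_iff_le_add', le_div_iff₀ (by positivity)]
  nlinarith [Real.sq_sqrt ha.le, Real.sq_sqrt hb, sq_nonneg (√a - √b)]

theorem measurableSet_near [MeasurableSpace Y] [BorelSpace Y] : MeasurableSet {t | P.Near t z} := by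
  have h1 : MeasurableSet {t | ‖pl2fst z - P.xs t‖ ≤ P.ε} :=
    measurableSet_le ((stronglyMeasurable_const.sub P.measurable_xs).norm.measurable)
      measurable_const
  have h2 : MeasurableSet {t | ‖pl2snd z - P.us t‖ ≤ P.r t} :=
    measurableSet_le ((stronglyMeasurable_const.sub P.measurable_us).norm.measurable)
      P.measurable_r
  exact (MeasurableSet.const (z ∈ P.C)).inter (h1.inter h2)

theorem measurable_ctrlPen (hω : StronglyMeasurable ω) :
    Measurable fun t => P.ctrlPen θ t (ω t) :=
  ((((continuous_pl2snd.comp_stronglyMeasurable hω).sub P.measurable_us).norm.measurable).sub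
    (P.measurable_r.const_mul θ)).max measurable_const

theorem continuous_slopeRate (t : ℝ) : Continuous fun z => P.slopeRate N γ L θ σ c ω z t := by
  have h1 := P.continuous_φ
  have h2 := P.continuous_F
  have h3 : Continuous fun z : PL2 X Y => pl2fst z := continuous_pl2fst
  have h4 : Continuous fun z : PL2 X Y => pl2snd z := continuous_pl2snd
  unfold slopeRate needleRate ctrlPen
  fun_prop

variable [MeasurableSpace X] [BorelSpace X] [FiniteDimensional ℝ X]

theorem measurable_slopeRate (hω : StronglyMeasurable ω) :
    Measurable (P.slopeRate N γ L θ σ c ω z) :=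
  (((measurable_needleRate hω).div_const _).add
    (((measurable_ctrlPen stronglyMeasurable_const).sub (measurable_ctrlPen hω)).const_mul L)).add
    ((stronglyMeasurable_const.sub hω).norm.measurable.const_mul σ)

open scoped Classical in
theorem ae_slopeRate_nonneg_of_mem_W (hN : 0 ≤ N) (hθ : 0 ≤ θ)
    (hω : StronglyMeasurable ω) (hn : ∀ᵐ t ∂P.μ, P.Near t (ω t)) (hQ : 0 < P.sqPen N γ c ω)
    (hρ : ∫ t, ‖ω t - P.ws t‖ ∂P.μ < ρ)
    (hmin : ∀ ω', StronglyMeasurable ω' → (∀ᵐ t ∂P.μ, P.Near t (ω' t)) →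
      ∫ t, ‖ω' t - P.ws t‖ ∂P.μ ≤ ρ →
      P.pen N γ L θ c ω ≤ P.pen N γ L θ c ω' + σ * ∫ t, ‖ω' t - ω t‖ ∂P.μ)
    (hz : z ∈ P.W) :
    ∀ᵐ t ∂P.μ, P.Near t z → 0 ≤ P.slopeRate N γ L θ σ c ω z t := by
  have hW := ae_mem_W hn
  have hB := P.B_pos
  have hconst : StronglyMeasurable fun _ : ℝ => z := stronglyMeasurable_const
  have hWc : ∀ᵐ _t ∂P.μ, z ∈ P.W := ae_of_all _ fun _ => hz
  have i1 := integrable_needleRate (c := c) (γ := γ) hN hω hW hz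
  have i2 : Integrable (fun t => P.ctrlPen θ t z - P.ctrlPen θ t (ω t)) P.μ :=
    (integrable_ctrlPen hθ hconst hWc).sub (integrable_ctrlPen hθ hω hW)
  have i3 : Integrable (fun t => ‖z - ω t‖) P.μ := integrable_norm_sub hconst hω hWc hW
  have i4 := i1.div_const (√(P.sqPen N γ c ω))
  have i5 := i2.const_mul L
  have i6 := i3.const_mul σ
  have i45 : Integrable (fun t => P.needleRate N γ c ω z t / √(P.sqPen N γ c ω) +
    L * (P.ctrlPen θ t z - P.ctrlPen θ t (ω t))) P.μ := i4.add i5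
  have hs : 0 < √(P.sqPen N γ c ω) := Real.sqrt_pos.2 hQ
  refine ae_nonneg_of_forall_small_setIntegral (T := {t | P.Near t z})
    (C := needleConst P N / (2 * √(P.sqPen N γ c ω)))
    (α := (ρ - ∫ t, ‖ω t - P.ws t‖ ∂P.μ) / (2 * P.B))
    (measurable_slopeRate hω) ((i4.add i5).add i6) ?_ (div_pos (by linarith) (by linarith)) ?_
  · borelize Y
    exact measurableSet_near
  intro A hA hAT hAα
  have hω'm : StronglyMeasurable (A.piecewise (fun _ => z) ω) :=
    StronglyMeasurable.piecewise hA stronglyMeasurable_const hω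
  have hn' : ∀ᵐ t ∂P.μ, P.Near t (A.piecewise (fun _ => z) ω t) := by
    filter_upwards [hn] with t ht
    by_cases h : t ∈ A
    · rw [piecewise_eq_of_mem _ _ _ h]; exact hAT h
    · rwa [piecewise_eq_of_notMem _ _ _ h]
  have hd : ∫ t, ‖A.piecewise (fun _ => z) ω t - ω t‖ ∂P.μ = ∫ t in A, ‖z - ω t‖ ∂P.μ := by
    have := integral_piecewise_eq_add (g := fun t w => ‖w - ω t‖) (z := z) (ω := ω) hA
      (by simp) i3
    simpa using this
  have hdle : ∫ t in A, ‖z - ω t‖ ∂P.μ ≤ 2 * P.B * P.μ.real A := by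
    have : ∀ᵐ t ∂(P.μ.restrict A), ‖z - ω t‖ ≤ 2 * P.B := ae_restrict_of_ae (hW.mono fun t ht =>
      (norm_sub_le _ _).trans (by linarith [P.norm_le_B _ ht, P.norm_le_B _ hz]))
    refine (integral_mono_ae i3.integrableOn (integrable_const _) this).trans_eq ?_
    rw [setIntegral_const, smul_eq_mul, mul_comm]
  have hρ' : ∫ t, ‖A.piecewise (fun _ => z) ω t - P.ws t‖ ∂P.μ ≤ ρ := by
    have j1 := integrable_norm_sub hω'm hω (ae_mem_W hn') hW
    have j2 := integrable_norm_sub hω stronglyMeasurable_ws hW (ae_mem_W near_ws)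
    have h1 : ∫ t, ‖A.piecewise (fun _ => z) ω t - P.ws t‖ ∂P.μ ≤
        (∫ t, ‖A.piecewise (fun _ => z) ω t - ω t‖ ∂P.μ) + ∫ t, ‖ω t - P.ws t‖ ∂P.μ := by
      rw [← integral_add j1 j2]
      exact integral_mono (integrable_norm_sub hω'm stronglyMeasurable_ws (ae_mem_W hn')
        (ae_mem_W near_ws)) (j1.add j2) fun t => norm_sub_le_norm_sub_add_norm_sub _ _ _
    rw [le_div_iff₀ (by linarith)] at hAα
    linarith
  have h1 := hmin _ hω'm hn' hρ'
  have h2 := integral_piecewise_eq_add (g := fun t w => P.ctrlPen θ t w) hA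
    (integrable_ctrlPen hθ hω hW) (integrable_ctrlPen hθ hconst hWc)
  have h3 := sqPen_needle_le (c := c) (γ := γ) hN hω hW hz hA
  have h4 := sqrt_le_sqrt_add hQ (sqPen_nonneg (γ := γ) (c := c)
    (ω := A.piecewise (fun _ => z) ω) (P := P) hN)
  have h5 : ∫ t in A, P.slopeRate N γ L θ σ c ω z t ∂P.μ =
      (∫ t in A, P.needleRate N γ c ω z t ∂P.μ) / √(P.sqPen N γ c ω) +
      L * (∫ t in A, (P.ctrlPen θ t z - P.ctrlPen θ t (ω t)) ∂P.μ) +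
      σ * ∫ t in A, ‖z - ω t‖ ∂P.μ := by
    rw [← integral_const_mul, ← integral_const_mul, ← integral_div,
      ← integral_add i4.integrableOn i5.integrableOn,
      ← integral_add i45.integrableOn i6.integrableOn]
    rfl
  have h6 : (P.sqPen N γ c (A.piecewise (fun _ => z) ω) - P.sqPen N γ c ω) /
      (2 * √(P.sqPen N γ c ω)) ≤ (∫ t in A, P.needleRate N γ c ω z t ∂P.μ) / √(P.sqPen N γ c ω) +
      needleConst P N / (2 * √(P.sqPen N γ c ω)) * P.μ.real A ^ 2 := by
    rw [div_le_iff₀ (by positivity), add_mul]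
    field_simp
    linarith
  rw [hd] at h1
  unfold pen at h1
  rw [h2, mul_add] at h1
  rw [h5]
  linarith

theorem ae_slopeRate_nonneg [FiniteDimensional ℝ Y] (hN : 0 ≤ N) (hθ : 0 ≤ θ)
    (hω : StronglyMeasurable ω) (hn : ∀ᵐ t ∂P.μ, P.Near t (ω t)) (hQ : 0 < P.sqPen N γ c ω)
    (hρ : ∫ t, ‖ω t - P.ws t‖ ∂P.μ < ρ)
    (hmin : ∀ ω', StronglyMeasurable ω' → (∀ᵐ t ∂P.μ, P.Near t (ω' t)) →
      ∫ t, ‖ω' t - P.ws t‖ ∂P.μ ≤ ρ →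
      P.pen N γ L θ c ω ≤ P.pen N γ L θ c ω' + σ * ∫ t, ‖ω' t - ω t‖ ∂P.μ) :
    ∀ᵐ t ∂P.μ, ∀ z ∈ P.C, ‖pl2fst z - P.xs t‖ < P.ε → ‖pl2snd z - P.us t‖ < P.r t →
      0 ≤ P.slopeRate N γ L θ σ c ω z t := by
  have : SecondCountableTopology (PL2 X Y) :=
    have : ProperSpace (PL2 X Y) := FiniteDimensional.proper ℝ _
    inferInstance
  obtain ⟨Z, hZC, hZc, hZd⟩ :=
    (TopologicalSpace.IsSeparable.of_separableSpace P.C).exists_countable_dense_subset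
  have h1 : ∀ z ∈ Z, ∀ᵐ t ∂P.μ, P.Near t z → 0 ≤ P.slopeRate N γ L θ σ c ω z t := by
    intro z _
    by_cases hz : z ∈ P.W
    · exact ae_slopeRate_nonneg_of_mem_W hN hθ hω hn hQ hρ hmin hz
    · filter_upwards [near_mem_W (P := P)] with t ht h using absurd (ht z h) hz
  filter_upwards [(ae_ball_iff hZc).2 h1] with t ht z hz h2 h3
  obtain ⟨zs, hzs, hlim⟩ := mem_closure_iff_seq_limit.1 (hZd hz)
  refine ge_of_tendsto (((continuous_slopeRate t).tendsto z).comp hlim) ?_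
  have e1 : ∀ᶠ n in atTop, ‖pl2fst (zs n) - P.xs t‖ < P.ε :=
    (((continuous_pl2fst.tendsto z).comp hlim).sub_const (P.xs t)).norm.eventually_lt_const h2
  have e2 : ∀ᶠ n in atTop, ‖pl2snd (zs n) - P.us t‖ < P.r t :=
    (((continuous_pl2snd.tendsto z).comp hlim).sub_const (P.us t)).norm.eventually_lt_const h3
  filter_upwards [e1, e2] with n h4 h5
  exact ht _ (hzs n) ⟨hZC (hzs n), h4.le, h5.le⟩

end LocalProblem

namespace LocalProblem

variable {X Y : Type} [NormedAddCommGroup X] [InnerProductSpace ℝ X] [NormedAddCommGroup Y]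
  [InnerProductSpace ℝ Y] {P : LocalProblem X Y} {c c' : PL2 X X} {ω ω' : ℝ → PL2 X Y}
  {N γ L θ σ ρ Kf : ℝ}

theorem setIntegral_Ici_t0 {G : Type} [NormedAddCommGroup G] [NormedSpace ℝ G] (g : ℝ → G) :
    ∫ s in Ici P.t0, g s ∂P.μ = ∫ s, g s ∂P.μ := by
  rw [Measure.restrict_restrict measurableSet_Ici, inter_eq_right.2 Icc_subset_Ici_self]

/-- First-order rate of the squared penalty under a variation of the endpoints. -/
def endRate (P : LocalProblem X Y) (N γ : ℝ) (c : PL2 X X) (ω : ℝ → PL2 X Y) (c' : PL2 X X) : ℝ :=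
  ⟪P.rawAdj N c ω P.t0, pl2fst (c' - c)⟫ - ⟪P.endGap c ω, pl2snd (c' - c)⟫ +
    P.costGap γ c ω * (P.f c' - P.f c)

variable [MeasurableSpace X] [BorelSpace X] [FiniteDimensional ℝ X]

theorem sqPen_endpoint_le (hN : 0 ≤ N) (hω : StronglyMeasurable ω) (hW : ∀ᵐ t ∂P.μ, ω t ∈ P.W)
    (hf : |P.f c' - P.f c| ≤ Kf * ‖c' - c‖) :
    P.sqPen N γ c' ω ≤ P.sqPen N γ c ω + 2 * P.endRate N γ c ω c' +
      (2 + Kf ^ 2 + N * P.μ.real univ) * ‖c' - c‖ ^ 2 := by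
  set α := pl2fst (c' - c) with hα
  set β := pl2snd (c' - c) with hβ
  have hαβ : ‖c' - c‖ ^ 2 = ‖α‖ ^ 2 + ‖β‖ ^ 2 := norm_sq_pl2 _
  have h1 : P.endGap c' ω = P.endGap c ω + (α - β) := by
    simp only [endGap, hα, hβ, pl2fst_sub, pl2snd_sub]; abel
  have h2 : P.cost c' ω - P.cost P.c₀ P.ws + γ =
      (P.cost c ω - P.cost P.c₀ P.ws + γ) + (P.f c' - P.f c) := by
    simp only [cost]; ring
  have h3 : ∀ t, P.gap c' ω t = P.gap c ω t + α := fun t => by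
    simp only [gap, traj, hα, pl2fst_sub]; abel
  have i1 := integrable_gap (c := c) hω hW
  have i2 := integrable_gap_sq (c := c) hω hW
  have i3 : Integrable (fun t => 2 * ⟪P.gap c ω t, α⟫) P.μ := (i1.inner_const α).const_mul 2
  have i4 : Integrable (fun t => ‖P.gap c ω t‖ ^ 2 + 2 * ⟪P.gap c ω t, α⟫) P.μ := i2.add i3
  have h4 : ∫ t, ‖P.gap c' ω t‖ ^ 2 ∂P.μ = (∫ t, ‖P.gap c ω t‖ ^ 2 ∂P.μ) +
      2 * ⟪∫ t, P.gap c ω t ∂P.μ, α⟫ + P.μ.real univ * ‖α‖ ^ 2 := by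
    simp only [h3, norm_add_sq_real]
    rw [integral_add i4 (integrable_const _), integral_add i2 i3, integral_const,
      integral_const_mul, smul_eq_mul, real_inner_comm, ← integral_inner i1 α]
    simp only [real_inner_comm]
  have h5 : P.costGap γ c' ω ^ 2 ≤ P.costGap γ c ω ^ 2 +
      2 * (P.costGap γ c ω * (P.f c' - P.f c)) + (P.f c' - P.f c) ^ 2 := by
    simp only [costGap, h2]
    exact max_add_sq_le _ _
  have h6 : (P.f c' - P.f c) ^ 2 ≤ Kf ^ 2 * ‖c' - c‖ ^ 2 := by
    rw [← mul_pow]; exact sq_le_sq' (by linarith [neg_abs_le (P.f c' - P.f c)])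
      ((le_abs_self _).trans hf)
  have h7 : ‖α - β‖ ^ 2 ≤ 2 * ‖c' - c‖ ^ 2 := by
    rw [hαβ, norm_sub_sq_real]
    nlinarith [norm_add_sq_real α β, sq_nonneg ‖α + β‖]
  have h8 : N * P.μ.real univ * ‖α‖ ^ 2 ≤ N * P.μ.real univ * ‖c' - c‖ ^ 2 := by
    rw [hαβ]
    have : 0 ≤ N * P.μ.real univ := mul_nonneg hN measureReal_nonneg
    nlinarith [sq_nonneg ‖β‖]
  have h9 : P.endRate N γ c ω c' = ⟪P.endGap c ω, α - β⟫ + N * ⟪∫ t, P.gap c ω t ∂P.μ, α⟫ +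
      P.costGap γ c ω * (P.f c' - P.f c) := by
    simp only [endRate, rawAdj, setIntegral_Ici_t0, inner_add_left, inner_sub_right,
      real_inner_smul_left]
    ring
  have h10 : ‖P.endGap c' ω‖ ^ 2 =
      ‖P.endGap c ω‖ ^ 2 + 2 * ⟪P.endGap c ω, α - β⟫ + ‖α - β‖ ^ 2 := by
    rw [h1, norm_add_sq_real]
  rw [h9]
  unfold sqPen
  rw [h10, h4]
  nlinarith

theorem endRate_nonneg (hN : 0 ≤ N) (hω : StronglyMeasurable ω) (hW : ∀ᵐ t ∂P.μ, ω t ∈ P.W)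
    (hQ : 0 < P.sqPen N γ c ω) (hf : |P.f c' - P.f c| ≤ Kf * ‖c' - c‖)
    (hmin : P.pen N γ L θ c ω ≤ P.pen N γ L θ c' ω + σ * ‖c' - c‖) :
    0 ≤ P.endRate N γ c ω c' / √(P.sqPen N γ c ω) + σ * ‖c' - c‖ +
      (2 + Kf ^ 2 + N * P.μ.real univ) / (2 * √(P.sqPen N γ c ω)) * ‖c' - c‖ ^ 2 := by
  have h1 := sqPen_endpoint_le (γ := γ) hN hω hW hf
  have h2 := sqrt_le_sqrt_add hQ (sqPen_nonneg (γ := γ) (c := c') (ω := ω) (P := P) hN)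
  have hs : 0 < √(P.sqPen N γ c ω) := Real.sqrt_pos.2 hQ
  have h3 : (P.sqPen N γ c' ω - P.sqPen N γ c ω) / (2 * √(P.sqPen N γ c ω)) ≤
      P.endRate N γ c ω c' / √(P.sqPen N γ c ω) +
      (2 + Kf ^ 2 + N * P.μ.real univ) / (2 * √(P.sqPen N γ c ω)) * ‖c' - c‖ ^ 2 := by
    rw [div_le_iff₀ (by positivity), add_mul]
    field_simp
    linarith
  unfold pen at hmin
  linarith

end LocalProblem

namespace LocalProblem

variable {X Y : Type} [NormedAddCommGroup X] [InnerProductSpace ℝ X] [NormedAddCommGroup Y]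
  [InnerProductSpace ℝ Y] {P : LocalProblem X Y} {q lam θ L σ t κ ρ₁ ρ₂ β : ℝ} {p x : X}
  {w z : PL2 X Y}

/-- Pointwise consequences of the standing assumptions, valid at almost every time. -/
structure Regular (P : LocalProblem X Y) (t : ℝ) : Prop where
  δ_le : P.δ ≤ P.r t
  near_ws : P.Near t (P.ws t)
  mem_W : ∀ z, P.Near t z → z ∈ P.W

theorem ae_regular : ∀ᵐ t ∂P.μ, P.Regular t := by
  filter_upwards [P.δ_le, near_ws (P := P), near_mem_W (P := P)] with t h1 h2 h3
  exact ⟨h1, h2, h3⟩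

/-- Variation of the penalized Hamiltonian from the value `w` to the value `z`. -/
def hamRate (P : LocalProblem X Y) (q lam : ℝ) (p x : X) (w z : PL2 X Y) : ℝ :=
  -⟪p, P.φ z - P.φ w⟫ + lam * (P.F z - P.F w) +
    q / 2 * (‖x - pl2fst z‖ ^ 2 - ‖x - pl2fst w‖ ^ 2)

theorem Regular.exists_mem_fiber [FiniteDimensional ℝ X] [FiniteDimensional ℝ Y]
    (hreg : P.Regular t) (hw : w ∈ P.C) (h₁ : ‖pl2fst w - P.xs t‖ + ρ₁ ≤ P.ε)
    (h₂ : ‖pl2snd w - P.us t‖ + ρ₂ ≤ P.r t) (h₃ : 2 * ‖x - pl2fst w‖ < ρ₁)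
    (h₄ : 2 * P.k * ‖x - pl2fst w‖ < ρ₂) :
    ∃ v, pl2 x v ∈ P.C ∧ ‖v - pl2snd w‖ ≤ 2 * P.k * ‖x - pl2fst w‖ := by
  refine exists_mem_fiber_of_slope_bound P.isClosed_C hw P.k_pos (fun z hz h5 h6 v hv => ?_) h₃ h₄
  refine P.slope z (hreg.mem_W z ⟨hz, ?_, ?_⟩) v hv
  · linarith [norm_sub_le_norm_sub_add_norm_sub (pl2fst z) (pl2fst w) (P.xs t)]
  · linarith [norm_sub_le_norm_sub_add_norm_sub (pl2snd z) (pl2snd w) (P.us t)]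

theorem hamRate_le (hw : w ∈ P.W) (hz : z ∈ P.W) (hlam : 0 ≤ lam) (hx : pl2fst z = x) :
    P.hamRate q lam p x w z ≤ P.K * (‖p‖ + lam) * ‖z - w‖ - q / 2 * ‖x - pl2fst w‖ ^ 2 := by
  have h1 : -⟪p, P.φ z - P.φ w⟫ ≤ ‖p‖ * (P.K * ‖z - w‖) :=
    (neg_le_abs _).trans ((abs_real_inner_le_norm _ _).trans
      (mul_le_mul_of_nonneg_left (P.φ_lip _ hz _ hw) (norm_nonneg _)))
  have h2 : lam * (P.F z - P.F w) ≤ lam * (P.K * ‖z - w‖) :=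
    mul_le_mul_of_nonneg_left ((le_abs_self _).trans (P.F_lip _ hz _ hw)) hlam
  unfold hamRate
  rw [hx, sub_self, norm_zero]
  nlinarith

theorem ctrlPen_eq_zero {v : Y} (h : ‖v - P.us t‖ ≤ θ * P.r t) : P.ctrlPen θ t (pl2 x v) = 0 := by
  simp [ctrlPen, h]

section

variable [FiniteDimensional ℝ X] [FiniteDimensional ℝ Y]

theorem Regular.gap_crude_bound (hreg : P.Regular t) (hw : P.Near t w)
    (hD : ∀ z ∈ P.C, ‖pl2fst z - P.xs t‖ < P.ε → ‖pl2snd z - P.us t‖ < P.r t →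
      0 ≤ P.hamRate q lam p x w z + L * (P.ctrlPen θ t z - P.ctrlPen θ t w) + σ * ‖z - w‖)
    (hσ : 0 ≤ σ) (hlam : 0 ≤ lam) (hθ : 0 ≤ θ)
    (hx : ‖x - P.xs t‖ ≤ κ) (h₁ : 2 * κ < P.ε) (h₂ : 2 * P.k * κ < P.δ)
    (h₃ : 2 * P.k * κ ≤ θ * P.δ) :
    q / 2 * ‖x - pl2fst w‖ ^ 2 + L * P.ctrlPen θ t w ≤
      2 * P.B * (P.K * (‖p‖ + lam) + σ) := by
  have hk := P.k_pos
  have hx' : ‖x - pl2fst (P.ws t)‖ ≤ κ := by simpa [ws] using hx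
  have hkx : 2 * P.k * ‖x - pl2fst (P.ws t)‖ ≤ 2 * P.k * κ := by gcongr
  have hδr := hreg.δ_le
  obtain ⟨v, hv, hvd⟩ := hreg.exists_mem_fiber (x := x) (ρ₁ := P.ε) (ρ₂ := P.δ) hreg.near_ws.1
    (by simp [ws]) (by simpa [ws] using hreg.δ_le) (by linarith) (by linarith)
  have hv' : ‖v - P.us t‖ ≤ 2 * P.k * κ := hvd.trans hkx
  have hκ : 0 ≤ κ := (norm_nonneg _).trans hx
  have h4 := hD _ hv (by simp only [pl2fst_pl2]; linarith) (by simp only [pl2snd_pl2]; linarith)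
  have hzW : pl2 x v ∈ P.W := hreg.mem_W _ ⟨hv, by simp only [pl2fst_pl2]; linarith,
    by simp only [pl2snd_pl2]; linarith⟩
  have hwW := hreg.mem_W _ hw
  have h5 := hamRate_le (q := q) (p := p) hwW hzW hlam rfl
  rw [pl2fst_pl2] at h5
  rw [ctrlPen_eq_zero (hv'.trans (h₃.trans (by gcongr)))] at h4
  have h6 : ‖pl2 x v - w‖ ≤ 2 * P.B :=
    (norm_sub_le _ _).trans (by linarith [P.norm_le_B _ hzW, P.norm_le_B _ hwW])
  have h7 : 0 ≤ P.K * (‖p‖ + lam) + σ := by have := P.K_pos; positivity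
  nlinarith [mul_le_mul_of_nonneg_left h6 h7]

theorem Regular.gap_fine_bound (hreg : P.Regular t) (hw : P.Near t w)
    (hD : ∀ z ∈ P.C, ‖pl2fst z - P.xs t‖ < P.ε → ‖pl2snd z - P.us t‖ < P.r t →
      0 ≤ P.hamRate q lam p x w z + L * (P.ctrlPen θ t z - P.ctrlPen θ t w) + σ * ‖z - w‖)
    (hσ : 0 ≤ σ) (hlam : 0 ≤ lam) (hL : 0 ≤ L)
    (h₁ : ‖pl2fst w - P.xs t‖ + ρ₁ ≤ P.ε)
    (h₂ : ‖pl2snd w - P.us t‖ + ρ₂ ≤ P.r t) (h₃ : 2 * ‖x - pl2fst w‖ < ρ₁)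
    (h₄ : 2 * P.k * ‖x - pl2fst w‖ < ρ₂)
    (hβ : ∀ v, pl2 x v ∈ P.C → ‖v - pl2snd w‖ ≤ 2 * P.k * ‖x - pl2fst w‖ →
      P.ctrlPen θ t (pl2 x v) - P.ctrlPen θ t w ≤ β * ‖x - pl2fst w‖) :
    q * ‖x - pl2fst w‖ ≤ 2 * (1 + 2 * P.k) * (P.K * (‖p‖ + lam) + σ) + 2 * L * |β| := by
  have hk := P.k_pos
  have hK := P.K_pos
  have hn : 0 ≤ ‖x - pl2fst w‖ := norm_nonneg _
  obtain ⟨v, hv, hvd⟩ := hreg.exists_mem_fiber hw.1 h₁ h₂ h₃ h₄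
  have h5 : ‖x - P.xs t‖ < P.ε := by
    linarith [norm_sub_le_norm_sub_add_norm_sub x (pl2fst w) (P.xs t)]
  have h6 : ‖v - P.us t‖ < P.r t := by
    linarith [norm_sub_le_norm_sub_add_norm_sub v (pl2snd w) (P.us t)]
  have h7 := hD _ hv h5 h6
  have h8 := hamRate_le (q := q) (p := p) (hreg.mem_W _ hw)
    (hreg.mem_W (pl2 x v) ⟨hv, h5.le, h6.le⟩) hlam rfl
  rw [pl2fst_pl2] at h8
  have h9 : ‖pl2 x v - w‖ ≤ (1 + 2 * P.k) * ‖x - pl2fst w‖ := by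
    refine (norm_le_pl2 _).trans ?_
    simp only [pl2fst_sub, pl2snd_sub, pl2fst_pl2, pl2snd_pl2]
    linarith
  have h10 : 0 ≤ P.K * (‖p‖ + lam) + σ := by positivity
  have h11 : L * (P.ctrlPen θ t (pl2 x v) - P.ctrlPen θ t w) ≤ L * (|β| * ‖x - pl2fst w‖) :=
    mul_le_mul_of_nonneg_left ((hβ v hv hvd).trans (by gcongr; exact le_abs_self _)) hL
  have h12 : 0 ≤ 2 * (1 + 2 * P.k) * (P.K * (‖p‖ + lam) + σ) + 2 * L * |β| := by positivity
  rcases hn.eq_or_lt with h | h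
  · rw [← h, mul_zero]; exact h12
  · refine le_of_mul_le_mul_right ?_ h
    nlinarith [mul_le_mul_of_nonneg_left h9 h10]

end

end LocalProblem

namespace LocalProblem

variable {X Y : Type} [NormedAddCommGroup X] [InnerProductSpace ℝ X] [NormedAddCommGroup Y]
  [InnerProductSpace ℝ Y] {P : LocalProblem X Y} {c c' : PL2 X X} {ω ω' : ℝ → PL2 X Y}
  {N γ L θ σ t : ℝ} {z : PL2 X Y}

def gapMult (P : LocalProblem X Y) (N γ : ℝ) (c : PL2 X X) (ω : ℝ → PL2 X Y) : ℝ :=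
  N / √(P.sqPen N γ c ω)

def costMult (P : LocalProblem X Y) (N γ : ℝ) (c : PL2 X X) (ω : ℝ → PL2 X Y) : ℝ :=
  P.costGap γ c ω / √(P.sqPen N γ c ω)

/-- Normalized adjoint arc. -/
def adj (P : LocalProblem X Y) (N γ : ℝ) (c : PL2 X X) (ω : ℝ → PL2 X Y) (t : ℝ) : X :=
  -((√(P.sqPen N γ c ω))⁻¹ • P.rawAdj N c ω t)

def endAdj (P : LocalProblem X Y) (N γ : ℝ) (c : PL2 X X) (ω : ℝ → PL2 X Y) : X :=
  -((√(P.sqPen N γ c ω))⁻¹ • P.endGap c ω)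

theorem costMult_nonneg : 0 ≤ P.costMult N γ c ω := div_nonneg costGap_nonneg (Real.sqrt_nonneg _)

theorem adj_eq : P.adj N γ c ω t =
    P.endAdj N γ c ω - ∫ s in Ici t, P.gapMult N γ c ω • P.gap c ω s ∂P.μ := by
  rw [integral_smul, adj, rawAdj, endAdj, smul_add, neg_add, smul_smul, gapMult, div_eq_inv_mul,
    sub_eq_add_neg]

theorem normalization (hQ : 0 < P.sqPen N γ c ω) :
    ‖P.endAdj N γ c ω‖ ^ 2 + P.costMult N γ c ω ^ 2 +
      N⁻¹ * ∫ t, ‖P.gapMult N γ c ω • P.gap c ω t‖ ^ 2 ∂P.μ = 1 := by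
  have hs : √(P.sqPen N γ c ω) ^ 2 = P.sqPen N γ c ω := Real.sq_sqrt hQ.le
  have hs0 : 0 < √(P.sqPen N γ c ω) := Real.sqrt_pos.2 hQ
  simp only [norm_smul, mul_pow, integral_const_mul, endAdj, norm_neg, costMult, gapMult,
    Real.norm_eq_abs, sq_abs, div_pow, inv_pow, hs]
  have : P.sqPen N γ c ω = ‖P.endGap c ω‖ ^ 2 + P.costGap γ c ω ^ 2 +
    N * ∫ t, ‖P.gap c ω t‖ ^ 2 ∂P.μ := rfl
  field_simp
  rw [this]

theorem slopeRate_eq : P.slopeRate N γ L θ σ c ω z t =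
    P.hamRate (P.gapMult N γ c ω) (P.costMult N γ c ω) (P.adj N γ c ω t) (P.traj c ω t) (ω t) z +
      L * (P.ctrlPen θ t z - P.ctrlPen θ t (ω t)) + σ * ‖z - ω t‖ := by
  simp only [slopeRate, needleRate, hamRate, gapMult, costMult, adj, inner_neg_left,
    real_inner_smul_left, gap]
  ring

theorem endRate_div_eq : P.endRate N γ c ω c' / √(P.sqPen N γ c ω) =
    -⟪P.adj N γ c ω P.t0, pl2fst (c' - c)⟫ + ⟪P.endAdj N γ c ω, pl2snd (c' - c)⟫ +
      P.costMult N γ c ω * (P.f c' - P.f c) := by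
  simp only [endRate, costMult, adj, endAdj, inner_neg_left, real_inner_smul_left]
  ring

end LocalProblem

namespace LocalProblem

variable {X Y : Type} [NormedAddCommGroup X] [InnerProductSpace ℝ X] [NormedAddCommGroup Y]
  [InnerProductSpace ℝ Y] {P : LocalProblem X Y} {q lam η L t κ κ₂ Pn : ℝ} {p x : X}
  {w z : PL2 X Y}

/-- Lipschitz constant of the adjoint equation. -/
def adjLip (P : LocalProblem X Y) : ℝ := 2 * (1 + 2 * P.k) * (P.K + 1)

theorem adjLip_pos : 0 < P.adjLip := by
  have := P.k_pos
  have := P.K_pos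
  unfold adjLip; positivity

theorem Regular.gap_bound [FiniteDimensional ℝ X] [FiniteDimensional ℝ Y]
    (hreg : P.Regular t) (hw : P.Near t w)
    (hD : ∀ z ∈ P.C, ‖pl2fst z - P.xs t‖ < P.ε → ‖pl2snd z - P.us t‖ < P.r t →
      0 ≤ P.hamRate q lam p x w z + L * (P.ctrlPen (1 - η) t z - P.ctrlPen (1 - η) t w) +
        η * ‖z - w‖)
    (hη : 0 < η) (hη2 : η ≤ 1 / 2) (hlam : 0 ≤ lam) (hlam1 : lam ≤ 1) (hL : 0 < L) (hq : 0 < q)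
    (hp : ‖p‖ ≤ Pn) (hBL : 2 * P.B * (P.K * (Pn + 1) + η) ≤ L * (η * P.δ / 4))
    (hBq : 2 * (2 * P.B * (P.K * (Pn + 1) + η)) ≤ q * κ₂ ^ 2) (hκ₂ : 0 ≤ κ₂)
    (hx : ‖x - P.xs t‖ ≤ κ) (h₁ : κ ≤ P.ε / 8) (h₂ : 2 * P.k * κ < P.δ / 2)
    (h₃ : κ₂ ≤ P.ε / 8) (h₄ : 2 * P.k * κ₂ ≤ η * P.δ / 4) :
    q * ‖x - pl2fst w‖ ≤ P.adjLip * (‖p‖ + lam + η) + 2 * L * (1 + 2 * P.k) ∧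
    (‖w - P.ws t‖ ≤ P.δ / 4 → q * ‖x - pl2fst w‖ ≤ P.adjLip * (‖p‖ + lam + η)) := by
  have hk := P.k_pos
  have hK := P.K_pos
  have hB := P.B_pos
  have hδ := P.δ_pos
  have hε := P.ε_pos
  have hδr := hreg.δ_le
  have hηr : η * P.δ ≤ η * P.r t := by gcongr
  have hηδ : 0 < η * P.δ := by positivity
  have hηδ2 : η * P.δ ≤ 1 / 2 * P.δ := by gcongr
  have h5 := hreg.gap_crude_bound (p := p) hw hD hη.le hlam (by linarith) hx (by linarith)
    (by linarith) (by linarith)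
  have h6 : 2 * P.B * (P.K * (‖p‖ + lam) + η) ≤ 2 * P.B * (P.K * (Pn + 1) + η) := by gcongr
  have hc := ctrlPen_nonneg (P := P) (1 - η) t w
  have h7 : ‖x - pl2fst w‖ ≤ κ₂ := by
    refine abs_le_of_sq_le_sq' ?_ hκ₂ |>.2
    refine le_of_mul_le_mul_left ?_ hq
    linarith [mul_nonneg hL.le hc]
  have h8 : P.ctrlPen (1 - η) t w ≤ η * P.δ / 4 := by
    refine le_of_mul_le_mul_left ?_ hL
    linarith [mul_nonneg hq.le (sq_nonneg ‖x - pl2fst w‖)]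
  have h9 : ‖pl2snd w - P.us t‖ ≤ (1 - η) * P.r t + η * P.δ / 4 := by
    linarith [le_max_left (‖pl2snd w - P.us t‖ - (1 - η) * P.r t) 0, h8,
      show P.ctrlPen (1 - η) t w = max (‖pl2snd w - P.us t‖ - (1 - η) * P.r t) 0 from rfl]
  have h10 : ‖pl2fst w - P.xs t‖ + P.ε / 2 ≤ P.ε := by
    have := norm_sub_le_norm_sub_add_norm_sub (pl2fst w) x (P.xs t)
    rw [norm_sub_rev (pl2fst w) x] at this
    linarith
  have h11 : ‖pl2snd w - P.us t‖ + η * P.δ / 2 ≤ P.r t := by linarith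
  have h12 : 2 * P.k * ‖x - pl2fst w‖ ≤ 2 * P.k * κ₂ := by gcongr
  have h13 : 2 * (1 + 2 * P.k) * (P.K * (‖p‖ + lam) + η) ≤ P.adjLip * (‖p‖ + lam + η) := by
    unfold adjLip
    rw [mul_assoc _ (P.K + 1)]
    gcongr
    nlinarith [norm_nonneg p]
  constructor
  · have := hreg.gap_fine_bound (β := 1 + 2 * P.k) (p := p) hw hD hη.le hlam hL.le h10 h11
      (by linarith) (by linarith) fun v hv hvd => ?_
    · rw [abs_of_pos (by positivity)] at this
      linarith
    · refine (le_abs_self _).trans ((abs_ctrlPen_sub_le _ _ _ _).trans ((norm_le_pl2 _).trans ?_))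
      simp only [pl2fst_sub, pl2snd_sub, pl2fst_pl2, pl2snd_pl2]
      linarith
  · intro hgood
    have := hreg.gap_fine_bound (β := 0) (p := p) hw hD hη.le hlam hL.le h10 h11
      (by linarith) (by linarith) fun v hv hvd => ?_
    · rw [abs_zero, mul_zero, add_zero] at this
      linarith
    · have h14 : ‖pl2snd w - P.us t‖ ≤ P.δ / 4 := (norm_pl2snd_le (w - P.ws t)).trans hgood
      rw [ctrlPen_eq_zero]
      · linarith
      · have h15 : (1 - η) * P.δ ≤ (1 - η) * P.r t := by
          have : 0 ≤ 1 - η := by linarith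
          gcongr
        linarith [norm_sub_le_norm_sub_add_norm_sub v (pl2snd w) (P.us t)]

end LocalProblem

section

theorem setIntegral_Ici_restrict_Icc {G : Type} [NormedAddCommGroup G] [NormedSpace ℝ G]
    {a b t : ℝ} (ht : t ∈ Icc a b) (g : ℝ → G) :
    ∫ s in Ici t, g s ∂(volume.restrict (Icc a b)) = ∫ s in t..b, g s := by
  rw [Measure.restrict_restrict measurableSet_Ici, intervalIntegral.integral_of_le ht.2,
    ← integral_Icc_eq_integral_Ioc]
  congr 2
  ext s
  simp only [mem_inter_iff, mem_Ici, mem_Icc]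
  exact ⟨fun h => ⟨h.1, h.2.2⟩, fun h => ⟨h.1, ht.1.trans h.1, h.2⟩⟩

variable {X : Type} [NormedAddCommGroup X] [InnerProductSpace ℝ X]
  [MeasurableSpace X] [BorelSpace X] [FiniteDimensional ℝ X]

/-- Uniform bound for solutions of a perturbed linear adjoint inequality. -/
theorem norm_le_of_adjoint_inequality {a b C D lam η : ℝ} (hab : a ≤ b) {p r : ℝ → X} {p₁ : X}
    {A : Set ℝ} (hA : MeasurableSet A) (hr : Measurable r)
    (hri : Integrable r (volume.restrict (Icc a b)))
    (hp : ∀ t, p t = p₁ - ∫ s in Ici t, r s ∂(volume.restrict (Icc a b)))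
    (hC : 0 ≤ C) (hD : 0 ≤ D) (hp₁ : ‖p₁‖ ≤ 1) (hlam : lam ≤ 1) (hη : η ≤ 1)
    (h : ∀ᵐ t ∂(volume.restrict (Icc a b)), ‖r t‖ ≤ C * (‖p t‖ + lam + η) + D)
    (h' : ∀ᵐ t ∂(volume.restrict (Icc a b)), t ∉ A → ‖r t‖ ≤ C * (‖p t‖ + lam + η))
    (hDA : D * (volume.restrict (Icc a b)).real A ≤ 1) {t : ℝ} (ht : t ∈ Icc a b) :
    ‖p t‖ ≤ 2 * (2 + 2 * C * (b - a)) * Real.exp (2 * (C + 1) * (b - a)) := by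
  set ν := volume.restrict (Icc a b) with hν
  have hT : ν.real univ = b - a := by simp [hν, Measure.real, hab]
  have hpm : Measurable p := by
    rw [funext hp]
    exact (measurable_setIntegral_Ici hr).const_sub _
  have hpb : ∀ t, ‖p t‖ ≤ 1 + ∫ s, ‖r s‖ ∂ν := fun t => by
    rw [hp]
    refine (norm_sub_le _ _).trans (add_le_add hp₁ ((norm_integral_le_integral_norm _).trans ?_))
    exact setIntegral_le_integral hri.norm (ae_of_all _ fun _ => norm_nonneg _)
  have hpi : Integrable (fun t => ‖p t‖) ν :=
    hpm.norm.integrable_of_norm_le (ae_of_all _ fun t => by rw [norm_norm]; exact hpb t)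
  refine le_of_integral_le_backward (u := fun t => ‖p t‖) hab
    (by have := sub_nonneg.2 hab; positivity) hC (fun t _ => hpb t) ?_ (fun t ht => ?_) ht
  · rw [intervalIntegrable_iff_integrableOn_Icc_of_le hab]
    exact hpi
  have i1 : Integrable (A.indicator fun _ => D) ν := (integrable_const D).indicator hA
  have i2 : Integrable (fun s => C * ‖p s‖ + 2 * C) ν := (hpi.const_mul C).add (integrable_const _)
  have i3 : Integrable (fun s => (C * ‖p s‖ + 2 * C) + A.indicator (fun _ => D) s) ν := i2.add i1
  have h1 : ∀ᵐ s ∂ν, ‖r s‖ ≤ (C * ‖p s‖ + 2 * C) + A.indicator (fun _ => D) s := by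
    filter_upwards [h, h'] with s h2 h3
    have h4 : C * (‖p s‖ + lam + η) ≤ C * ‖p s‖ + 2 * C := by nlinarith
    by_cases hs : s ∈ A
    · rw [indicator_of_mem hs]; linarith
    · rw [indicator_of_notMem hs]; linarith [h3 hs]
  have h5 : ∫ s in Ici t, ‖r s‖ ∂ν ≤ C * (∫ s in t..b, ‖p s‖) + 2 * C * (b - a) + 1 := by
    calc ∫ s in Ici t, ‖r s‖ ∂ν
        ≤ ∫ s in Ici t, ((C * ‖p s‖ + 2 * C) + A.indicator (fun _ => D) s) ∂ν :=
          integral_mono_ae hri.norm.integrableOn i3.integrableOn (ae_restrict_of_ae h1)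
      _ = C * (∫ s in t..b, ‖p s‖) + (∫ s in Ici t, 2 * C ∂ν) +
          ∫ s in Ici t, A.indicator (fun _ => D) s ∂ν := by
        rw [integral_add i2.integrableOn i1.integrableOn,
          integral_add (hpi.const_mul C).integrableOn (integrable_const _), integral_const_mul,
          setIntegral_Ici_restrict_Icc ht]
      _ ≤ C * (∫ s in t..b, ‖p s‖) + 2 * C * (b - a) + 1 := by
        gcongr
        · have h6 : 2 * C * (b - a) = ∫ _, 2 * C ∂ν := by
            rw [integral_const, hT, smul_eq_mul, mul_comm]
          rw [h6]
          exact setIntegral_le_integral (integrable_const _)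
            (ae_of_all _ fun _ => by simp only [Pi.zero_apply]; positivity)
        · refine le_trans ?_ hDA
          refine (setIntegral_le_integral i1 (ae_of_all _ fun s =>
            indicator_nonneg (fun _ _ => hD) s)).trans_eq ?_
          rw [integral_indicator hA, setIntegral_const, smul_eq_mul, mul_comm]
  simp only [hp t]
  refine (norm_sub_le _ _).trans ?_
  linarith [norm_integral_le_integral_norm (μ := ν.restrict (Ici t)) r]

end

theorem eventually_lt_of_continuous_zero {g : ℝ → ℝ} (hg : Continuous g) (h0 : g 0 = 0) {a : ℝ}
    (ha : 0 < a) : ∀ᶠ γ in 𝓝[>] (0 : ℝ), g γ < a :=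
  nhdsWithin_le_nhds ((hg.tendsto 0).eventually_lt_const (by rwa [h0]))

theorem integral_norm_le_of_sq {X : Type} [NormedAddCommGroup X] {ν : Measure ℝ}
    [IsFiniteMeasure ν] {v : ℝ → X} {B : ℝ}
    (h1 : Integrable (fun t => ‖v t‖) ν) (h2 : Integrable (fun t => ‖v t‖ ^ 2) ν)
    (hB : ∫ t, ‖v t‖ ^ 2 ∂ν ≤ B) : ∫ t, ‖v t‖ ∂ν ≤ (ν.real univ + B) / 2 := by
  have i : Integrable (fun t => (1 + ‖v t‖ ^ 2) / 2) ν := ((integrable_const 1).add h2).div_const 2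
  refine (integral_mono h1 i fun t => ?_).trans ?_
  · simp only
    linarith [sq_nonneg (‖v t‖ - 1)]
  · rw [integral_div, integral_add (integrable_const _) h2]
    simp only [integral_const, smul_eq_mul, mul_one]
    linarith

namespace LocalProblem

variable {X Y : Type} [NormedAddCommGroup X] [InnerProductSpace ℝ X] [NormedAddCommGroup Y]
  [InnerProductSpace ℝ Y]

/-- An approximate extremal of the local problem with accuracy `η`. -/
structure ApproxExtremal [MeasurableSpace X] (P : LocalProblem X Y) (M η : ℝ) where
  c : PL2 X X
  ω : ℝ → PL2 X Y
  x : ℝ → X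
  p : ℝ → X
  p₁ : X
  v : ℝ → X
  lam : ℝ
  q : ℝ
  A : Set ℝ
  c_mem : c ∈ P.S
  norm_c_sub : ‖c - P.c₀‖ ≤ η
  norm_x_sub : ∀ t ∈ Icc P.t0 P.t1, ‖x t - P.xs t‖ ≤ η
  measurable_v : Measurable v
  integrable_v : Integrable v P.μ
  p_eq : ∀ t, p t = p₁ - ∫ s in Ici t, v s ∂P.μ
  norm_le : ‖p₁‖ ^ 2 + lam ^ 2 ≤ 1
  le_norm : 1 - η ≤ ‖p₁‖ ^ 2 + lam ^ 2
  lam_nonneg : 0 ≤ lam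
  q_nonneg : 0 ≤ q
  measurableSet_A : MeasurableSet A
  measure_A : P.μ.real A ≤ η
  integral_A : ∫ t in A, ‖v t‖ ∂P.μ ≤ η
  norm_p_le : ∀ t ∈ Icc P.t0 P.t1, ‖p t‖ ≤ M
  good : ∀ᵐ t ∂P.μ, t ∉ A → ω t ∈ P.C ∧ ‖ω t - P.ws t‖ ≤ η ∧
    ‖v t‖ ≤ P.adjLip * (‖p t‖ + lam + η)
  v_eq : ∀ᵐ t ∂P.μ, v t = q • (x t - pl2fst (ω t))
  ham : ∀ᵐ t ∂P.μ, ∀ z ∈ P.C, ‖pl2fst z - P.xs t‖ < P.ε → ‖pl2snd z - P.us t‖ ≤ (1 - η) * P.r t →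
    0 ≤ P.hamRate q lam (p t) (x t) (ω t) z + η * ‖z - ω t‖
  endpoint : ∃ τ > 0, ∃ a ≥ 0, ∀ c' ∈ P.S, ‖c' - c‖ ≤ τ →
    0 ≤ -⟪p P.t0, pl2fst (c' - c)⟫ + ⟪p₁, pl2snd (c' - c)⟫ + lam * (P.f c' - P.f c) +
      η * ‖c' - c‖ + a * ‖c' - c‖ ^ 2

variable {P : LocalProblem X Y}

theorem measureReal_univ : P.μ.real univ = P.t1 - P.t0 := by
  simp [Measure.real, P.t0_lt.le]

end LocalProblem

namespace LocalProblem

variable {X Y : Type} [NormedAddCommGroup X] [InnerProductSpace ℝ X] [NormedAddCommGroup Y]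
  [InnerProductSpace ℝ Y] {P : LocalProblem X Y} {η N L γ κ₂ : ℝ}

/-- Uniform bound for the adjoint arcs. -/
def adjBound (P : LocalProblem X Y) : ℝ :=
  2 * (2 + 2 * P.adjLip * (P.t1 - P.t0)) * Real.exp (2 * (P.adjLip + 1) * (P.t1 - P.t0))

/-- Crude bound for the adjoint arcs. -/
def crudeBound (P : LocalProblem X Y) (N : ℝ) : ℝ := 1 + (P.t1 - P.t0 + N) / 2

def gapConst (P : LocalProblem X Y) (η N : ℝ) : ℝ :=
  2 * P.B * (P.K * (P.crudeBound N + 1) + η)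

set_option maxHeartbeats 4000000 in
theorem exists_approxExtremal_of_params [MeasurableSpace X] [BorelSpace X] [FiniteDimensional ℝ X]
    [FiniteDimensional ℝ Y] (hη : 0 < η) (hη2 : η ≤ 1 / 2)
    (hN : 0 < N) (hγ : 0 < γ) (hL : 0 < L) (hκ₂ : 0 ≤ κ₂)
    (hNM : 2 * (P.adjLip * (P.adjBound + 2)) ^ 2 * (P.t1 - P.t0) + 1 ≤ η * N)
    (hBL : P.gapConst η N ≤ L * (η * P.δ / 4))
    (hBκ : 2 * P.gapConst η N * γ ≤ N * κ₂ ^ 2)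
    (hκ₂ε : κ₂ ≤ P.ε / 8) (hκ₂k : 2 * P.k * κ₂ ≤ η * P.δ / 4)
    (hγρ : γ / η < P.ρ / 2)
    (hκη : (1 + P.K) * (γ / η) ≤ η) (hκε : (1 + P.K) * (γ / η) ≤ P.ε / 8)
    (hκk : 2 * P.k * ((1 + P.K) * (γ / η)) < P.δ / 2)
    (hb1 : γ / η / min η (P.δ / 4) ≤ η)
    (hb2 : 2 * L * (1 + 2 * P.k) * (γ / η / min η (P.δ / 4)) ≤ 1)
    (hb3 : (P.adjLip * (P.adjBound + 2) + 2 * L * (1 + 2 * P.k)) *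
      (γ / η / min η (P.δ / 4)) ≤ η)
    (hb4 : 2 * (2 * L * (1 + 2 * P.k)) ^ 2 * (γ / η / min η (P.δ / 4)) ≤ 1) :
    Nonempty (ApproxExtremal P P.adjBound η) := by
  have hk := P.k_pos
  have hK := P.K_pos
  have hδ := P.δ_pos
  have hC := P.adjLip_pos
  have hab := P.t0_lt
  set m := min η (P.δ / 4) with hm
  have hm0 : 0 < m := lt_min hη (by linarith)
  set b := γ / η / m with hb
  set D := 2 * L * (1 + 2 * P.k) with hD
  have hD0 : 0 ≤ D := by positivity
  set C := P.adjLip with hCdef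
  set M := P.adjBound with hM
  obtain ⟨c, ω, hcS, hω, hn, hpen, hc, hd, hmin⟩ :=
    P.exists_ekeland_process (N := N) (γ := γ) (L := L) (θ := 1 - η) (σ := η) hγ hL.le
      (by linarith) hη P.ρ_pos
  have hW := ae_mem_W hn
  rw [mul_comm, ← le_div_iff₀ hη] at hc hd
  have hQ : 0 < P.sqPen N γ c ω := sqPen_pos hN hγ hcS hω hn (by linarith [P.ρ_pos])
  set s := √(P.sqPen N γ c ω) with hs
  have hs0 : 0 < s := Real.sqrt_pos.2 hQ
  have hsγ : s ≤ γ := by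
    have := mul_nonneg hL.le (ctrlPen_integral_nonneg (P := P) (θ := 1 - η) (ω := ω))
    unfold pen at hpen
    linarith
  set q := P.gapMult N γ c ω with hq
  set lam := P.costMult N γ c ω with hlam
  set p := P.adj N γ c ω with hp
  set p₁ := P.endAdj N γ c ω with hp₁
  set x := P.traj c ω with hx
  set v : ℝ → X := fun t => q • P.gap c ω t with hv
  have hq0 : 0 < q := div_pos hN hs0
  have hlam0 : 0 ≤ lam := costMult_nonneg
  have hnorm : ‖p₁‖ ^ 2 + lam ^ 2 + N⁻¹ * ∫ t, ‖v t‖ ^ 2 ∂P.μ = 1 := normalization hQ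
  have hvm : Measurable v := (measurable_gap hω).const_smul q
  have hvi : Integrable v P.μ := (integrable_gap hω hW).smul q
  have hv2i : Integrable (fun t => ‖v t‖ ^ 2) P.μ := by
    simp only [hv, norm_smul, mul_pow]
    exact (integrable_gap_sq hω hW).const_mul _
  have hv2n : 0 ≤ ∫ t, ‖v t‖ ^ 2 ∂P.μ := integral_nonneg fun t => sq_nonneg _
  have hv2N : ∫ t, ‖v t‖ ^ 2 ∂P.μ ≤ N := by
    have h1 : N⁻¹ * ∫ t, ‖v t‖ ^ 2 ∂P.μ ≤ 1 := by linarith [sq_nonneg ‖p₁‖, sq_nonneg lam]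
    rwa [inv_mul_le_iff₀ hN, mul_one] at h1
  have hle : ‖p₁‖ ^ 2 + lam ^ 2 ≤ 1 := by
    have := mul_nonneg (inv_nonneg.2 hN.le) hv2n
    linarith
  have hp₁1 : ‖p₁‖ ≤ 1 := (sq_le_one_iff₀ (norm_nonneg _)).1 (by linarith [sq_nonneg lam])
  have hlam1 : lam ≤ 1 := (sq_le_one_iff₀ hlam0).1 (by linarith [sq_nonneg ‖p₁‖])
  have hpeq : ∀ t, p t = p₁ - ∫ s in Ici t, v s ∂P.μ := fun t => adj_eq
  have hpcrude : ∀ t, ‖p t‖ ≤ P.crudeBound N := fun t => by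
    rw [hpeq]
    refine (norm_sub_le _ _).trans (add_le_add hp₁1 ((norm_integral_le_integral_norm _).trans ?_))
    refine (setIntegral_le_integral hvi.norm (ae_of_all _ fun _ => norm_nonneg _)).trans ?_
    rw [← measureReal_univ]
    exact integral_norm_le_of_sq hvi.norm hv2i hv2N
  have hxx : ∀ t ∈ Icc P.t0 P.t1, ‖x t - P.xs t‖ ≤ (1 + P.K) * (γ / η) := fun t ht => by
    rw [← traj_ws ht]
    refine (norm_traj_sub_le hω stronglyMeasurable_ws hW (ae_mem_W near_ws) t).trans ?_
    rw [add_mul, one_mul]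
    gcongr
  have hslope := ae_slopeRate_nonneg (c := c) (σ := η) (ρ := P.ρ) (L := L) hN.le
    (show (0 : ℝ) ≤ 1 - η by linarith) hω hn hQ (by linarith [P.ρ_pos]) fun ω' h1 h2 h3 => by
      simpa using hmin c ω' hcS h1 h2 (by linarith [P.ρ_pos]) h3
  simp only [slopeRate_eq] at hslope
  have hIcc : ∀ᵐ t ∂P.μ, t ∈ Icc P.t0 P.t1 := ae_restrict_mem measurableSet_Icc
  have hvx : ∀ t, ‖v t‖ = q * ‖x t - pl2fst (ω t)‖ := fun t => by
    rw [hv, norm_smul, Real.norm_of_nonneg hq0.le]; rfl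
  have hbound : ∀ᵐ t ∂P.μ, ‖v t‖ ≤ C * (‖p t‖ + lam + η) + D ∧
      (‖ω t - P.ws t‖ ≤ P.δ / 4 → ‖v t‖ ≤ C * (‖p t‖ + lam + η)) := by
    filter_upwards [hslope, ae_regular (P := P), hn, hIcc] with t h1 h2 h3 h4
    rw [hvx]
    refine h2.gap_bound h3 h1 hη hη2 hlam0 hlam1 hL hq0 (hpcrude t) hBL ?_ hκ₂ (hxx t h4) hκε hκk
      hκ₂ε hκ₂k
    change 2 * P.gapConst η N ≤ N / s * κ₂ ^ 2
    have hg : 0 ≤ 2 * P.gapConst η N := by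
      have := P.B_pos
      have : 0 ≤ P.crudeBound N := (norm_nonneg _).trans (hpcrude t)
      unfold gapConst; positivity
    rw [div_mul_eq_mul_div, le_div_iff₀ hs0]
    exact (mul_le_mul_of_nonneg_left hsγ hg).trans hBκ
  set A := {t | m < ‖ω t - P.ws t‖} with hA
  have hAm : MeasurableSet A :=
    measurableSet_lt measurable_const (hω.sub stronglyMeasurable_ws).norm.measurable
  have hAb : P.μ.real A ≤ b := by
    have h1 := mul_meas_ge_le_integral_of_nonneg (ae_of_all P.μ fun t => norm_nonneg _)
      (integrable_norm_sub hω stronglyMeasurable_ws hW (ae_mem_W near_ws)) m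
    have h2 : P.μ.real A ≤ P.μ.real {t | m ≤ ‖ω t - P.ws t‖} :=
      measureReal_mono fun t (ht : m < _) => ht.le
    rw [hb, le_div_iff₀ hm0, mul_comm]
    exact (mul_le_mul_of_nonneg_left h2 hm0.le).trans (h1.trans hd)
  have hA0 : 0 ≤ P.μ.real A := measureReal_nonneg
  have hgood : ∀ t, t ∉ A → ‖ω t - P.ws t‖ ≤ m := fun t ht => not_lt.1 ht
  have hpM : ∀ t ∈ Icc P.t0 P.t1, ‖p t‖ ≤ M := fun t ht =>
    norm_le_of_adjoint_inequality hab.le hAm hvm hvi hpeq hC.le hD0 hp₁1 hlam1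
      (by linarith : η ≤ 1) (hbound.mono fun t h => h.1)
      (hbound.mono fun t h ht => h.2 ((hgood t ht).trans (min_le_right _ _)))
      ((mul_le_mul_of_nonneg_left hAb hD0).trans hb2) ht
  have hM0 : 0 ≤ M := (norm_nonneg _).trans (hpM P.t0 ⟨le_rfl, hab.le⟩)
  set Mr := C * (M + 2) with hMr
  have hMr0 : 0 ≤ Mr := by positivity
  have hCM : ∀ t ∈ Icc P.t0 P.t1, C * (‖p t‖ + lam + η) ≤ Mr := fun t ht =>
    mul_le_mul_of_nonneg_left (by linarith [hpM t ht]) hC.le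
  have hv2 : ∫ t, ‖v t‖ ^ 2 ∂P.μ ≤ 2 * Mr ^ 2 * (P.t1 - P.t0) + 1 := by
    have i1 : Integrable (A.indicator fun _ => 2 * D ^ 2) P.μ := (integrable_const _).indicator hAm
    have i2 : Integrable (fun t => 2 * Mr ^ 2 + A.indicator (fun _ => 2 * D ^ 2) t) P.μ :=
      (integrable_const _).add i1
    refine (integral_mono_ae hv2i i2 ?_).trans ?_
    · filter_upwards [hbound, hIcc] with t h1 h2
      by_cases ht : t ∈ A
      · rw [indicator_of_mem ht]
        have h3 : ‖v t‖ ≤ Mr + D := h1.1.trans (by linarith [hCM t h2])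
        linarith [pow_le_pow_left₀ (norm_nonneg _) h3 2, sq_nonneg (Mr - D)]
      · rw [indicator_of_notMem ht, add_zero]
        have h3 : ‖v t‖ ≤ Mr := (h1.2 ((hgood t ht).trans (min_le_right _ _))).trans (hCM t h2)
        linarith [pow_le_pow_left₀ (norm_nonneg _) h3 2, sq_nonneg Mr]
    · rw [integral_add (integrable_const _) i1, integral_const, integral_indicator hAm,
        setIntegral_const, measureReal_univ, smul_eq_mul, smul_eq_mul]
      have : 2 * D ^ 2 * P.μ.real A ≤ 2 * D ^ 2 * b := by gcongr
      linarith
  obtain ⟨Kf, hKf, rf, hrf, hf⟩ := P.lipschitz_f.exists_ball c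
  refine ⟨⟨c, ω, x, p, p₁, v, lam, q, A, hcS, ?_, fun t ht => (hxx t ht).trans hκη, hvm, hvi, hpeq,
    hle, ?_, hlam0, hq0.le, hAm, hAb.trans hb1, ?_, hpM, ?_, ae_of_all _ fun t => rfl, ?_, ?_⟩⟩
  · refine hc.trans (le_trans ?_ hκη)
    linarith [mul_pos hK (div_pos hγ hη)]
  · have : N⁻¹ * ∫ t, ‖v t‖ ^ 2 ∂P.μ ≤ η := by
      rw [inv_mul_le_iff₀ hN]; linarith
    linarith
  · have h1 : ∀ᵐ t ∂(P.μ.restrict A), ‖v t‖ ≤ Mr + D := ae_restrict_of_ae (by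
      filter_upwards [hbound, hIcc] with t h1 h2
      exact h1.1.trans (by linarith [hCM t h2]))
    refine (integral_mono_ae hvi.norm.integrableOn (integrable_const _) h1).trans ?_
    rw [setIntegral_const, smul_eq_mul, mul_comm]
    exact (mul_le_mul_of_nonneg_left hAb (by positivity)).trans hb3
  · filter_upwards [hbound, hn] with t h1 h2 ht
    exact ⟨h2.1, (hgood t ht).trans (min_le_left _ _),
      h1.2 ((hgood t ht).trans (min_le_right _ _))⟩
  · filter_upwards [hslope, P.δ_le] with t h1 h2 z hz h3 h4
    have h5 := h1 z hz h3 (h4.trans_lt (by linarith [mul_pos hη (hδ.trans_le h2)]))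
    have h6 : P.ctrlPen (1 - η) t z = 0 := ctrlPen_eq_zero (x := pl2fst z) h4
    rw [h6] at h5
    linarith [mul_nonneg hL.le (ctrlPen_nonneg (P := P) (1 - η) t (ω t))]
  · refine ⟨min rf (P.ρ / 2), lt_min hrf (by linarith [P.ρ_pos]),
      (2 + Kf ^ 2 + N * P.μ.real univ) / (2 * s), ?_, fun c' hc' hcc => ?_⟩
    · have : 0 ≤ P.μ.real univ := measureReal_nonneg
      positivity
    · have h1 := endRate_nonneg (γ := γ) (L := L) (θ := 1 - η) (σ := η) (c' := c') (Kf := Kf) hN.le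
        hω hW hQ (hf c' c (hcc.trans (min_le_left _ _)) (by simpa using hrf.le)) (by
          have := hmin c' ω hc' hω hn (by
            linarith [norm_sub_le_norm_sub_add_norm_sub c' c P.c₀, min_le_right rf (P.ρ / 2)])
            (by linarith [P.ρ_pos])
          simpa using this)
      rwa [endRate_div_eq] at h1

end LocalProblem

namespace LocalProblem

variable {X Y : Type} [NormedAddCommGroup X] [InnerProductSpace ℝ X] [NormedAddCommGroup Y]
  [InnerProductSpace ℝ Y] {P : LocalProblem X Y} {η : ℝ}

theorem exists_approxExtremal [MeasurableSpace X] [BorelSpace X] [FiniteDimensional ℝ X]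
    [FiniteDimensional ℝ Y] (hη : 0 < η) (hη2 : η ≤ 1 / 2) :
    Nonempty (ApproxExtremal P P.adjBound η) := by
  have hk := P.k_pos
  have hK := P.K_pos
  have hδ := P.δ_pos
  have hC := P.adjLip_pos
  have hB := P.B_pos
  have hε := P.ε_pos
  have hT := sub_pos.2 P.t0_lt
  have hρ := P.ρ_pos
  obtain ⟨N, hNdef⟩ : ∃ N, N = (2 * (P.adjLip * (P.adjBound + 2)) ^ 2 * (P.t1 - P.t0) + 1) / η :=
    ⟨_, rfl⟩
  have hN : 0 < N := by rw [hNdef]; positivity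
  have hNM : 2 * (P.adjLip * (P.adjBound + 2)) ^ 2 * (P.t1 - P.t0) + 1 ≤ η * N := by
    rw [hNdef, mul_div_cancel₀ _ hη.ne']
  have hG : 0 < P.gapConst η N := by
    unfold gapConst crudeBound
    positivity
  obtain ⟨L, hLdef⟩ : ∃ L, L = P.gapConst η N / (η * P.δ / 4) := ⟨_, rfl⟩
  have hL : 0 < L := by rw [hLdef]; positivity
  have hBL : P.gapConst η N ≤ L * (η * P.δ / 4) := by
    rw [hLdef, div_mul_cancel₀ _ (by positivity)]
  have hm : 0 < min η (P.δ / 4) := lt_min hη (by positivity)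
  have key : ∀ᶠ γ in 𝓝[>] (0 : ℝ), 0 < γ ∧ √(2 * P.gapConst η N * γ / N) < P.ε / 8 ∧
      2 * P.k * √(2 * P.gapConst η N * γ / N) < η * P.δ / 4 ∧ γ / η < P.ρ / 2 ∧
      (1 + P.K) * (γ / η) < η ∧ (1 + P.K) * (γ / η) < P.ε / 8 ∧
      2 * P.k * ((1 + P.K) * (γ / η)) < P.δ / 2 ∧
      γ / η / min η (P.δ / 4) < η ∧
      2 * L * (1 + 2 * P.k) * (γ / η / min η (P.δ / 4)) < 1 ∧
      (P.adjLip * (P.adjBound + 2) + 2 * L * (1 + 2 * P.k)) *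
        (γ / η / min η (P.δ / 4)) < η ∧
      2 * (2 * L * (1 + 2 * P.k)) ^ 2 * (γ / η / min η (P.δ / 4)) < 1 := by
    refine eventually_mem_nhdsWithin.and ?_
    refine .and (eventually_lt_of_continuous_zero (by fun_prop) (by simp) (by positivity)) ?_
    refine .and (eventually_lt_of_continuous_zero (by fun_prop) (by simp) (by positivity)) ?_
    refine .and (eventually_lt_of_continuous_zero (by fun_prop) (by simp) (by positivity)) ?_
    refine .and (eventually_lt_of_continuous_zero (by fun_prop) (by simp) (by positivity)) ?_
    refine .and (eventually_lt_of_continuous_zero (by fun_prop) (by simp) (by positivity)) ?_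
    refine .and (eventually_lt_of_continuous_zero (by fun_prop) (by simp) (by positivity)) ?_
    refine .and (eventually_lt_of_continuous_zero (by fun_prop) (by simp) (by positivity)) ?_
    refine .and (eventually_lt_of_continuous_zero (by fun_prop) (by simp) (by positivity)) ?_
    refine .and (eventually_lt_of_continuous_zero (by fun_prop) (by simp) (by positivity)) ?_
    exact eventually_lt_of_continuous_zero (by fun_prop) (by simp) (by positivity)
  obtain ⟨γ, hγ, g1, g2, g3, g4, g5, g6, g7, g8, g9, g10⟩ := key.exists
  refine exists_approxExtremal_of_params hη hη2 hN hγ hL (Real.sqrt_nonneg _) hNM hBL ?_ g1.le g2.le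
    g3 g4.le g5.le g6 g7.le g8.le g9.le g10.le
  rw [Real.sq_sqrt (by positivity), mul_div_cancel₀ _ hN.ne']

end LocalProblem

theorem ae_nonneg_of_intervalIntegral_nonneg {D : ℝ → ℝ} {a b : ℝ} (hab : a ≤ b)
    (hD : IntervalIntegrable D volume a b)
    (h : ∀ s ∈ Icc a b, ∀ t ∈ Icc a b, s ≤ t → 0 ≤ ∫ τ in s..t, D τ) :
    ∀ᵐ t ∂volume.restrict (Icc a b), 0 ≤ D t := by
  have h₂ : ∀ᵐ x ∂(volume : Measure ℝ), x ≠ b := by simp [ae_iff, measure_singleton]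
  rw [ae_restrict_iff' measurableSet_Icc]
  filter_upwards [hD.ae_hasDerivAt_integral, h₂] with t ht h₂ htI
  rw [uIcc_of_le hab] at ht
  have hd := (ht htI t htI).tendsto_slope
  have hd' : Tendsto (slope (fun x => ∫ τ in t..x, D τ) t) (𝓝[>] t) (𝓝 (D t)) :=
    hd.mono_left (nhdsWithin_mono _ fun x (hx : t < x) => hx.ne')
  refine ge_of_tendsto hd' ?_
  have htb : t < b := lt_of_le_of_ne htI.2 h₂
  filter_upwards [Ioc_mem_nhdsGT htb] with x hx
  rw [slope_def_field]
  refine div_nonneg ?_ (sub_nonneg.2 hx.1.le)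
  simpa using h t htI x ⟨htI.1.trans hx.1.le, hx.2⟩ hx.1.le

section

variable {X : Type} [NormedAddCommGroup X] [InnerProductSpace ℝ X] [FiniteDimensional ℝ X]

theorem exists_integral_eq_of_lipschitzOnWith {Q : ℝ → X} {K : ℝ≥0} {a b : ℝ} (hab : a ≤ b)
    (hQ : LipschitzOnWith K Q (Icc a b)) :
    ∃ w : ℝ → X, IntervalIntegrable w volume a b ∧ ∀ t ∈ Icc a b, ∫ s in a..t, w s = Q t - Q a := by
  have e := stdOrthonormalBasis ℝ X
  have hL : ∀ i, LipschitzOnWith (‖e i‖₊ * K) (fun t => ⟪e i, Q t⟫) (uIcc a b) := fun i => by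
    rw [uIcc_of_le hab]
    have h1 : LipschitzWith ‖e i‖₊ fun y : X => ⟪e i, y⟫ := by
      refine LipschitzWith.of_dist_le_mul fun y z => ?_
      rw [dist_eq_norm, dist_eq_norm, ← inner_sub_right]
      exact norm_inner_le_norm _ _
    exact h1.comp_lipschitzOnWith hQ
  have hAC := fun i => (hL i).absolutelyContinuousOnInterval
  have hi : ∀ i, IntervalIntegrable (deriv fun t => ⟪e i, Q t⟫) volume a b := fun i =>
    (hAC i).intervalIntegrable_deriv
  have hi' : ∀ i, IntervalIntegrable (fun s => deriv (fun t => ⟪e i, Q t⟫) s • e i) volume a b :=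
    fun i => ⟨(hi i).1.smul_const _, (hi i).2.smul_const _⟩
  refine ⟨fun s => ∑ i, deriv (fun t => ⟪e i, Q t⟫) s • e i, ?_, fun t ht => ?_⟩
  · exact ⟨integrable_finsetSum _ fun i _ => (hi' i).1, integrable_finsetSum _ fun i _ => (hi' i).2⟩
  · have hsub : uIcc a t ⊆ uIcc a b := uIcc_subset_uIcc_left (by rwa [uIcc_of_le hab])
    rw [intervalIntegral.integral_finsetSum fun i _ => (hi' i).mono_set hsub]
    simp_rw [intervalIntegral.integral_smul_const, ((hAC _).mono hsub).integral_deriv_eq_sub,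
      ← inner_sub_right]
    exact e.sum_repr' _

theorem ae_mem_convexHull_of_tendsto_integral [MeasurableSpace X] [BorelSpace X] {v : ℕ → ℝ → X}
    {w : ℝ → X} {K a b : ℝ} (hab : a ≤ b) (hv : ∀ n, Measurable (v n)) (hK : ∀ n t, ‖v n t‖ ≤ K)
    (hw : IntervalIntegrable w volume a b)
    (h : ∀ t ∈ Icc a b, Tendsto (fun n => ∫ s in a..t, v n s) atTop (𝓝 (∫ s in a..t, w s))) :
    ∀ᵐ t ∂volume.restrict (Icc a b),
      w t ∈ convexHull ℝ {y | MapClusterPt y atTop fun n => v n t} := by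
  have : CompleteSpace X := FiniteDimensional.complete ℝ X
  have : ProperSpace X := FiniteDimensional.proper ℝ X
  have hK0 : 0 ≤ K := (norm_nonneg _).trans (hK 0 0)
  have hvi : ∀ n s t, IntervalIntegrable (v n) volume s t := fun n s t => by
    refine (intervalIntegrable_const (c := K)).mono_fun (hv n).aestronglyMeasurable
      (ae_of_all _ fun t => ?_)
    rw [Real.norm_of_nonneg hK0]
    exact hK n t
  have hbdd : ∀ (ξ : X) N t, BddAbove (range fun n => ⟪ξ, v (N + n) t⟫) := fun ξ N t =>
    ⟨‖ξ‖ * K, by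
      rintro _ ⟨n, rfl⟩
      exact (real_inner_le_norm _ _).trans (mul_le_mul_of_nonneg_left (hK _ _) (norm_nonneg _))⟩
  have hle : ∀ (ξ : X) (N : ℕ), ∀ᵐ t ∂volume.restrict (Icc a b),
      ⟪ξ, w t⟫ ≤ ⨆ n, ⟪ξ, v (N + n) t⟫ := fun ξ N => by
    have hm : Measurable fun t => ⨆ n, ⟪ξ, v (N + n) t⟫ :=
      Measurable.iSup fun n => (hv _).const_inner
    have hsn : ∀ t, ‖⨆ n, ⟪ξ, v (N + n) t⟫‖ ≤ ‖ξ‖ * K := fun t => by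
      rw [Real.norm_eq_abs, abs_le]
      have h1 : ∀ n, |⟪ξ, v (N + n) t⟫| ≤ ‖ξ‖ * K := fun n => (abs_real_inner_le_norm _ _).trans
        (mul_le_mul_of_nonneg_left (hK _ _) (norm_nonneg _))
      exact ⟨(abs_le.1 (h1 0)).1.trans (le_ciSup (hbdd ξ N t) 0),
        ciSup_le fun n => (abs_le.1 (h1 n)).2⟩
    have hsi : ∀ s t, IntervalIntegrable (fun t => ⨆ n, ⟪ξ, v (N + n) t⟫) volume s t :=
      fun s t => by
        refine (intervalIntegrable_const (c := ‖ξ‖ * K)).mono_fun hm.aestronglyMeasurable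
          (ae_of_all _ fun t => ?_)
        rw [Real.norm_of_nonneg (by positivity : 0 ≤ ‖ξ‖ * K)]
        exact hsn t
    have hwξ : IntervalIntegrable (fun t => ⟪ξ, w t⟫) volume a b :=
      ⟨hw.1.const_inner ξ, hw.2.const_inner ξ⟩
    have key := ae_nonneg_of_intervalIntegral_nonneg hab ((hsi a b).sub hwξ) ?_
    · exact key.mono fun t ht => sub_nonneg.1 ht
    intro s hs t ht hst
    have hsub : ∀ c ∈ Icc a b, uIcc a c ⊆ uIcc a b := fun c hc =>
      uIcc_subset_uIcc_left (by rwa [uIcc_of_le hab])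
    have hws := hw.mono_set (hsub s hs)
    have hwt := hw.mono_set (hsub t ht)
    have hwst : IntervalIntegrable w volume s t := hws.symm.trans hwt
    have hwst' : IntervalIntegrable (fun t => ⟪ξ, w t⟫) volume s t :=
      ⟨hwst.1.const_inner ξ, hwst.2.const_inner ξ⟩
    rw [intervalIntegral.integral_sub (hsi s t) hwst', sub_nonneg]
    have hinner : ∀ g : ℝ → X, IntervalIntegrable g volume s t →
        ∫ τ in s..t, ⟪ξ, g τ⟫ = ⟪ξ, ∫ τ in s..t, g τ⟫ := fun g hg =>
      (innerSL ℝ ξ).intervalIntegral_comp_comm hg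
    rw [hinner w hwst]
    have hlim : Tendsto (fun n => ⟪ξ, ∫ τ in s..t, v n τ⟫) atTop (𝓝 ⟪ξ, ∫ τ in s..t, w τ⟫) := by
      refine tendsto_const_nhds.inner ?_
      rw [← intervalIntegral.integral_interval_sub_left hwt hws]
      simp_rw [fun n => (intervalIntegral.integral_interval_sub_left (hvi n a t) (hvi n a s)).symm]
      exact (h t ht).sub (h s hs)
    refine le_of_tendsto hlim ?_
    filter_upwards [eventually_ge_atTop N] with n hn
    rw [← hinner _ (hvi n s t)]
    refine intervalIntegral.integral_mono_on hst
      ⟨(hvi n s t).1.const_inner ξ, (hvi n s t).2.const_inner ξ⟩ (hsi s t) fun τ _ => ?_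
    obtain ⟨m, rfl⟩ := Nat.exists_eq_add_of_le hn
    exact le_ciSup (hbdd ξ N τ) m
  have hcount : ∀ᵐ t ∂volume.restrict (Icc a b), ∀ k N : ℕ,
      ⟪TopologicalSpace.denseSeq X k, w t⟫ ≤ ⨆ n, ⟪TopologicalSpace.denseSeq X k, v (N + n) t⟫ :=
    ae_all_iff.2 fun k => ae_all_iff.2 fun N => hle _ N
  filter_upwards [hcount] with t ht
  refine mem_convexHull_of_inner_le ?_ fun ξ => ?_
  · refine (isCompact_closedBall (0 : X) K).of_isClosed_subset isClosed_setOfPred_clusterPt ?_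
    intro y (hy : MapClusterPt y atTop _)
    exact Metric.isClosed_closedBall.mem_of_mapClusterPt hy
      (Eventually.of_forall fun n => by simpa using hK n t)
  · have hex : ∀ N : ℕ, ∃ n ≥ N, ⟪ξ, w t⟫ ≤ ⟪ξ, v n t⟫ + 1 / ((N : ℝ) + 1) := fun N => by
      have hpos : 0 < 1 / ((N : ℝ) + 1) := Nat.one_div_pos_of_nat
      have hw0 : 0 < ‖w t‖ + K + 1 := by positivity
      obtain ⟨k, hk⟩ := (TopologicalSpace.denseRange_denseSeq X).exists_dist_lt ξ
        (show 0 < 1 / ((N : ℝ) + 1) / 2 / (‖w t‖ + K + 1) by positivity)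
      set ξ' := TopologicalSpace.denseSeq X k
      rw [dist_eq_norm, lt_div_iff₀ hw0] at hk
      obtain ⟨m, hm⟩ := exists_lt_of_lt_ciSup ((sub_lt_self _ (half_pos hpos)).trans_le (ht k N))
      refine ⟨N + m, Nat.le_add_right _ _, ?_⟩
      have h1 : ⟪ξ - ξ', w t - v (N + m) t⟫ ≤ 1 / ((N : ℝ) + 1) / 2 := by
        refine (real_inner_le_norm _ _).trans (le_trans ?_ hk.le)
        gcongr
        exact (norm_sub_le _ _).trans (by linarith [hK (N + m) t])
      rw [inner_sub_left, inner_sub_right, inner_sub_right] at h1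
      linarith
    choose n hnN hn using hex
    obtain ⟨y, -, φ, hφ, hy⟩ := (isCompact_closedBall (0 : X) K).tendsto_subseq
      (x := fun N => v (n N) t) fun N => by simpa using hK _ t
    have hnt : Tendsto n atTop atTop := tendsto_atTop_mono hnN tendsto_id
    refine ⟨y, ?_, ?_⟩
    · exact hy.mapClusterPt.of_comp (u := fun n => v n t) (hnt.comp hφ.tendsto_atTop)
    · have h2 : Tendsto (fun N => ⟪ξ, v (n (φ N)) t⟫ + 1 / ((φ N : ℝ) + 1)) atTop
          (𝓝 (⟪ξ, y⟫ + 0)) :=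
        (tendsto_const_nhds.inner hy).add
          (tendsto_one_div_add_atTop_nhds_zero_nat.comp hφ.tendsto_atTop)
      rw [add_zero] at h2
      exact ge_of_tendsto' h2 fun N => hn _

end

section

variable {X : Type} [NormedAddCommGroup X] [InnerProductSpace ℝ X] [FiniteDimensional ℝ X]

/-- A uniformly bounded sequence of uniformly Lipschitz curves has a subsequence that converges
pointwise to a Lipschitz curve. -/
theorem exists_subseq_tendsto_of_lipschitz {Q : ℕ → ℝ → X} {K : ℝ≥0} {R : ℝ → ℝ}
    (hQ : ∀ n, LipschitzWith K (Q n)) (hR : ∀ n t, ‖Q n t‖ ≤ R t) :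
    ∃ φ : ℕ → ℕ, StrictMono φ ∧ ∃ q : ℝ → X, LipschitzWith K q ∧
      ∀ t, Tendsto (fun n => Q (φ n) t) atTop (𝓝 (q t)) := by
  have : ProperSpace X := FiniteDimensional.proper ℝ _
  have : CompleteSpace X := FiniteDimensional.complete ℝ X
  obtain ⟨z, -, φ, hφ, hz⟩ :=
    (isCompact_univ_pi fun r : ℚ => isCompact_closedBall (0 : X) (R r)).tendsto_subseq
      (x := fun n (r : ℚ) => Q n r) fun n r _ => by simpa using hR n r
  have hc : ∀ t, CauchySeq fun n => Q (φ n) t := fun t => by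
    rw [Metric.cauchySeq_iff']
    intro ε hε
    obtain ⟨r, hr⟩ := (Rat.denseRange_cast (𝕜 := ℝ)).exists_dist_lt t
      (show 0 < ε / (3 * (K + 1)) by positivity)
    have hKr : K * dist t r ≤ ε / 3 := by
      rw [lt_div_iff₀ (by positivity)] at hr
      have := dist_nonneg (x := t) (y := (r : ℝ))
      linarith
    obtain ⟨N, hN⟩ := Metric.cauchySeq_iff'.1 (((continuous_apply r).tendsto z).comp hz).cauchySeq
      (ε / 3) (by positivity)
    refine ⟨N, fun n hn => ?_⟩
    have h1 := (hQ (φ n)).dist_le_mul t r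
    have h2 := (hQ (φ N)).dist_le_mul r t
    rw [dist_comm (r : ℝ) t] at h2
    have h3 : dist (Q (φ n) r) (Q (φ N) r) < ε / 3 := hN n hn
    linarith [dist_triangle4 (Q (φ n) t) (Q (φ n) r) (Q (φ N) r) (Q (φ N) t)]
  choose q hq using fun t => cauchySeq_tendsto_of_complete (hc t)
  refine ⟨φ, hφ, q, LipschitzWith.of_dist_le_mul fun s t => ?_, hq⟩
  exact le_of_tendsto' ((hq s).dist (hq t)) fun n => (hQ _).dist_le_mul s t

/-- Bounded sequences of measurable curves have weakly convergent subsequences, whose limit lies in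
the convex hull of the pointwise cluster points. -/
theorem exists_weak_limit [MeasurableSpace X] [BorelSpace X] {v : ℕ → ℝ → X} {K a b : ℝ}
    (hab : a ≤ b) (hv : ∀ n, Measurable (v n)) (hK : ∀ n t, ‖v n t‖ ≤ K) :
    ∃ φ : ℕ → ℕ, StrictMono φ ∧ ∃ w : ℝ → X, IntervalIntegrable w volume a b ∧
      (∀ t ∈ Icc a b,
        Tendsto (fun n => ∫ s in a..t, v (φ n) s) atTop (𝓝 (∫ s in a..t, w s))) ∧
      ∀ᵐ t ∂volume.restrict (Icc a b),
        w t ∈ convexHull ℝ {y | MapClusterPt y atTop fun n => v (φ n) t} := by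
  have : CompleteSpace X := FiniteDimensional.complete ℝ X
  have hK0 : 0 ≤ K := (norm_nonneg _).trans (hK 0 0)
  have hvi : ∀ n s t, IntervalIntegrable (v n) volume s t := fun n s t => by
    refine (intervalIntegrable_const (c := K)).mono_fun (hv n).aestronglyMeasurable
      (ae_of_all _ fun t => ?_)
    rw [Real.norm_of_nonneg hK0]
    exact hK n t
  have hlip : ∀ n, LipschitzWith K.toNNReal fun t => ∫ s in a..t, v n s := fun n =>
    LipschitzWith.of_dist_le_mul fun s t => by
      rw [dist_eq_norm, intervalIntegral.integral_interval_sub_left (hvi n _ _) (hvi n _ _),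
        Real.coe_toNNReal _ hK0, Real.dist_eq]
      exact intervalIntegral.norm_integral_le_of_norm_le_const fun τ _ => hK n τ
  obtain ⟨φ, hφ, q, hq, hlim⟩ := exists_subseq_tendsto_of_lipschitz hlip
    (R := fun t => K * |t - a|) fun n t =>
      intervalIntegral.norm_integral_le_of_norm_le_const fun τ _ => hK n τ
  obtain ⟨w, hw, hwq⟩ := exists_integral_eq_of_lipschitzOnWith hab
    (hq.lipschitzOnWith (s := Icc a b))
  have hqa : q a = 0 := tendsto_nhds_unique (hlim a) (by simp)
  have hlim' : ∀ t ∈ Icc a b,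
      Tendsto (fun n => ∫ s in a..t, v (φ n) s) atTop (𝓝 (∫ s in a..t, w s)) := fun t ht => by
    rw [hwq t ht, hqa, sub_zero]
    exact hlim t
  exact ⟨φ, hφ, w, hw, hlim', ae_mem_convexHull_of_tendsto_integral hab (fun n => hv _)
    (fun n => hK _) hw hlim'⟩

end

theorem MapClusterPt.congr_eventuallyEq {X : Type} [TopologicalSpace X] {f g : ℕ → X} {y : X}
    (h : f =ᶠ[atTop] g) (hf : MapClusterPt y atTop f) : MapClusterPt y atTop g := by
  rwa [MapClusterPt, ← Filter.map_congr h]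

namespace LocalProblem

variable {X Y : Type} [NormedAddCommGroup X] [InnerProductSpace ℝ X] [NormedAddCommGroup Y]
  [InnerProductSpace ℝ Y] [MeasurableSpace X] {P : LocalProblem X Y} {M η : ℝ}

namespace ApproxExtremal

theorem lam_le_one (e : ApproxExtremal P M η) : e.lam ≤ 1 :=
  (sq_le_one_iff₀ e.lam_nonneg).1 (by linarith [e.norm_le, sq_nonneg ‖e.p₁‖])

theorem norm_p₁_le_one (e : ApproxExtremal P M η) : ‖e.p₁‖ ≤ 1 :=
  (sq_le_one_iff₀ (norm_nonneg _)).1 (by linarith [e.norm_le, sq_nonneg e.lam])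

/-- The set where the adjoint velocity is not controlled by `K`. -/
def badSet (e : ApproxExtremal P M η) (K : ℝ) : Set ℝ := e.A ∪ {t | K < ‖e.v t‖}

theorem measurableSet_badSet [BorelSpace X] (e : ApproxExtremal P M η) (K : ℝ) :
    MeasurableSet (e.badSet K) :=
  e.measurableSet_A.union (measurableSet_lt measurable_const e.measurable_v.norm)

theorem badSet_ae_eq (e : ApproxExtremal P M η) (hη : η ≤ 1) :
    e.badSet (P.adjLip * (M + 2)) =ᵐ[P.μ] e.A := by
  have hIcc : ∀ᵐ t ∂P.μ, t ∈ Icc P.t0 P.t1 := ae_restrict_mem measurableSet_Icc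
  filter_upwards [e.good, hIcc] with t h1 h2
  refine propext ⟨fun h => ?_, fun h => Or.inl h⟩
  by_contra hA
  rcases h with h | h
  · exact hA h
  · have h3 := (h1 hA).2.2
    have h4 := mul_le_mul_of_nonneg_left (show ‖e.p t‖ + e.lam + η ≤ M + 2 by
      linarith [e.norm_p_le t h2, e.lam_le_one]) P.adjLip_pos.le
    have h5 : P.adjLip * (M + 2) < ‖e.v t‖ := h
    linarith

/-- The truncated adjoint velocity. -/
def truncV (e : ApproxExtremal P M η) (K : ℝ) : ℝ → X := (e.badSet K)ᶜ.indicator e.v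

theorem measurable_truncV [BorelSpace X] (e : ApproxExtremal P M η) (K : ℝ) :
    Measurable (e.truncV K) :=
  e.measurable_v.indicator (e.measurableSet_badSet K).compl

theorem norm_truncV_le (e : ApproxExtremal P M η) {K : ℝ} (hK : 0 ≤ K) (t : ℝ) :
    ‖e.truncV K t‖ ≤ K := by
  by_cases h : t ∈ e.badSet K
  · rw [truncV, indicator_of_notMem (by simpa using h), norm_zero]
    exact hK
  · rw [truncV, indicator_of_mem (by simpa using h)]
    exact not_lt.1 fun hlt => h (Or.inr hlt)

theorem norm_p_sub_le [BorelSpace X] (e : ApproxExtremal P M η)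
    (hη : η ≤ 1) {t : ℝ} (ht : t ∈ Icc P.t0 P.t1) :
    ‖e.p t - (e.p₁ - ∫ s in t..P.t1, e.truncV (P.adjLip * (M + 2)) s)‖ ≤ η := by
  have hM : 0 ≤ M := (norm_nonneg _).trans (e.norm_p_le t ht)
  have hC := P.adjLip_pos
  set K := P.adjLip * (M + 2) with hK
  have hK0 : 0 ≤ K := by positivity
  have hti : Integrable (e.truncV K) P.μ :=
    (e.integrable_v.indicator (e.measurableSet_badSet K).compl)
  rw [← setIntegral_Ici_restrict_Icc ht, e.p_eq, sub_sub_sub_cancel_left, norm_sub_rev,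
    ← integral_sub e.integrable_v.integrableOn hti.integrableOn]
  have hd : ∀ s, e.v s - e.truncV K s = (e.badSet K).indicator e.v s := fun s => by
    by_cases h : s ∈ e.badSet K
    · simp [truncV, h]
    · simp [truncV, h]
  simp_rw [hd]
  refine (norm_integral_le_integral_norm _).trans ((setIntegral_le_integral
    (e.integrable_v.indicator (e.measurableSet_badSet K)).norm
    (ae_of_all _ fun _ => norm_nonneg _)).trans ?_)
  simp_rw [norm_indicator_eq_indicator_norm]
  rw [integral_indicator (e.measurableSet_badSet K), setIntegral_congr_set (e.badSet_ae_eq hη)]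
  exact e.integral_A

end ApproxExtremal

/-- The limit of a sequence of approximate extremals. -/
structure LimitData (P : LocalProblem X Y) (M : ℝ) where
  η : ℕ → ℝ
  η_pos : ∀ n, 0 < η n
  tendsto_η : Tendsto η atTop (𝓝 0)
  e : ∀ n, ApproxExtremal P M (η n)
  p : ℝ → X
  w : ℝ → X
  lam : ℝ
  intervalIntegrable_w : IntervalIntegrable w volume P.t0 P.t1
  p_eq : ∀ t ∈ Icc P.t0 P.t1, p t = p P.t0 + ∫ s in P.t0..t, w s
  lam_nonneg : 0 ≤ lam
  normalized : ‖p P.t1‖ ^ 2 + lam ^ 2 = 1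
  tendsto_lam : Tendsto (fun n => (e n).lam) atTop (𝓝 lam)
  tendsto_p₁ : Tendsto (fun n => (e n).p₁) atTop (𝓝 (p P.t1))
  tendsto_p : ∀ t ∈ Icc P.t0 P.t1, Tendsto (fun n => (e n).p t) atTop (𝓝 (p t))
  eventually_notMem : ∀ᵐ t ∂P.μ, ∀ᶠ n in atTop, t ∉ (e n).A
  w_mem : ∀ᵐ t ∂P.μ, w t ∈ convexHull ℝ {y | MapClusterPt y atTop fun n => (e n).v t}

theorem exists_limitData [BorelSpace X] [FiniteDimensional ℝ X]
    (h : ∀ η : ℝ, 0 < η → η ≤ 1 / 2 → Nonempty (ApproxExtremal P M η)) :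
    Nonempty (LimitData P M) := by
  have : ProperSpace X := FiniteDimensional.proper ℝ _
  have : CompleteSpace X := FiniteDimensional.complete ℝ X
  have hab := P.t0_lt.le
  have hC := P.adjLip_pos
  have hη1 : ∀ n : ℕ, (1 / 2 : ℝ) ^ (n + 1) ≤ 1 / 2 := fun n =>
    pow_le_of_le_one (by norm_num) (by norm_num) n.succ_ne_zero
  have e := fun n : ℕ => (h ((1 / 2) ^ (n + 1)) (by positivity) (hη1 n)).some
  have hM : 0 ≤ M := (norm_nonneg _).trans ((e 0).norm_p_le P.t0 ⟨le_rfl, hab⟩)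
  obtain ⟨K, hK⟩ : ∃ K, K = P.adjLip * (M + 2) := ⟨_, rfl⟩
  have hK0 : 0 ≤ K := by rw [hK]; positivity
  obtain ⟨⟨p₁, lam⟩, -, φ₁, hφ₁, hlim₁⟩ :=
    (isCompact_closedBall (0 : X × ℝ) 1).tendsto_subseq (x := fun n => ((e n).p₁, (e n).lam))
      fun n => by
        rw [mem_closedBall_zero_iff]
        exact norm_prod_le_iff.2 ⟨(e n).norm_p₁_le_one, by
          rw [Real.norm_of_nonneg (e n).lam_nonneg]; exact (e n).lam_le_one⟩
  obtain ⟨φ₂, hφ₂, w, hw, hlim₂, hconv⟩ := exists_weak_limit hab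
    (v := fun n => (e (φ₁ n)).truncV K) (fun n => (e _).measurable_truncV K)
    (fun n => (e _).norm_truncV_le hK0)
  have hφ : Tendsto (fun n => φ₁ (φ₂ n)) atTop atTop :=
    hφ₁.tendsto_atTop.comp hφ₂.tendsto_atTop
  have hη : Tendsto (fun n => (1 / 2 : ℝ) ^ (φ₁ (φ₂ n) + 1)) atTop (𝓝 0) :=
    ((tendsto_pow_atTop_nhds_zero_of_lt_one (by norm_num) (by norm_num)).comp
      (tendsto_add_atTop_nat 1)).comp hφ
  have hp₁ : Tendsto (fun n => (e (φ₁ (φ₂ n))).p₁) atTop (𝓝 p₁) :=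
    ((continuous_fst.tendsto _).comp hlim₁).comp hφ₂.tendsto_atTop
  have hlam : Tendsto (fun n => (e (φ₁ (φ₂ n))).lam) atTop (𝓝 lam) :=
    ((continuous_snd.tendsto _).comp hlim₁).comp hφ₂.tendsto_atTop
  have hsub : ∀ t ∈ Icc P.t0 P.t1, IntervalIntegrable w volume P.t0 t := fun t ht =>
    hw.mono_set (uIcc_subset_uIcc_left (by rwa [uIcc_of_le hab]))
  have hti : ∀ n s t, IntervalIntegrable ((e n).truncV K) volume s t := fun n s t => by
    refine (intervalIntegrable_const (c := K)).mono_fun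
      ((e n).measurable_truncV K).aestronglyMeasurable (ae_of_all _ fun t => ?_)
    rw [Real.norm_of_nonneg hK0]
    exact (e n).norm_truncV_le hK0 t
  have hnotMem : ∀ᵐ t ∂P.μ, ∀ᶠ n in atTop, t ∉ (e n).badSet K := by
    refine ae_eventually_notMem (ne_top_of_le_ne_top (Summable.tsum_ofReal_ne_top
      ((summable_nat_add_iff 1).2 (summable_geometric_of_lt_one (r := (1 / 2 : ℝ)) (by norm_num)
        (by norm_num)))) (ENNReal.tsum_le_tsum fun n => ?_))
    rw [hK, measure_congr ((e n).badSet_ae_eq ((hη1 n).trans (by norm_num))),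
      ← ofReal_measureReal]
    exact ENNReal.ofReal_le_ofReal (e n).measure_A
  have hnotMem' : ∀ᵐ t ∂P.μ, ∀ᶠ n in atTop, t ∉ (e (φ₁ (φ₂ n))).badSet K :=
    hnotMem.mono fun t ht => hφ.eventually ht
  refine ⟨⟨_, fun n => by positivity, hη, fun n => e (φ₁ (φ₂ n)),
    fun t => p₁ - ∫ s in t..P.t1, w s, w, lam, hw, fun t ht => ?_,
    ge_of_tendsto' hlam fun n => (e _).lam_nonneg, ?_, hlam, by simpa using hp₁, fun t ht => ?_, ?_,
    ?_⟩⟩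
  · rw [← intervalIntegral.integral_interval_sub_left hw (hsub t ht)]
    abel
  · have h1 : Tendsto (fun n => ‖(e (φ₁ (φ₂ n))).p₁‖ ^ 2 + (e (φ₁ (φ₂ n))).lam ^ 2) atTop
        (𝓝 (‖p₁‖ ^ 2 + lam ^ 2)) := (hp₁.norm.pow 2).add (hlam.pow 2)
    simp only [intervalIntegral.integral_same, sub_zero]
    refine le_antisymm (le_of_tendsto' h1 fun n => (e _).norm_le) ?_
    have h2 := le_of_tendsto_of_tendsto' (tendsto_const_nhds.sub hη) h1 fun n => (e _).le_norm
    simpa using h2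
  · have h1 : Tendsto (fun n => (e (φ₁ (φ₂ n))).p₁ -
        ∫ s in t..P.t1, (e (φ₁ (φ₂ n))).truncV K s) atTop (𝓝 (p₁ - ∫ s in t..P.t1, w s)) := by
      refine hp₁.sub ?_
      rw [← intervalIntegral.integral_interval_sub_left hw (hsub t ht)]
      simp_rw [fun n => (intervalIntegral.integral_interval_sub_left (hti n P.t0 P.t1)
        (hti n P.t0 t)).symm]
      exact (hlim₂ _ ⟨hab, le_rfl⟩).sub (hlim₂ t ht)
    have h2 : Tendsto (fun n => (e (φ₁ (φ₂ n))).p t - ((e (φ₁ (φ₂ n))).p₁ -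
        ∫ s in t..P.t1, (e (φ₁ (φ₂ n))).truncV K s)) atTop (𝓝 0) := by
      refine squeeze_zero_norm (fun n => ?_) hη
      rw [hK]
      exact (e _).norm_p_sub_le ((hη1 _).trans (by norm_num)) ht
    simpa using h2.add h1
  · exact hnotMem'.mono fun t ht => ht.mono fun n hn hA => hn (Or.inl hA)
  · filter_upwards [hconv, hnotMem'] with t h1 h2
    refine convexHull_mono (fun y hy => ?_) h1
    refine MapClusterPt.congr_eventuallyEq ?_ hy
    filter_upwards [h2] with n hn
    exact indicator_of_mem (show t ∈ ((e _).badSet K)ᶜ from hn) _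

end LocalProblem

theorem half_mul_norm_sq_sub_norm_sq {X Y : Type} [NormedAddCommGroup X] [InnerProductSpace ℝ X]
    [NormedAddCommGroup Y] [InnerProductSpace ℝ Y] (q : ℝ) (x : X) (z w : PL2 X Y) :
    q / 2 * (‖x - pl2fst z‖ ^ 2 - ‖x - pl2fst w‖ ^ 2) =
      -⟪q • (x - pl2fst w), pl2fst (z - w)⟫ + q / 2 * ‖pl2fst (z - w)‖ ^ 2 := by
  have h1 : x - pl2fst z = (x - pl2fst w) - pl2fst (z - w) := by simp
  rw [h1, norm_sub_sq_real, real_inner_smul_left]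
  ring

namespace LocalProblem

variable {X Y : Type} [NormedAddCommGroup X] [InnerProductSpace ℝ X] [NormedAddCommGroup Y]
  [InnerProductSpace ℝ Y] {P : LocalProblem X Y} {M : ℝ}

section

variable [FiniteDimensional ℝ X]

/-- The Euler inclusion obtained from almost minimizers of penalized Hamiltonians. -/
theorem exists_euler_limit [FiniteDimensional ℝ Y] (hφ : LocallyLipschitz P.φ)
    (hF : LocallyLipschitz P.F) {t : ℝ} (hr : P.δ ≤ P.r t) {η q lams : ℕ → ℝ}
    {ps x v : ℕ → X} {ω : ℕ → PL2 X Y} {p y : X} {lam : ℝ}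
    (hη0 : ∀ n, 0 < η n) (hη : Tendsto η atTop (𝓝 0)) (hq : ∀ n, 0 ≤ q n)
    (hlam : Tendsto lams atTop (𝓝 lam)) (hp : Tendsto ps atTop (𝓝 p))
    (hv : Tendsto v atTop (𝓝 y)) (hvq : ∀ n, v n = q n • (x n - pl2fst (ω n)))
    (hωC : ∀ n, ω n ∈ P.C) (hω : ∀ n, ‖ω n - P.ws t‖ ≤ η n)
    (hham : ∀ n, ∀ z ∈ P.C, ‖pl2fst z - P.xs t‖ < P.ε →
      ‖pl2snd z - P.us t‖ ≤ (1 - η n) * P.r t →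
      0 ≤ P.hamRate (q n) (lams n) (ps n) (x n) (ω n) z + η n * ‖z - ω n‖) :
    ∃ ζ ∈ limSubdiff (fun z => ⟪-p, P.φ z⟫ + lam * P.F z) (P.ws t),
      ∃ w ∈ limitingNC P.C (P.ws t), pl2 y 0 = ζ + w := by
  obtain ⟨Kφ, hKφ, r₁, hr₁, hlφ⟩ := hφ.exists_ball (P.ws t)
  obtain ⟨KF, hKF, r₂, hr₂, hlF⟩ := hF.exists_ball (P.ws t)
  have hgap : ∀ (p : X) (l : ℝ) (z w : PL2 X Y), ‖z - P.ws t‖ ≤ min r₁ r₂ →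
      ‖w - P.ws t‖ ≤ min r₁ r₂ →
      |⟪p, P.φ z - P.φ w⟫ + l * (P.F z - P.F w)| ≤ (Kφ * ‖p‖ + KF * |l|) * ‖z - w‖ := by
    intro p l z w hz hw
    have h1 := hlφ z w (hz.trans (min_le_left _ _)) (hw.trans (min_le_left _ _))
    have h2 := hlF z w (hz.trans (min_le_right _ _)) (hw.trans (min_le_right _ _))
    calc _ ≤ |⟪p, P.φ z - P.φ w⟫| + |l * (P.F z - P.F w)| := abs_add_le _ _
      _ ≤ ‖p‖ * (Kφ * ‖z - w‖) + |l| * (KF * ‖z - w‖) := by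
        rw [abs_mul]
        exact add_le_add ((abs_real_inner_le_norm _ _).trans (by gcongr)) (by gcongr; exact h2)
      _ = _ := by ring
  refine exists_limiting_sum (zs := ω) (vs := fun n => pl2 (v n) 0)
    (s := fun n => η n + (Kφ * ‖ps n - p‖ + KF * |lam - lams n|))
    (K := Kφ * ‖-p‖ + KF * |lam|) (r := min r₁ r₂) P.isClosed_C
    (lt_min hr₁ hr₂) (by positivity) (fun z w hz hw => ?_) hωC ?_ (hv.pl2 tendsto_const_nhds)
    ?_ (fun n => by have := hη0 n; positivity) ?_
  · have := hgap (-p) lam z w hz hw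
    rw [inner_sub_right] at this
    convert this using 2
    ring
  · exact tendsto_iff_norm_sub_tendsto_zero.2
      (squeeze_zero (fun _ => norm_nonneg _) hω hη)
  · have h1 := (tendsto_iff_norm_sub_tendsto_zero.1 hp).const_mul Kφ
    have h2 := ((tendsto_const_nhds (x := lam)).sub hlam).abs.const_mul KF
    simpa using hη.add (h1.add h2)
  · have hε := P.ε_pos
    have hδ := P.δ_pos
    filter_upwards [hη.eventually_lt_const (show (0 : ℝ) < 1 / 2 by norm_num),
      hη.eventually_lt_const (show (0 : ℝ) < P.δ / 4 by positivity),
      hη.eventually_lt_const (show (0 : ℝ) < P.ε / 2 by positivity),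
      hη.eventually_lt_const (show (0 : ℝ) < min r₁ r₂ / 2 by positivity)] with n h1 h2 h3 h4
    have hn := hη0 n
    refine ⟨η n, hn, q n / 2, by have := hq n; positivity, fun z hz hzω => ?_⟩
    have hz2 : ‖z - P.ws t‖ ≤ 2 * η n := by
      linarith [norm_sub_le_norm_sub_add_norm_sub z (ω n) (P.ws t), hω n]
    have hzf : ‖pl2fst z - P.xs t‖ ≤ 2 * η n := by
      simpa [ws] using (norm_pl2fst_le (z - P.ws t)).trans hz2
    have hzs : ‖pl2snd z - P.us t‖ ≤ 2 * η n := by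
      simpa [ws] using (norm_pl2snd_le (z - P.ws t)).trans hz2
    have h5 := hham n z hz (by linarith) (by
      have : (1 - η n) * P.δ ≤ (1 - η n) * P.r t := by gcongr; linarith
      nlinarith)
    rw [hamRate, half_mul_norm_sq_sub_norm_sq, ← hvq] at h5
    have h6 := (abs_le.1 (hgap (ps n - p) (lam - lams n) z (ω n) (by linarith)
      (by linarith [hω n]))).1
    have h7 : ‖pl2fst (z - ω n)‖ ^ 2 ≤ ‖z - ω n‖ ^ 2 := by
      gcongr
      exact norm_pl2fst_le _
    have h8 : q n / 2 * ‖pl2fst (z - ω n)‖ ^ 2 ≤ q n / 2 * ‖z - ω n‖ ^ 2 := by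
      have := hq n
      gcongr
    have h9 : ⟪pl2 (v n) (0 : Y), z - ω n⟫ = ⟪v n, pl2fst (z - ω n)⟫ := by
      rw [inner_pl2, pl2fst_pl2, pl2snd_pl2, inner_zero_left, add_zero]
    rw [h9]
    rw [inner_sub_left, inner_sub_right, inner_sub_right] at h6
    rw [inner_sub_right] at h5
    rw [inner_neg_left, inner_neg_left]
    linarith

/-- Transversality obtained from almost minimizers of the end point problem. -/
theorem exists_transversality_limit {η lams : ℕ → ℝ} {p₀ p₁ : ℕ → X} {c : ℕ → PL2 X X} {a b : X}
    {lam : ℝ} (hη0 : ∀ n, 0 < η n) (hη : Tendsto η atTop (𝓝 0))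
    (hlam : Tendsto lams atTop (𝓝 lam)) (hp₀ : Tendsto p₀ atTop (𝓝 a))
    (hp₁ : Tendsto p₁ atTop (𝓝 b)) (hcS : ∀ n, c n ∈ P.S) (hc : ∀ n, ‖c n - P.c₀‖ ≤ η n)
    (hend : ∀ n, ∃ τ > 0, ∃ a ≥ 0, ∀ c' ∈ P.S, ‖c' - c n‖ ≤ τ →
      0 ≤ -⟪p₀ n, pl2fst (c' - c n)⟫ + ⟪p₁ n, pl2snd (c' - c n)⟫ +
        lams n * (P.f c' - P.f (c n)) + η n * ‖c' - c n‖ + a * ‖c' - c n‖ ^ 2) :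
    ∃ ζ ∈ limSubdiff (fun z => lam * P.f z) P.c₀,
      ∃ w ∈ limitingNC P.S P.c₀, pl2 a (-b) = ζ + w := by
  obtain ⟨K, hK, r, hr, hlf⟩ := P.lipschitz_f.exists_ball P.c₀
  refine exists_limiting_sum (zs := c) (vs := fun n => pl2 (p₀ n) (-p₁ n))
    (s := fun n => η n + K * |lam - lams n|)
    (K := |lam| * K) (r := r) P.isClosed_S hr (by positivity) (fun z w hz hw => ?_) hcS ?_
    (hp₀.pl2 hp₁.neg) ?_ (fun n => by have := hη0 n; positivity) ?_
  · rw [← mul_sub, abs_mul, mul_assoc]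
    gcongr
    exact hlf z w hz hw
  · exact tendsto_iff_norm_sub_tendsto_zero.2 (squeeze_zero (fun _ => norm_nonneg _) hc hη)
  · have h2 := ((tendsto_const_nhds (x := lam)).sub hlam).abs.const_mul K
    simpa using hη.add h2
  · filter_upwards [hη.eventually_lt_const (show (0 : ℝ) < r / 2 by positivity)] with n h1
    obtain ⟨τ, hτ, α, hα, h⟩ := hend n
    refine ⟨min τ (r / 2), by positivity, α, hα, fun z hz hzc => ?_⟩
    have h2 := h z hz (hzc.trans (min_le_left _ _))
    have h3 := hzc.trans (min_le_right _ _)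
    have h4 := hlf z (c n) (by
      linarith [norm_sub_le_norm_sub_add_norm_sub z (c n) P.c₀, hc n]) (by linarith [hc n])
    have h5 : |(lam - lams n) * (P.f z - P.f (c n))| ≤ |lam - lams n| * (K * ‖z - c n‖) := by
      rw [abs_mul]
      gcongr
      exact h4
    have h6 := (abs_le.1 h5).1
    have h7 : ⟪pl2 (p₀ n) (-p₁ n), z - c n⟫ =
        ⟪p₀ n, pl2fst (z - c n)⟫ - ⟪p₁ n, pl2snd (z - c n)⟫ := by
      rw [inner_pl2, pl2fst_pl2, pl2snd_pl2, inner_neg_left]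
      exact (sub_eq_add_neg _ _).symm
    rw [h7]
    linarith

end

end LocalProblem

namespace LocalProblem

variable {X Y : Type} [NormedAddCommGroup X] [InnerProductSpace ℝ X] [NormedAddCommGroup Y]
  [InnerProductSpace ℝ Y] {P : LocalProblem X Y} {M : ℝ}

section

variable [MeasurableSpace X]

namespace LimitData

theorem tendsto_ω_of_eventually (D : LimitData P M) {t : ℝ}
    (h : ∀ᶠ n in atTop, ‖(D.e n).ω t - P.ws t‖ ≤ D.η n) :
    Tendsto (fun n => (D.e n).ω t) atTop (𝓝 (P.ws t)) :=
  tendsto_iff_norm_sub_tendsto_zero.2 (squeeze_zero'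
    (Eventually.of_forall fun _ => norm_nonneg _) h D.tendsto_η)

variable [FiniteDimensional ℝ X]

theorem transversality (D : LimitData P M) :
    ∃ ζ ∈ limSubdiff (fun z => D.lam * P.f z) P.c₀,
      ∃ w ∈ limitingNC P.S P.c₀, pl2 (D.p P.t0) (-D.p P.t1) = ζ + w :=
  exists_transversality_limit D.η_pos D.tendsto_η D.tendsto_lam
    (D.tendsto_p _ ⟨le_rfl, P.t0_lt.le⟩) D.tendsto_p₁ (fun n => (D.e n).c_mem)
    (fun n => (D.e n).norm_c_sub) (fun n => (D.e n).endpoint)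

end LimitData

end

variable [FiniteDimensional ℝ X] [FiniteDimensional ℝ Y]

/-- The Weierstrass condition obtained from almost minimizers of penalized Hamiltonians. -/
theorem weierstrass_limit {t : ℝ} (hreg : P.Regular t) {η q lams : ℕ → ℝ} {ps x : ℕ → X}
    {ω : ℕ → PL2 X Y} {p : X} {lam : ℝ} (hη : Tendsto η atTop (𝓝 0))
    (hq : ∀ n, 0 ≤ q n) (hlam : Tendsto lams atTop (𝓝 lam)) (hp : Tendsto ps atTop (𝓝 p))
    (hx : ∀ n, ‖x n - P.xs t‖ ≤ η n) (hω : Tendsto ω atTop (𝓝 (P.ws t)))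
    (hham : ∀ n, ∀ z ∈ P.C, ‖pl2fst z - P.xs t‖ < P.ε →
      ‖pl2snd z - P.us t‖ ≤ (1 - η n) * P.r t →
      0 ≤ P.hamRate (q n) (lams n) (ps n) (x n) (ω n) z + η n * ‖z - ω n‖)
    {u : Y} (huC : pl2 (P.xs t) u ∈ P.C) (hur : ‖u - P.us t‖ < P.r t) :
    ⟪p, P.φ (pl2 (P.xs t) u)⟫ - lam * P.F (pl2 (P.xs t) u) ≤
      ⟪p, P.φ (P.ws t)⟫ - lam * P.F (P.ws t) := by
  have hε := P.ε_pos
  have hk := P.k_pos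
  have hrt : 0 < P.r t := (norm_nonneg _).trans_lt hur
  obtain ⟨γ, hγ⟩ : ∃ γ, γ = (P.r t - ‖u - P.us t‖) / 2 := ⟨_, rfl⟩
  have hγ0 : 0 < γ := by rw [hγ]; linarith
  have hx0 : Tendsto (fun n => ‖x n - P.xs t‖) atTop (𝓝 0) :=
    squeeze_zero (fun _ => norm_nonneg _) hx hη
  have hfib : ∀ᶠ n in atTop, ∃ v, pl2 (x n) v ∈ P.C ∧ ‖v - u‖ ≤ 2 * P.k * ‖x n - P.xs t‖ := by
    filter_upwards [hη.eventually_lt_const (show (0 : ℝ) < P.ε / 2 by positivity),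
      hη.eventually_lt_const (show (0 : ℝ) < γ / (2 * P.k) by positivity)] with n h1 h2
    rw [lt_div_iff₀ (by positivity)] at h2
    have h3 : 2 * P.k * ‖x n - P.xs t‖ ≤ 2 * P.k * η n := by gcongr; exact hx n
    have := hreg.exists_mem_fiber (x := x n) (ρ₁ := P.ε) (ρ₂ := γ) huC (by simp)
      (by rw [pl2snd_pl2]; linarith) (by rw [pl2fst_pl2]; linarith [hx n])
      (by rw [pl2fst_pl2]; linarith)
    simpa only [pl2fst_pl2, pl2snd_pl2] using this
  have hfib' : ∀ n, ∃ v, (∃ v, pl2 (x n) v ∈ P.C ∧ ‖v - u‖ ≤ 2 * P.k * ‖x n - P.xs t‖) →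
      pl2 (x n) v ∈ P.C ∧ ‖v - u‖ ≤ 2 * P.k * ‖x n - P.xs t‖ := fun n => by
    by_cases h : ∃ v, pl2 (x n) v ∈ P.C ∧ ‖v - u‖ ≤ 2 * P.k * ‖x n - P.xs t‖
    · exact ⟨h.choose, fun _ => h.choose_spec⟩
    · exact ⟨0, fun h' => (h h').elim⟩
  choose v hv using hfib'
  have hvu : Tendsto v atTop (𝓝 u) := by
    rw [tendsto_iff_norm_sub_tendsto_zero]
    refine squeeze_zero' (Eventually.of_forall fun _ => norm_nonneg _) ?_
      (by simpa using hx0.const_mul (2 * P.k))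
    filter_upwards [hfib] with n hn using (hv n hn).2
  have hxx : Tendsto x atTop (𝓝 (P.xs t)) := tendsto_iff_norm_sub_tendsto_zero.2 hx0
  have hz : Tendsto (fun n => pl2 (x n) (v n)) atTop (𝓝 (pl2 (P.xs t) u)) := hxx.pl2 hvu
  have hφz := (P.continuous_φ.tendsto _).comp hz
  have hφω := (P.continuous_φ.tendsto _).comp hω
  have hFz := (P.continuous_F.tendsto _).comp hz
  have hFω := (P.continuous_F.tendsto _).comp hω
  have hlim := ((hp.inner (hφz.sub hφω)).neg.add (hlam.mul (hFz.sub hFω))).add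
    (hη.mul (hz.sub hω).norm)
  have hnn : ∀ᶠ n in atTop, 0 ≤ -⟪ps n, P.φ (pl2 (x n) (v n)) - P.φ (ω n)⟫ +
      lams n * (P.F (pl2 (x n) (v n)) - P.F (ω n)) + η n * ‖pl2 (x n) (v n) - ω n‖ := by
    have h4 := (hvu.sub_const (P.us t)).norm
    filter_upwards [hfib, hη.eventually_lt_const hε,
      h4.eventually_lt_const (show ‖u - P.us t‖ < ‖u - P.us t‖ + γ by linarith),
      hη.eventually_lt_const (show (0 : ℝ) < γ / P.r t by positivity)] with n h1 h2 h3 h5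
    rw [lt_div_iff₀ hrt] at h5
    have h6 := hham n _ (hv n h1).1 (by rw [pl2fst_pl2]; linarith [hx n]) (by
      rw [pl2snd_pl2]; linarith)
    rw [hamRate, pl2fst_pl2, sub_self, norm_zero] at h6
    have h7 : 0 ≤ q n / 2 * ‖x n - pl2fst (ω n)‖ ^ 2 := by have := hq n; positivity
    linarith
  have h := ge_of_tendsto hlim hnn
  rw [zero_mul, add_zero, inner_sub_right] at h
  linarith

variable [MeasurableSpace X]

namespace LimitData

theorem weierstrass (D : LimitData P M) : ∀ᵐ t ∂P.μ, ∀ u, pl2 (P.xs t) u ∈ P.C →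
    ‖u - P.us t‖ < P.r t → ⟪D.p t, P.φ (pl2 (P.xs t) u)⟫ - D.lam * P.F (pl2 (P.xs t) u) ≤
      ⟪D.p t, P.φ (P.ws t)⟫ - D.lam * P.F (P.ws t) := by
  have hIcc : ∀ᵐ t ∂P.μ, t ∈ Icc P.t0 P.t1 := ae_restrict_mem measurableSet_Icc
  filter_upwards [hIcc, P.ae_regular, D.eventually_notMem,
    ae_all_iff.2 fun n => (D.e n).good, ae_all_iff.2 fun n => (D.e n).ham]
    with t ht hreg hA hgood hham u huC hur
  exact weierstrass_limit hreg D.tendsto_η (fun n => (D.e n).q_nonneg) D.tendsto_lam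
    (D.tendsto_p t ht) (fun n => (D.e n).norm_x_sub t ht)
    (D.tendsto_ω_of_eventually (hA.mono fun n hn => (hgood n hn).2.1)) hham huC hur

theorem euler (D : LimitData P M) (hφ : LocallyLipschitz P.φ) (hF : LocallyLipschitz P.F) :
    ∀ᵐ t ∂P.μ, D.w t ∈ convexHull ℝ {y | (∃ ζ ∈ limSubdiff
        (fun z => ⟪-(D.p t), P.φ z⟫ + D.lam * P.F z) (P.ws t),
      ∃ w ∈ limitingNC P.C (P.ws t), pl2 y 0 = ζ + w) ∧
      ‖y‖ ≤ P.adjLip * (‖D.p t‖ + D.lam)} := by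
  have hIcc : ∀ᵐ t ∂P.μ, t ∈ Icc P.t0 P.t1 := ae_restrict_mem measurableSet_Icc
  filter_upwards [hIcc, P.ae_regular, D.eventually_notMem, D.w_mem,
    ae_all_iff.2 fun n => (D.e n).good, ae_all_iff.2 fun n => (D.e n).ham,
    ae_all_iff.2 fun n => (D.e n).v_eq] with t ht hreg hA hw hgood hham hveq
  refine convexHull_mono (fun y hy => ?_) hw
  obtain ⟨ψ, hψ, hlim⟩ := MapClusterPt.tendsto_subseq hy
  obtain ⟨N, hN⟩ := eventually_atTop.1 hA
  have hψN : Tendsto (fun n => ψ (n + N)) atTop atTop :=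
    hψ.tendsto_atTop.comp (tendsto_add_atTop_nat N)
  have hlim' : Tendsto (fun n => (D.e (ψ (n + N))).v t) atTop (𝓝 y) :=
    hlim.comp (tendsto_add_atTop_nat N)
  have hg := fun n => hgood (ψ (n + N)) (hN _ ((Nat.le_add_left N n).trans (hψ.id_le _)))
  refine ⟨exists_euler_limit hφ hF hreg.δ_le (fun n => D.η_pos (ψ (n + N)))
    (D.tendsto_η.comp hψN) (fun n => (D.e (ψ (n + N))).q_nonneg) (D.tendsto_lam.comp hψN)
    ((D.tendsto_p t ht).comp hψN) hlim' (fun n => hveq (ψ (n + N))) (fun n => (hg n).1)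
    (fun n => (hg n).2.1) (fun n => hham (ψ (n + N))), ?_⟩
  refine le_of_tendsto_of_tendsto' hlim'.norm ?_ fun n => (hg n).2.2
  have h := ((((D.tendsto_p t ht).norm.add D.tendsto_lam).add D.tendsto_η).const_mul
    P.adjLip).comp hψN
  rw [add_zero] at h
  exact h

theorem ae_norm_w_le (D : LimitData P M) (hφ : LocallyLipschitz P.φ)
    (hF : LocallyLipschitz P.F) :
    ∀ᵐ t ∂P.μ, ‖D.w t‖ ≤ P.adjLip * (‖D.p t‖ + D.lam) := by
  filter_upwards [D.euler hφ hF] with t ht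
  have := convexHull_min (fun y hy => mem_closedBall_zero_iff.2 hy.2)
    (convex_closedBall (0 : X) (P.adjLip * (‖D.p t‖ + D.lam))) ht
  exact mem_closedBall_zero_iff.1 this

theorem p_ne_zero (D : LimitData P M) (hφ : LocallyLipschitz P.φ) (hF : LocallyLipschitz P.F)
    (hlam : D.lam = 0) {t : ℝ} (ht : t ∈ Icc P.t0 P.t1) : D.p t ≠ 0 := by
  have : CompleteSpace X := FiniteDimensional.complete ℝ X
  intro h0
  have hab := P.t0_lt.le
  have hC := P.adjLip_pos
  have hsub : ∀ a ∈ Icc P.t0 P.t1, ∀ b ∈ Icc P.t0 P.t1, IntervalIntegrable D.w volume a b :=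
    fun a ha b hb => D.intervalIntegrable_w.mono_set
      (uIcc_subset_uIcc (by rwa [uIcc_of_le hab]) (by rwa [uIcc_of_le hab]))
  have h0' : P.t0 ∈ Icc P.t0 P.t1 := ⟨le_rfl, hab⟩
  have hp : ∀ s ∈ Icc t P.t1, D.p s = ∫ τ in t..s, D.w τ := fun s hs => by
    have hs' : s ∈ Icc P.t0 P.t1 := ⟨ht.1.trans hs.1, hs.2⟩
    have h1 := D.p_eq s hs'
    have h2 := D.p_eq t ht
    have h3 := intervalIntegral.integral_add_adjacent_intervals (hsub _ h0' _ ht)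
      (hsub _ ht _ hs')
    rw [h1, ← h3, ← add_assoc, ← h2, h0, zero_add]
  have hcont : ContinuousOn D.p (Icc t P.t1) := by
    have := intervalIntegral.continuousOn_primitive_interval'
      (hsub _ ht _ ⟨hab, le_rfl⟩) left_mem_uIcc
    rw [uIcc_of_le ht.2] at this
    exact this.congr hp
  have hint : ∀ s ∈ Icc t P.t1, IntervalIntegrable (fun τ => ‖D.p τ‖) volume t s := fun s hs =>
    (hcont.mono (Icc_subset_Icc_right hs.2)).norm.intervalIntegrable_of_Icc hs.1
  obtain ⟨B, hB⟩ := (isCompact_Icc.image_of_continuousOn hcont.norm).bddAbove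
  have hend := eq_zero_of_integral_le_forward (u := fun s => ‖D.p s‖) ht.2 hC.le
    (fun s hs => hB (mem_image_of_mem _ hs)) (hint _ ⟨ht.2, le_rfl⟩) fun s hs => by
      rw [hp s hs, ← intervalIntegral.integral_const_mul]
      refine intervalIntegral.norm_integral_le_of_norm_le hs.1 ?_ ((hint s hs).const_mul _)
      have h4 := (ae_restrict_iff' measurableSet_Icc).1 (D.ae_norm_w_le hφ hF)
      filter_upwards [h4] with τ hτ hτs
      have := hτ ⟨ht.1.trans hτs.1.le, hτs.2.trans hs.2⟩
      rwa [hlam, add_zero] at this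
  have h5 : ‖D.p P.t1‖ = 0 := le_antisymm hend (norm_nonneg _)
  have := D.normalized
  rw [h5, hlam] at this
  norm_num at this

end LimitData

end LocalProblem

namespace LocalProblem

variable {X Y : Type} [NormedAddCommGroup X] [InnerProductSpace ℝ X] [NormedAddCommGroup Y]
  [InnerProductSpace ℝ Y]

/-- A normal or abnormal extremal of the local problem. -/
structure Extremal (P : LocalProblem X Y) where
  p : ℝ → X
  w : ℝ → X
  lam : ℝ
  intervalIntegrable_w : IntervalIntegrable w volume P.t0 P.t1
  p_eq : ∀ t ∈ Icc P.t0 P.t1, p t = p P.t0 + ∫ s in P.t0..t, w s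
  lam_mem : lam ∈ ({0, 1} : Set ℝ)
  nontrivial : ∀ t ∈ Icc P.t0 P.t1, (lam, p t) ≠ 0
  transversality : ∃ a ∈ limSubdiff P.f P.c₀, ∃ b ∈ limitingNC P.S P.c₀,
    pl2 (p P.t0) (-p P.t1) = lam • a + b
  euler : ∀ᵐ t ∂P.μ, w t ∈ convexHull ℝ {y | ∃ ζ ∈ limSubdiff
    (fun z => ⟪-(p t), P.φ z⟫ + lam * P.F z) (P.ws t), ∃ w ∈ limitingNC P.C (P.ws t),
      pl2 y 0 = ζ + w}
  weierstrass : ∀ᵐ t ∂P.μ, ∀ u, pl2 (P.xs t) u ∈ P.C → ‖u - P.us t‖ < P.r t →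
    ⟪p t, P.φ (pl2 (P.xs t) u)⟫ - lam * P.F (pl2 (P.xs t) u) ≤
      ⟪p t, P.φ (P.ws t)⟫ - lam * P.F (P.ws t)
  normal_of_free : P.S = univ → lam = 1

variable {P : LocalProblem X Y} {M : ℝ} [FiniteDimensional ℝ X] [FiniteDimensional ℝ Y]
  [MeasurableSpace X]

namespace LimitData

theorem nonempty_extremal_of_lam_eq_zero (D : LimitData P M) (hφ : LocallyLipschitz P.φ)
    (hF : LocallyLipschitz P.F) (hlam : D.lam = 0) : Nonempty P.Extremal := by
  obtain ⟨ζ, hζ, b, hb, hab⟩ := D.transversality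
  obtain ⟨a, ha⟩ := limSubdiff_nonempty P.lipschitz_f P.c₀
  have hζ0 : ζ = 0 := by
    simp only [hlam, zero_mul] at hζ
    exact limSubdiff_zero _ hζ
  rw [hζ0] at hab
  have hne := fun t ht => D.p_ne_zero hφ hF hlam (t := t) ht
  exact ⟨{ p := D.p, w := D.w, lam := D.lam
           intervalIntegrable_w := D.intervalIntegrable_w
           p_eq := D.p_eq
           lam_mem := Or.inl hlam
           nontrivial := fun t ht h => hne t ht (congrArg Prod.snd h)
           transversality := ⟨a, ha, b, hb, by rw [hab, hlam, zero_smul]⟩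
           euler := (D.euler hφ hF).mono fun t ht => convexHull_mono (fun y hy => hy.1) ht
           weierstrass := D.weierstrass
           normal_of_free := fun hS => by
             rw [hS, limitingNC_univ, mem_singleton_iff] at hb
             rw [hb, add_zero] at hab
             have h1 := congrArg pl2fst hab
             rw [pl2fst_pl2] at h1
             exact (hne _ ⟨le_rfl, P.t0_lt.le⟩ (h1.trans (by simp))).elim }⟩

theorem nonempty_extremal_of_lam_pos (D : LimitData P M) (hφ : LocallyLipschitz P.φ)
    (hF : LocallyLipschitz P.F) (hlam : 0 < D.lam) : Nonempty P.Extremal := by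
  have : CompleteSpace X := FiniteDimensional.complete ℝ X
  obtain ⟨ζ, hζ, b, hb, hab⟩ := D.transversality
  have hinv : 0 < D.lam⁻¹ := inv_pos.2 hlam
  have hmul : ∀ a : ℝ, D.lam⁻¹ * (D.lam * a) = a := fun a => inv_mul_cancel_left₀ hlam.ne' a
  refine ⟨{ p := fun t => D.lam⁻¹ • D.p t, w := fun t => D.lam⁻¹ • D.w t, lam := 1
            intervalIntegrable_w := D.intervalIntegrable_w.smul _
            p_eq := fun t ht => by
              rw [intervalIntegral.integral_smul, ← smul_add, ← D.p_eq t ht]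
            lam_mem := Or.inr rfl
            nontrivial := fun t _ h => one_ne_zero (congrArg Prod.fst h)
            transversality := ⟨D.lam⁻¹ • ζ, ?_, D.lam⁻¹ • b,
              smul_mem_limitingNC hb hinv.le, ?_⟩
            euler := ?_
            weierstrass := ?_
            normal_of_free := fun _ => rfl }⟩
  · simpa only [hmul] using smul_mem_limSubdiff hζ hinv
  · rw [one_smul, ← smul_add, ← hab]
    exact pl2_ext (by simp) (by simp)
  · filter_upwards [D.euler hφ hF] with t ht
    have h1 := smul_mem_smul_set (a := D.lam⁻¹) ht
    rw [← convexHull_smul] at h1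
    refine convexHull_mono ?_ h1
    rintro _ ⟨y, ⟨⟨ζ, hζ, w, hw, h⟩, -⟩, rfl⟩
    refine ⟨D.lam⁻¹ • ζ, ?_, D.lam⁻¹ • w, smul_mem_limitingNC hw hinv.le, ?_⟩
    · have := smul_mem_limSubdiff hζ hinv
      simp only [mul_add, hmul, inner_neg_left] at this
      simpa only [one_mul, inner_neg_left, real_inner_smul_left, mul_neg] using this
    · rw [← smul_add, ← h]
      exact pl2_ext (by simp) (by simp)
  · filter_upwards [D.weierstrass] with t ht u hu hur
    have h1 := mul_le_mul_of_nonneg_left (ht u hu hur) hinv.le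
    rw [mul_sub, mul_sub, hmul, hmul] at h1
    simpa only [real_inner_smul_left, one_mul] using h1

end LimitData

theorem nonempty_extremal [BorelSpace X] (hφ : LocallyLipschitz P.φ)
    (hF : LocallyLipschitz P.F) : Nonempty P.Extremal := by
  obtain ⟨D⟩ := exists_limitData fun η h1 h2 => exists_approxExtremal (P := P) h1 h2
  rcases D.lam_nonneg.eq_or_lt with h | h
  · exact D.nonempty_extremal_of_lam_eq_zero hφ hF h.symm
  · exact D.nonempty_extremal_of_lam_pos hφ hF h

end LocalProblem

theorem setIntegral_Iic_restrict_Icc {G : Type} [NormedAddCommGroup G] [NormedSpace ℝ G]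
    {g : ℝ → G} {a b t : ℝ} (ht : t ∈ Icc a b) :
    ∫ s in Iic t, g s ∂(volume.restrict (Icc a b)) = ∫ s in a..t, g s := by
  rw [Measure.restrict_restrict measurableSet_Iic, intervalIntegral.integral_of_le ht.1,
    ← integral_Icc_eq_integral_Ioc]
  congr 2
  ext s
  simp only [mem_inter_iff, mem_Iic, mem_Icc]
  exact ⟨fun h => ⟨h.2.1, h.1⟩, fun h => ⟨h.2, h.1, h.2.trans ht.2⟩⟩

theorem integral_restrict_Icc_eq {G : Type} [NormedAddCommGroup G] [NormedSpace ℝ G]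
    (g : ℝ → G) {a b : ℝ} (hab : a ≤ b) :
    ∫ s, g s ∂(volume.restrict (Icc a b)) = ∫ s in a..b, g s := by
  rw [intervalIntegral.integral_of_le hab, ← integral_Icc_eq_integral_Ioc]

theorem Arc.continuousOn {n : ℕ} {t0 t1 : ℝ} (x : Arc n t0 t1) (h : t0 ≤ t1) :
    ContinuousOn x.f (Icc t0 t1) := by
  have := intervalIntegral.continuousOn_primitive_interval' x.intble left_mem_uIcc
  rw [uIcc_of_le h] at this
  exact (continuousOn_const.add this).congr x.rel

/-- A locally Lipschitz map is bounded and Lipschitz on a compact set. -/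
theorem LocallyLipschitz.exists_bound_of_isCompact {E G : Type} [NormedAddCommGroup E]
    [NormedAddCommGroup G] {g : E → G} (hg : LocallyLipschitz g) {W : Set E} (hW : IsCompact W) :
    ∃ K > 0, ∀ K' ≥ K, (∀ z ∈ W, ‖g z‖ ≤ K') ∧ ∀ z ∈ W, ∀ w ∈ W, ‖g z - g w‖ ≤ K' * ‖z - w‖ := by
  obtain ⟨L, hL⟩ := LocallyLipschitzOn.exists_lipschitzOnWith_of_compact hW hg.locallyLipschitzOn
  obtain ⟨B, hB⟩ := (hW.image hg.continuous).isBounded.exists_norm_le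
  refine ⟨L + |B| + 1, by positivity, fun K' hK => ⟨fun z hz => ?_, fun z hz w hw => ?_⟩⟩
  · have := hB _ (mem_image_of_mem g hz)
    linarith [le_abs_self B, L.coe_nonneg]
  · have := hL.dist_le_mul z hz w hw
    rw [dist_eq_norm, dist_eq_norm] at this
    exact this.trans (mul_le_mul_of_nonneg_right (by linarith [abs_nonneg B]) (norm_nonneg _))

namespace ProblemP

variable {nx nu dd : ℕ} {t0 t1 : ℝ} {F : PL2 (Euc nx) (Euc nu) → ℝ}
  {f : PL2 (Euc nx) (Euc nx) → ℝ} {φ : PL2 (Euc nx) (Euc nu) → Euc nx}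
  {Φ : PL2 (Euc nx) (Euc nu) → Euc dd} {Uset : Set (Euc nu)} {Om : Set (Euc dd)}
  {S : Set (PL2 (Euc nx) (Euc nx))} {ε : ℝ} {R : ℝ → ℝ≥0∞} {xs : Arc nx t0 t1}
  {us : ℝ → Euc nu}

theorem exists_slope_bound_of_WBCQ (hΦ : LocallyLipschitz Φ) (hU : IsClosed Uset)
    (hOm : IsClosed Om) {W : Set (PL2 (Euc nx) (Euc nu))} (hW : IsCompact W)
    (hCQ : ∀ z ∈ W, WBCQ Φ Uset Om (pl2fst z) (pl2snd z) ∧ Calm (Mmap Φ Uset Om) 0 z) :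
    ∃ k > 0, ∀ z ∈ W, ∀ v ∈ limitingNC (feasibleSet Φ Uset Om) z,
      ‖pl2fst v‖ ≤ k * ‖pl2snd v‖ := by
  refine exists_slope_bound hW fun z hz v hv hv0 => ?_
  obtain ⟨lam, hlam, a, ha, η, hη, h⟩ :=
    exists_multiplier_of_mem_limitingNC hΦ hU hOm (hCQ z hz).2 hv
  refine (hCQ z hz).1 lam _ hlam ⟨a, ha, η, hη, ?_⟩
  rw [← h, ← hv0, pl2_eta]

/-- The truncated radius. -/
def truncRadius (R : ℝ → ℝ≥0∞) (M : ℝ) (t : ℝ) : ℝ := (min (R t) (ENNReal.ofReal M)).toReal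

theorem ofReal_truncRadius (R : ℝ → ℝ≥0∞) (M t : ℝ) :
    ENNReal.ofReal (truncRadius R M t) = min (R t) (ENNReal.ofReal M) :=
  ENNReal.ofReal_toReal (ne_top_of_le_ne_top ENNReal.ofReal_ne_top (min_le_right _ _))

theorem enorm_le_of_le_truncRadius {M t : ℝ} {v : Euc nu} (h : ‖v‖ ≤ truncRadius R M t) :
    (‖v‖₊ : ℝ≥0∞) ≤ R t := by
  have h1 : (‖v‖₊ : ℝ≥0∞) = ENNReal.ofReal ‖v‖ := (ofReal_norm v).symm
  rw [h1]
  refine (ENNReal.ofReal_le_ofReal h).trans ?_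
  rw [ofReal_truncRadius]
  exact min_le_left _ _

theorem lt_truncRadius {M t : ℝ} {v : Euc nu} (h : (‖v‖₊ : ℝ≥0∞) < R t) (hM : ‖v‖ < M) :
    ‖v‖ < truncRadius R M t := by
  have h1 : (‖v‖₊ : ℝ≥0∞) = ENNReal.ofReal ‖v‖ := (ofReal_norm v).symm
  rw [h1] at h
  refine lt_of_not_ge fun hle => ?_
  have h2 := ENNReal.ofReal_le_ofReal hle
  rw [ofReal_truncRadius] at h2
  have h3 : ENNReal.ofReal ‖v‖ < ENNReal.ofReal M :=
    (ENNReal.ofReal_lt_ofReal_iff ((norm_nonneg v).trans_lt hM)).2 hM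
  exact (lt_min h h3).not_ge h2

theorem le_truncRadius {M t δ : ℝ} (h : ENNReal.ofReal δ ≤ R t) (hM : δ ≤ M) :
    δ ≤ truncRadius R M t := by
  have h2 := le_min h (ENNReal.ofReal_le_ofReal hM)
  rw [← ofReal_truncRadius] at h2
  exact (ENNReal.ofReal_le_ofReal_iff ENNReal.toReal_nonneg).1 h2

theorem measurable_truncRadius (hR : Measurable R) (M : ℝ) : Measurable (truncRadius R M) :=
  (hR.min measurable_const).ennreal_toReal

end ProblemP

namespace ProblemP

variable {nx nu dd : ℕ} {t0 t1 : ℝ} {F : PL2 (Euc nx) (Euc nu) → ℝ}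
  {f : PL2 (Euc nx) (Euc nx) → ℝ} {φ : PL2 (Euc nx) (Euc nu) → Euc nx}
  {Φ : PL2 (Euc nx) (Euc nu) → Euc dd} {Uset : Set (Euc nu)} {Om : Set (Euc dd)}
  {S : Set (PL2 (Euc nx) (Euc nx))} {ε : ℝ} {R : ℝ → ℝ≥0∞} {xs : Arc nx t0 t1}
  {us : ℝ → Euc nu}

theorem IsLocalMinOfRadius.le_of_traj (hmin : IsLocalMinOfRadius F f φ Φ Uset Om S ε R xs us)
    (ht : t0 < t1) (hφ : Continuous φ) {W : Set (PL2 (Euc nx) (Euc nu))} {K B : ℝ} (hK : 0 < K)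
    (hB : ∀ z ∈ W, ‖z‖ ≤ B) (hφK : ∀ z ∈ W, ‖φ z‖ ≤ K)
    (hφL : ∀ z ∈ W, ∀ w ∈ W, ‖φ z - φ w‖ ≤ K * ‖z - w‖)
    {x : ℝ → Euc nx} (hx : StronglyMeasurable x) (hxs : ∀ t ∈ Icc t0 t1, x t = xs.f t)
    (hsW : ∀ᵐ t ∂(volume.restrict (Icc t0 t1)), pl2 (x t) (us t) ∈ W)
    {c : PL2 (Euc nx) (Euc nx)} {ω : ℝ → PL2 (Euc nx) (Euc nu)} (hc : c ∈ S)
    (hω : StronglyMeasurable ω)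
    (hωW : ∀ᵐ t ∂(volume.restrict (Icc t0 t1)), ω t ∈ W)
    (hωC : ∀ᵐ t ∂(volume.restrict (Icc t0 t1)), ω t ∈ feasibleSet Φ Uset Om ∧
      ‖pl2fst (ω t) - x t‖ ≤ ε ∧ (‖pl2snd (ω t) - us t‖₊ : ℝ≥0∞) ≤ R t)
    (htraj : ∀ᵐ t ∂(volume.restrict (Icc t0 t1)), pl2fst (ω t) =
      pl2fst c + ∫ s in Iic t, φ (ω s) ∂(volume.restrict (Icc t0 t1)))
    (hend : pl2fst c + (∫ s, φ (ω s) ∂(volume.restrict (Icc t0 t1))) = pl2snd c)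
    (hint : (∫ t, ‖ω t - pl2 (x t) (us t)‖ ∂(volume.restrict (Icc t0 t1))) ≤ ε / K) :
    (∫ t, F (pl2 (x t) (us t)) ∂(volume.restrict (Icc t0 t1))) + f (pl2 (x t0) (x t1)) ≤
      (∫ t, F (ω t) ∂(volume.restrict (Icc t0 t1))) + f c := by
  have hle := ht.le
  have hIcc : ∀ᵐ t ∂(volume.restrict (Icc t0 t1)), t ∈ Icc t0 t1 :=
    ae_restrict_mem measurableSet_Icc
  have hi : Integrable (fun t => φ (ω t)) (volume.restrict (Icc t0 t1)) :=
    .of_bound (hφ.comp_stronglyMeasurable hω).aestronglyMeasurable K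
      (hωW.mono fun t h => hφK _ h)
  let y : Arc nx t0 t1 :=
    { f := fun t => pl2fst c + ∫ s in t0..t, φ (ω s)
      d := fun t => φ (ω t)
      intble := (intervalIntegrable_iff_integrableOn_Icc_of_le hle).2 hi
      rel := fun t _ => by simp }
  have hy : ∀ᵐ t ∂(volume.restrict (Icc t0 t1)), y.f t = pl2fst (ω t) := by
    filter_upwards [htraj, hIcc] with t h1 h2
    rw [h1, setIntegral_Iic_restrict_Icc h2]
  have hy' : ∀ᵐ t ∂(volume.restrict (Icc t0 t1)), pl2 (y.f t) (pl2snd (ω t)) = ω t := by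
    filter_upwards [hy] with t h1
    rw [h1, pl2_eta]
  have hye : pl2 (y.f t0) (y.f t1) = c := by
    refine pl2_ext (by simp [y]) ?_
    rw [pl2snd_pl2, ← hend, integral_restrict_Icc_eq _ hle]
  have hadm : Admissible φ Φ Uset Om S y fun t => pl2snd (ω t) := by
    refine ⟨(continuous_pl2snd.comp_stronglyMeasurable hω).measurable, ?_, hye.symm ▸ hc⟩
    filter_upwards [hy', hωC] with t h1 h2
    rw [h1]
    exact ⟨rfl, h2.1.2, h2.1.1⟩
  have hd : ∀ᵐ t ∂(volume.restrict (Icc t0 t1)),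
      ‖y.d t - xs.d t‖ ≤ K * ‖ω t - pl2 (x t) (us t)‖ := by
    filter_upwards [hmin.1.2.1, hIcc, hωW, hsW] with t h1 h2 h3 h4
    rw [h1.1, ← hxs t h2]
    exact hφL _ h3 _ h4
  have hwi : Integrable (fun t => ‖ω t - pl2 (x t) (us t)‖) (volume.restrict (Icc t0 t1)) := by
    refine .of_bound (hω.sub (continuous_pl2.comp_stronglyMeasurable
      (hx.prodMk hmin.1.1.stronglyMeasurable))).norm.aestronglyMeasurable (2 * B) ?_
    filter_upwards [hωW, hsW] with t h3 h4
    rw [norm_norm]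
    linarith [norm_sub_le (ω t) (pl2 (x t) (us t)), hB _ h3, hB _ h4]
  have hJ := hmin.2 y _ hadm (by
    filter_upwards [hy, hωC, hIcc] with t h1 h2 h3
    rw [h1, ← hxs t h3]
    exact h2.2) (by
    rw [← integral_restrict_Icc_eq _ hle]
    refine (integral_mono_of_nonneg (ae_of_all _ fun _ => norm_nonneg _)
      (hwi.const_mul K) hd).trans ?_
    rw [integral_const_mul]
    rwa [le_div_iff₀' hK] at hint)
  rw [Jcost, Jcost, hye, ← integral_restrict_Icc_eq _ hle, ← integral_restrict_Icc_eq _ hle] at hJ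
  rw [hxs t0 ⟨le_rfl, hle⟩, hxs t1 ⟨hle, le_rfl⟩]
  refine (Eq.le ?_).trans (hJ.trans (Eq.le ?_)) <;> congr 1
  · exact integral_congr_ae (hIcc.mono fun t h => by simp only; rw [hxs t h])
  · exact integral_congr_ae (hy'.mono fun t h => by simp only; rw [h])

end ProblemP

namespace ProblemP

variable {nx nu dd : ℕ} {t0 t1 : ℝ} {F : PL2 (Euc nx) (Euc nu) → ℝ}
  {f : PL2 (Euc nx) (Euc nx) → ℝ} {φ : PL2 (Euc nx) (Euc nu) → Euc nx}
  {Φ : PL2 (Euc nx) (Euc nu) → Euc dd} {Uset : Set (Euc nu)} {Om : Set (Euc dd)}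
  {S : Set (PL2 (Euc nx) (Euc nx))} {ε : ℝ} {R : ℝ → ℝ≥0∞} {xs : Arc nx t0 t1}
  {us : ℝ → Euc nu}

theorem exists_localProblem (ht : t0 < t1) (hF : LocallyLipschitz F) (hf : LocallyLipschitz f)
    (hφ : LocallyLipschitz φ) (hΦ : LocallyLipschitz Φ) (hU : IsClosed Uset) (hOm : IsClosed Om)
    (hS : IsClosed S) (hε : 0 < ε) (hR : Measurable R)
    (hmin : IsLocalMinOfRadius F f φ Φ Uset Om S ε R xs us) {δ : ℝ} (hδ : 0 < δ)
    (hRδ : ∀ᵐ t ∂(volume.restrict (Icc t0 t1)), ENNReal.ofReal δ ≤ R t)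
    (hC : IsCompact (Ctil Φ Uset Om ε R xs us))
    (hCQ : ∀ q ∈ Ctil Φ Uset Om ε R xs us,
      WBCQ Φ Uset Om q.2.1 q.2.2 ∧ Calm (Mmap Φ Uset Om) 0 (pl2 q.2.1 q.2.2)) :
    ∃ P : LocalProblem (Euc nx) (Euc nu), P.t0 = t0 ∧ P.t1 = t1 ∧ P.F = F ∧ P.f = f ∧ P.φ = φ ∧
      P.S = S ∧ P.C = feasibleSet Φ Uset Om ∧ P.us = us ∧
      (∀ t ∈ Icc t0 t1, P.xs t = xs.f t) ∧
      ∀ᵐ t ∂(volume.restrict (Icc t0 t1)), ∀ u, pl2 (xs.f t) u ∈ feasibleSet Φ Uset Om →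
        (‖u - us t‖₊ : ℝ≥0∞) < R t → ‖u - us t‖ < P.r t := by
  have hIcc : ∀ᵐ t ∂(volume.restrict (Icc t0 t1)), t ∈ Icc t0 t1 :=
    ae_restrict_mem measurableSet_Icc
  have hle := ht.le
  obtain ⟨W, hW⟩ : ∃ W, W = (fun q : ℝ × Euc nx × Euc nu => pl2 q.2.1 q.2.2) ''
    Ctil Φ Uset Om ε R xs us := ⟨_, rfl⟩
  have hWc : IsCompact W := hW ▸ hC.image (continuous_pl2.comp continuous_snd)
  have hmemW : ∀ t ∈ Icc t0 t1, ∀ z ∈ feasibleSet Φ Uset Om, ‖pl2fst z - xs.f t‖ ≤ ε →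
      (‖pl2snd z - us t‖₊ : ℝ≥0∞) ≤ R t → z ∈ W := fun t h z hz h1 h2 => by
    rw [hW]
    exact ⟨(t, pl2fst z, pl2snd z), subset_closure ⟨h, h1, hz.1, hz.2, h2⟩, pl2_eta z⟩
  obtain ⟨k, hk, hslope⟩ := exists_slope_bound_of_WBCQ hΦ hU hOm hWc (by
    rw [hW]
    rintro _ ⟨q, hq, rfl⟩
    exact hCQ q hq)
  obtain ⟨K₁, hK₁, hφK⟩ := hφ.exists_bound_of_isCompact hWc
  obtain ⟨K₂, hK₂, hFK⟩ := hF.exists_bound_of_isCompact hWc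
  obtain ⟨B₀, hB₀⟩ := hWc.isBounded.exists_norm_le
  obtain ⟨B, hB, hBW⟩ : ∃ B > 0, ∀ z ∈ W, ‖z‖ ≤ B :=
    ⟨|B₀| + 1, by positivity, fun z hz => by linarith [hB₀ z hz, le_abs_self B₀]⟩
  obtain ⟨hφb, hφl⟩ := hφK (max K₁ K₂) (le_max_left _ _)
  obtain ⟨hFb, hFl⟩ := hFK (max K₁ K₂) (le_max_right _ _)
  have hK : 0 < max K₁ K₂ := lt_max_of_lt_left hK₁
  obtain ⟨x, hx⟩ : ∃ x : ℝ → Euc nx, x = IccExtend hle ((Icc t0 t1).domRestrict xs.f) := ⟨_, rfl⟩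
  have hxs : ∀ t ∈ Icc t0 t1, x t = xs.f t := fun t h => by
    rw [hx, IccExtend_of_mem hle _ h, domRestrict_apply]
  have hxm : StronglyMeasurable x := by
    rw [hx]
    exact (continuousOn_iff_continuous_domRestrict.1 (xs.continuousOn hle)).Icc_extend'
      |>.stronglyMeasurable
  have href : ∀ᵐ t ∂(volume.restrict (Icc t0 t1)), pl2 (x t) (us t) ∈ feasibleSet Φ Uset Om := by
    filter_upwards [hmin.1.2.1, hIcc] with t h1 h2
    rw [hxs t h2]
    exact ⟨h1.2.2, h1.2.1⟩
  have hrefW : ∀ᵐ t ∂(volume.restrict (Icc t0 t1)), pl2 (x t) (us t) ∈ W := by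
    filter_upwards [href, hIcc] with t h1 h2
    refine hmemW t h2 _ h1 ?_ (by simp)
    rw [pl2fst_pl2, hxs t h2, sub_self, norm_zero]
    exact hε.le
  have hnear : ∀ᵐ t ∂(volume.restrict (Icc t0 t1)), ∀ z ∈ feasibleSet Φ Uset Om,
      ‖pl2fst z - x t‖ ≤ ε → ‖pl2snd z - us t‖ ≤ truncRadius R (2 * B + 1 + δ) t → z ∈ W := by
    filter_upwards [hIcc] with t h z hz h1 h2
    rw [hxs t h] at h1
    exact hmemW t h z hz h1 (enorm_le_of_le_truncRadius h2)
  refine ⟨{ t0 := t0, t1 := t1, F := F, f := f, φ := φ, C := feasibleSet Φ Uset Om, W := W, S := S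
            xs := x, us := us, r := truncRadius R (2 * B + 1 + δ), ε := ε, δ := δ, k := k
            K := max K₁ K₂, B := B, ρ := ε / max K₁ K₂
            t0_lt := ht, ε_pos := hε, δ_pos := hδ, k_pos := hk, K_pos := hK, B_pos := hB
            ρ_pos := by positivity
            continuous_F := hF.continuous, continuous_φ := hφ.continuous, lipschitz_f := hf
            isClosed_C := isClosed_feasibleSet hΦ.continuous hU hOm, isClosed_S := hS
            norm_le_B := hBW, φ_bound := hφb, F_bound := hFb, φ_lip := hφl, F_lip := hFl
            slope := hslope, measurable_xs := hxm
            measurable_us := hmin.1.1.stronglyMeasurable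
            measurable_r := measurable_truncRadius hR _
            δ_le := hRδ.mono fun t h => le_truncRadius h (by linarith)
            mem_W := hnear
            ref_mem := href
            ref_endpoints := by
              rw [hxs t0 ⟨le_rfl, hle⟩, hxs t1 ⟨hle, le_rfl⟩]
              exact hmin.1.2.2
            ref_traj := fun t h => ?_
            minimal := fun c ω hc hω h1 h2 h3 h4 => ?_ },
    rfl, rfl, rfl, rfl, rfl, rfl, rfl, rfl, hxs, ?_⟩
  · rw [setIntegral_Iic_restrict_Icc h, hxs t h, hxs t0 ⟨le_rfl, hle⟩, xs.rel t h]
    congr 1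
    refine intervalIntegral.integral_congr_ae ?_
    rw [uIoc_of_le h.1]
    filter_upwards [(ae_restrict_iff' measurableSet_Icc).1 hmin.1.2.1] with s hs hst
    have hs' : s ∈ Icc t0 t1 := ⟨hst.1.le, hst.2.trans h.2⟩
    rw [(hs hs').1, hxs s hs']
  · refine hmin.le_of_traj ht hφ.continuous hK hBW hφb hφl hxm hxs hrefW hc hω ?_ ?_ h2 h3 h4
    · filter_upwards [h1, hnear] with t h5 h6 using h6 _ h5.1 h5.2.1 h5.2.2
    · exact h1.mono fun t h => ⟨h.1, h.2.1, enorm_le_of_le_truncRadius h.2.2⟩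
  · filter_upwards [hIcc, hrefW] with t h h0 u hu hur
    refine lt_truncRadius hur ?_
    have h1 := hmemW t h _ hu (by rw [pl2fst_pl2, sub_self, norm_zero]; exact hε.le)
      (by rw [pl2snd_pl2]; exact hur.le)
    have h2 := (norm_pl2snd_le _).trans (hBW _ h1)
    have h3 := (norm_pl2snd_le _).trans (hBW _ h0)
    rw [pl2snd_pl2] at h2 h3
    linarith [norm_sub_le u (us t)]

/-- A convexified normal cone inclusion for the feasible set splits into the Clarke form. -/
theorem exists_clarke_decomposition (hΦ : LocallyLipschitz Φ) (hU : IsClosed Uset)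
    (hOm : IsClosed Om) {g : PL2 (Euc nx) (Euc nu) → ℝ} {z : PL2 (Euc nx) (Euc nu)}
    (hcalm : Calm (Mmap Φ Uset Om) 0 z) {y : Euc nx}
    (hy : y ∈ convexHull ℝ {y | ∃ ζ ∈ limSubdiff g z,
      ∃ w ∈ limitingNC (feasibleSet Φ Uset Om) z, pl2 y 0 = ζ + w}) :
    ∃ a ∈ clarkeSubdiff g z, ∃ β ∈ clarkeNC Uset (pl2snd z),
      ∃ c ∈ convexHull ℝ (⋃ lam ∈ limitingNC Om (Φ z), limSubdiff (fun z => ⟪lam, Φ z⟫) z),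
        pl2 y 0 = a + pl2 0 β + c := by
  refine convexHull_min (t := {y | ∃ a ∈ clarkeSubdiff g z, ∃ β ∈ clarkeNC Uset (pl2snd z),
      ∃ c ∈ convexHull ℝ (⋃ lam ∈ limitingNC Om (Φ z), limSubdiff (fun z => ⟪lam, Φ z⟫) z),
        pl2 y 0 = a + pl2 0 β + c}) ?_ ?_ hy
  · rintro y ⟨ζ, hζ, w, hw, h⟩
    obtain ⟨lam, hlam, a, ha, η, hη, rfl⟩ :=
      exists_multiplier_of_mem_limitingNC hΦ hU hOm hcalm hw
    refine ⟨ζ, subset_convexHull ℝ _ hζ, η, subset_closure (subset_convexHull ℝ _ hη), a,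
      subset_convexHull ℝ _ (mem_biUnion hlam ha), ?_⟩
    rw [h]
    abel
  · rintro y ⟨a, ha, β, hβ, c, hc, h⟩ y' ⟨a', ha', β', hβ', c', hc', h'⟩ s s' hs hs' hss
    refine ⟨s • a + s' • a', convex_convexHull ℝ _ ha ha' hs hs' hss, s • β + s' • β',
      (convex_convexHull ℝ _).closure hβ hβ' hs hs' hss, s • c + s' • c',
      convex_convexHull ℝ _ hc hc' hs hs' hss, ?_⟩
    have h1 : pl2 (s • y + s' • y') (0 : Euc nu) = s • pl2 y 0 + s' • pl2 y' 0 :=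
      pl2_ext (by simp) (by simp)
    have h2 : pl2 (0 : Euc nx) (s • β + s' • β') = s • pl2 0 β + s' • pl2 0 β' :=
      pl2_ext (by simp) (by simp)
    rw [h1, h2, h, h']
    module

end ProblemP

namespace ProblemP

/-- Necessary optimality conditions for a local minimum of radius
`R(·)` of problem (P) under the WBCQ plus calmness of the perturbed constraint map:
nontriviality, transversality, the Euler adjoint inclusion and the Weierstrass
condition of radius `R(·)`; in the free end point case `λ₀` can be taken as `1`. -/
theorem necessary_optimality_P
    {nx nu dd : ℕ} {t0 t1 : ℝ} (ht : t0 < t1)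
    (F : PL2 (Euc nx) (Euc nu) → ℝ) (f : PL2 (Euc nx) (Euc nx) → ℝ)
    (φ : PL2 (Euc nx) (Euc nu) → Euc nx) (Φ : PL2 (Euc nx) (Euc nu) → Euc dd)
    (Uset : Set (Euc nu)) (Om : Set (Euc dd)) (S : Set (PL2 (Euc nx) (Euc nx)))
    (hF : LocallyLipschitz F) (hf : LocallyLipschitz f)
    (hφ : LocallyLipschitz φ) (hΦ : LocallyLipschitz Φ)
    (hU : IsClosed Uset) (hOm : IsClosed Om) (hS : IsClosed S)
    (ε : ℝ) (hε : 0 < ε) (R : ℝ → ℝ≥0∞) (hR : Measurable R)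
    (xs : Arc nx t0 t1) (us : ℝ → Euc nu)
    (hmin : IsLocalMinOfRadius F f φ Φ Uset Om S ε R xs us)
    (δ : ℝ) (hδ : 0 < δ)
    (hRδ : ∀ᵐ t ∂(volume.restrict (Set.Icc t0 t1)), ENNReal.ofReal δ ≤ R t)
    (hCcpt : IsCompact (Ctil Φ Uset Om ε R xs us))
    (hCQ : ∀ q ∈ Ctil Φ Uset Om ε R xs us,
      WBCQ Φ Uset Om q.2.1 q.2.2 ∧ Calm (Mmap Φ Uset Om) 0 (pl2 q.2.1 q.2.2)) :
    ∃ (p : Arc nx t0 t1) (lam0 : ℝ), lam0 ∈ ({0, 1} : Set ℝ) ∧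
      -- nontriviality
      (∀ t ∈ Set.Icc t0 t1, (lam0, p.f t) ≠ 0) ∧
      -- transversality
      (∃ a ∈ limSubdiff f (pl2 (xs.f t0) (xs.f t1)),
        ∃ b ∈ limitingNC S (pl2 (xs.f t0) (xs.f t1)),
        pl2 (p.f t0) (-(p.f t1)) = lam0 • a + b) ∧
      -- Euler adjoint inclusion
      (∀ᵐ t ∂(volume.restrict (Set.Icc t0 t1)),
        ∃ a ∈ clarkeSubdiff (fun z => ⟪-(p.f t), φ z⟫ + lam0 * F z) (pl2 (xs.f t) (us t)),
        ∃ β ∈ clarkeNC Uset (us t),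
        ∃ c ∈ convexHull ℝ (⋃ lam ∈ limitingNC Om (Φ (pl2 (xs.f t) (us t))),
          limSubdiff (fun z => ⟪lam, Φ z⟫) (pl2 (xs.f t) (us t))),
        pl2 (p.d t) 0 = a + pl2 0 β + c) ∧
      -- Weierstrass condition of radius R(·)
      (∀ᵐ t ∂(volume.restrict (Set.Icc t0 t1)), ∀ u ∈ Uset,
        Φ (pl2 (xs.f t) u) ∈ Om → (‖u - us t‖₊ : ℝ≥0∞) < R t →
        ⟪p.f t, φ (pl2 (xs.f t) u)⟫ - lam0 * F (pl2 (xs.f t) u) ≤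
          ⟪p.f t, φ (pl2 (xs.f t) (us t))⟫ - lam0 * F (pl2 (xs.f t) (us t))) ∧
      -- free end point
      (S = Set.univ → lam0 = 1) := by
  obtain ⟨P, hP0, hP1, rfl, rfl, rfl, rfl, hPC, rfl, hPx, hPr⟩ := exists_localProblem ht hF hf hφ hΦ
    hU hOm hS hε hR hmin hδ hRδ hCcpt hCQ
  subst hP0 hP1
  have hIcc : ∀ᵐ t ∂P.μ, t ∈ Icc P.t0 P.t1 := ae_restrict_mem measurableSet_Icc
  obtain ⟨E⟩ := P.nonempty_extremal hφ hF
  have hc₀ : P.c₀ = pl2 (xs.f P.t0) (xs.f P.t1) := by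
    rw [LocalProblem.c₀, hPx _ ⟨le_rfl, ht.le⟩, hPx _ ⟨ht.le, le_rfl⟩]
  have hws : ∀ t ∈ Icc P.t0 P.t1, P.ws t = pl2 (xs.f t) (P.us t) := fun t h => by
    rw [LocalProblem.ws, hPx t h]
  refine ⟨⟨E.p, E.w, E.intervalIntegrable_w, E.p_eq⟩, E.lam, E.lam_mem, E.nontrivial,
    hc₀ ▸ E.transversality, ?_, ?_, E.normal_of_free⟩
  · filter_upwards [E.euler, hIcc, hmin.1.2.1] with t h1 h2 h3
    rw [hws t h2, hPC] at h1
    refine exists_clarke_decomposition hΦ hU hOm (hCQ (t, xs.f t, P.us t)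
      (subset_closure ⟨h2, ?_, h3.2.2, h3.2.1, ?_⟩)).2 h1
    · simpa using hε.le
    · simp
  · filter_upwards [E.weierstrass, hIcc, hPr] with t h1 h2 h3 u hu hΦu hur
    have h4 : pl2 (xs.f t) u ∈ feasibleSet Φ Uset Om := ⟨hu, hΦu⟩
    have h5 := h1 u (by rw [hPx t h2, hPC]; exact h4) (h3 u h4 hur)
    rwa [hPx t h2, hws t h2] at h5

end ProblemP

end
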